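/- arXiv:2001.03265 — 3 statements merged into one kernel-verified Lean document; each statement's English description precedes it below -/
import Mathlib

section
/- Define the off-diagonal one-level sum I_1^1(N; α) = (1/#H_{2g+1}) ∑_{D ∈ H_{2g+1}} ∑_{f} Λ(f) χ_D(f) / |f|^{1/2+α}, where f runs over monic polynomials of degree at most N of the form f = P^{2k+1} with P monic irreducible and k ≥ 0. Then there is a constant C(q) such that for all integers g ≥ 1 and 1 ≤ N < 4g, and all complex α with |α| ≤ 1/g, | I_1^1(N; α) − 1_{N ≥ 2g} ( − ∑_{n=g+1}^{⌊N/2⌋} q^{−2nα} + q^{−2gα}/(q − 1) ) | ≤ C(q) ( N q^{N/2 − 2g} + q^{−g} ), where 1_{N ≥ 2g} is 1 if N ≥ 2g and 0 otherwise. -/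
open Polynomial UniqueFactorizationMonoid
open scoped Classical

noncomputable section

/-- The quadratic residue symbol `(a/P)` for `P` a monic irreducible polynomial:
`0` if `P ∣ a`, `1` if `a` is a nonzero square mod `P`, `-1` otherwise. -/
def resSym (q : ℕ) (a P : Polynomial (ZMod q)) : ℤ :=
  if P ∣ a then 0 else if ∃ b : Polynomial (ZMod q), P ∣ (a - b ^ 2) then 1 else -1

/-- The symbol `(a/b)`, extended multiplicatively over the monic irreducible factors
of `b` (with multiplicity); by convention `(a/0) = 0`.  In particular `χ_D(f) = (D/f)`
is `jacSym q D f`, and `χ_f(h) = (f/h)` is `jacSym q f h`. -/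
def jacSym (q : ℕ) [Fact q.Prime] (a b : Polynomial (ZMod q)) : ℤ :=
  if b = 0 then 0 else ((normalizedFactors b).map fun P => resSym q a P).prod

/-- The monic polynomial of degree `n` determined by the vector `v` of its
lower-order coefficients. -/
def monicOfDeg (q : ℕ) (n : ℕ) (v : Fin n → ZMod q) : Polynomial (ZMod q) :=
  X ^ n + ∑ i : Fin n, C (v i) * X ^ (i : ℕ)

/-- The polynomial of degree `< n` with coefficient vector `v`. -/
def polyLT (q : ℕ) (n : ℕ) (v : Fin n → ZMod q) : Polynomial (ZMod q) :=
  ∑ i : Fin n, C (v i) * X ^ (i : ℕ)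

/-- Sum of `F` over all monic polynomials of degree `m`; empty for `m < 0`. -/
def sumMonic (q : ℕ) [NeZero q] {M : Type*} [AddCommMonoid M] (m : ℤ)
    (F : Polynomial (ZMod q) → M) : M :=
  if 0 ≤ m then ∑ v : Fin m.toNat → ZMod q, F (monicOfDeg q m.toNat v) else 0

/-- Sum of `F` over all monic polynomials of degree `≤ n`; empty for `n < 0`. -/
def sumMonicLE (q : ℕ) [NeZero q] {M : Type*} [AddCommMonoid M] (n : ℤ)
    (F : Polynomial (ZMod q) → M) : M :=
  if 0 ≤ n then ∑ m ∈ Finset.range (n.toNat + 1), sumMonic q (m : ℤ) F else 0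

/-- Sum of `F` over the set `H_{2g+1}` of monic squarefree polynomials of degree `2g+1`. -/
def sumH (q : ℕ) [NeZero q] {M : Type*} [AddCommMonoid M] (g : ℕ)
    (F : Polynomial (ZMod q) → M) : M :=
  ∑ v : Fin (2 * g + 1) → ZMod q,
    if Squarefree (monicOfDeg q (2 * g + 1) v) then F (monicOfDeg q (2 * g + 1) v) else 0

/-- `e(a/f)` for monic `f`: the additive character `exp(2πi a₁/q)` where `a₁` is the
coefficient of `t⁻¹` in the expansion of `a/f` at infinity, namely the coefficient of
`t^{deg f - 1}` in `a mod f`. -/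
def ePoly (q : ℕ) (a f : Polynomial (ZMod q)) : ℂ :=
  Complex.exp (2 * Real.pi * Complex.I *
    (((a %ₘ f).coeff (f.natDegree - 1)).val : ℂ) / q)

/-- The generalized Gauss sum `G(V, f) = ∑_{u mod f} χ_f(u) e(uV/f)`, the sum running
over the residues `u` modulo `f`, i.e. the polynomials of degree `< deg f`. -/
def gaussS (q : ℕ) [Fact q.Prime] (V f : Polynomial (ZMod q)) : ℂ :=
  ∑ v : Fin f.natDegree → ZMod q,
    (jacSym q f (polyLT q f.natDegree v) : ℂ) * ePoly q (polyLT q f.natDegree v * V) f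

/-- The von Mangoldt function: `Λ(f) = deg P` if `f = P^k` with `P` monic irreducible
and `k ≥ 1`, and `0` otherwise. -/
def vM (q : ℕ) (f : Polynomial (ZMod q)) : ℕ :=
  if h : ∃ P : Polynomial (ZMod q), (∃ k : ℕ, 1 ≤ k ∧ f = P ^ k) ∧ P.Monic ∧ Irreducible P
  then h.choose.natDegree else 0

/-- The monic irreducible polynomials of `F_q[t]`. -/
abbrev MonicIrr (q : ℕ) := {P : Polynomial (ZMod q) // P.Monic ∧ Irreducible P}

/-- `B(α) = ∑_P d(P) / ((|P|^{1+2α} - 1)(|P| + 1))`, over monic irreducible `P`. -/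
def Bsum (q : ℕ) (α : ℂ) : ℂ :=
  ∑' P : MonicIrr q, (P.1.natDegree : ℂ) /
    (((q : ℂ) ^ ((P.1.natDegree : ℂ) * (1 + 2 * α)) - 1) * ((q : ℂ) ^ P.1.natDegree + 1))

end

section Stepanov

variable {K : Type*} [Field K]

/-- Sums of powers of `Y` with coefficients `w (r j)` vanish only trivially, as soon as `Y ∣ w t`
forces `t = 0`. -/
lemma eq_zero_of_sum_mul_pow_eq_zero {M : Type*} [AddCommGroup M] {Y : K[X]} (hY : Y ≠ 0)
    (w : M →+ K[X]) (S : Set M) (hw : ∀ t ∈ S, Y ∣ w t → t = 0) :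
    ∀ (J : ℕ) (r : Fin J → M), (∀ j, r j ∈ S) → ∑ j, w (r j) * Y ^ (j : ℕ) = 0 →
      ∀ j, r j = 0 := by
  intro J
  induction J with
  | zero => intro r _ _ j; exact j.elim0
  | succ J ih =>
    intro r hr hsum
    rw [Fin.sum_univ_succ] at hsum
    have e : ∑ i : Fin J, w (r i.succ) * Y ^ ((i.succ : Fin (J + 1)) : ℕ) =
        Y * ∑ i : Fin J, w (r i.succ) * Y ^ (i : ℕ) := by
      rw [Finset.mul_sum]
      refine Finset.sum_congr rfl fun i _ => ?_
      rw [Fin.val_succ, pow_succ]; ring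
    rw [e] at hsum
    have h0 : r 0 = 0 := by
      refine hw _ (hr 0) ⟨-∑ i : Fin J, w (r i.succ) * Y ^ (i : ℕ), ?_⟩
      simp only [Fin.val_zero, pow_zero, mul_one] at hsum
      linear_combination hsum
    rw [h0, map_zero, zero_mul, zero_add] at hsum
    have h1 := ih (fun i => r i.succ) (fun i => hr _) ((mul_eq_zero.mp hsum).resolve_left hY)
    intro j
    refine Fin.cases h0 (fun i => h1 i) j

/-- If `(X - x₀) ^ B'` with `B' = 2 n' + 1` a power of the characteristic divides
`r + s f ^ n'` and the degrees are small, then `r² f` is a nonzero constant times `s²`. -/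
lemma sq_mul_eq_of_dvd {p : ℕ} [Fact p.Prime] [CharP K p] {b n' : ℕ} (hn' : 2 * n' + 1 = p ^ b)
    (f : K[X]) (x₀ : K) {R : ℕ} (hR : 2 * R + f.natDegree ≤ p ^ b) {r s : K[X]}
    (hr : r.natDegree < R) (hs : s.natDegree < R)
    (hdvd : (X - C x₀) ^ p ^ b ∣ r + s * f ^ n') :
    r ^ 2 * f = C (f.eval x₀ ^ p ^ b) * s ^ 2 := by
  set Y : K[X] := (X - C x₀) ^ p ^ b with hY
  have hYmonic : Y.Monic := (monic_X_sub_C x₀).pow _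
  have hYdeg : Y.natDegree = p ^ b := by
    rw [hY, natDegree_pow, natDegree_X_sub_C, mul_one]
  have h1 : Y ∣ f ^ p ^ b - C (f.eval x₀ ^ p ^ b) := by
    rw [C_pow, ← sub_pow_char_pow]
    exact pow_dvd_pow_of_dvd (X_sub_C_dvd_sub_C_eval) _
  have h2 : Y ∣ r ^ 2 * f - s ^ 2 * f ^ p ^ b := by
    have : r ^ 2 * f - s ^ 2 * f ^ p ^ b = (r + s * f ^ n') * ((r - s * f ^ n') * f) := by
      rw [← hn']; ring
    rw [this]
    exact hdvd.mul_right _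
  have h3 : Y ∣ r ^ 2 * f - C (f.eval x₀ ^ p ^ b) * s ^ 2 := by
    have : r ^ 2 * f - C (f.eval x₀ ^ p ^ b) * s ^ 2 = (r ^ 2 * f - s ^ 2 * f ^ p ^ b) +
      (f ^ p ^ b - C (f.eval x₀ ^ p ^ b)) * s ^ 2 := by ring
    rw [this]
    exact dvd_add h2 (h1.mul_right _)
  by_contra hne
  have h4 := natDegree_le_of_dvd h3 (sub_ne_zero.mpr hne)
  have h5 : (r ^ 2 * f - C (f.eval x₀ ^ p ^ b) * s ^ 2).natDegree < p ^ b := by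
    refine lt_of_le_of_lt (natDegree_sub_le _ _) (max_lt ?_ ?_)
    · refine lt_of_le_of_lt natDegree_mul_le ?_
      have := natDegree_pow_le (p := r) (n := 2)
      omega
    · refine lt_of_le_of_lt (natDegree_C_mul_le _ _) ?_
      have := natDegree_pow_le (p := s) (n := 2)
      omega
  omega

lemma natDegree_lt_of_mem_degreeLT {R : ℕ} (hR : 0 < R) {r : K[X]} (hr : r ∈ degreeLT K R) :
    r.natDegree < R := by
  rw [mem_degreeLT] at hr
  by_cases h : r = 0
  · simpa [h] using hR
  · exact (natDegree_lt_iff_degree_lt h).mpr hr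

variable [Fintype K]

instance degreeLT.finite (n : ℕ) : Finite (degreeLT K n) :=
  Finite.of_equiv _ (degreeLTEquiv K n).toEquiv.symm

lemma card_degreeLT (n : ℕ) : Nat.card (degreeLT K n) = Fintype.card K ^ n := by
  rw [Nat.card_congr (degreeLTEquiv K n).toEquiv]
  simp

/-- Stepanov's argument with explicit parameters. -/
lemma card_pow_eq_le_of_params {p : ℕ} [Fact p.Prime] [CharP K p] {b b' n n' : ℕ}
    (hn : 2 * n + 1 = p ^ b) (hn' : 2 * n' + 1 = p ^ b')
    (hK : Fintype.card K = p ^ b * p ^ b') (f : K[X])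
    (hf : ∀ (r s : K[X]) (κ : K), κ ≠ 0 → r ^ 2 * f = C κ * s ^ 2 → r = 0 ∧ s = 0)
    {a x₀ : K} (ha : a ≠ 0) (hx₀ : f.eval x₀ ≠ 0) {J R : ℕ} (hR : 0 < R) (hJ : 0 < J)
    (hRB : 2 * R + f.natDegree ≤ p ^ b')
    (hJR : f.natDegree * n + p ^ b * R + J < 2 * J * R) :
    (Finset.univ.filter fun x : K => f.eval x ^ (n + p ^ b * n') = a).card ≤
      R + f.natDegree * n' + (J - 1) * p ^ b' := by
  set m := f.natDegree with hm
  let φ : (Fin J → degreeLT K R × degreeLT K R) → K[X] := fun t =>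
    ∑ j, (f ^ n * ((t j).1 : K[X]) ^ p ^ b + C a * ((t j).2 : K[X]) ^ p ^ b) *
      (X - C x₀) ^ (j : ℕ)
  have hφ : ∀ t, φ t ∈ degreeLT K (m * n + p ^ b * R + J) := by
    intro t
    refine Submodule.sum_mem _ fun j _ => ?_
    rw [mem_degreeLT]
    refine lt_of_le_of_lt degree_le_natDegree ?_
    have h1 := natDegree_lt_of_mem_degreeLT hR (t j).1.2
    have h2 := natDegree_lt_of_mem_degreeLT hR (t j).2.2
    have h3 : (f ^ n * ((t j).1 : K[X]) ^ p ^ b).natDegree ≤ m * n + p ^ b * R := by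
      refine natDegree_mul_le.trans (add_le_add ?_ ?_)
      · rw [mul_comm]; exact natDegree_pow_le
      · exact natDegree_pow_le.trans (Nat.mul_le_mul_left _ h1.le)
    have h4 : (C a * ((t j).2 : K[X]) ^ p ^ b).natDegree ≤ m * n + p ^ b * R := by
      refine (natDegree_C_mul_le _ _).trans (le_add_left ?_)
      exact natDegree_pow_le.trans (Nat.mul_le_mul_left _ h2.le)
    have h5 : ((X - C x₀ : K[X]) ^ (j : ℕ)).natDegree ≤ (j : ℕ) := by
      rw [natDegree_pow, natDegree_X_sub_C, mul_one]
    have h6 := (natDegree_mul_le (p := f ^ n * ((t j).1 : K[X]) ^ p ^ b +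
      C a * ((t j).2 : K[X]) ^ p ^ b) (q := (X - C x₀) ^ (j : ℕ)))
    have h7 := natDegree_add_le_of_degree_le h3 h4
    have := j.2
    exact Nat.cast_lt.mpr (by omega)
  obtain ⟨t₁, t₂, hne, heq⟩ : ∃ t₁ t₂, t₁ ≠ t₂ ∧ φ t₁ = φ t₂ := by
    by_contra! hcon
    have hinj : Function.Injective
        (fun t => (⟨φ t, hφ t⟩ : degreeLT K (m * n + p ^ b * R + J))) := by
      intro t₁ t₂ h
      by_contra hne
      exact hcon t₁ t₂ hne (congrArg Subtype.val h)
    have hc := Nat.card_le_card_of_injective _ hinj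
    rw [Nat.card_fun, Nat.card_prod, card_degreeLT, card_degreeLT, ← pow_add, ← pow_mul,
      Nat.card_eq_fintype_card, Fintype.card_fin] at hc
    have := (Nat.pow_le_pow_iff_right (Fintype.one_lt_card (α := K))).mp hc
    have e : (R + R) * J = 2 * J * R := by ring
    omega
  let t := t₁ - t₂
  have ht : t ≠ 0 := sub_ne_zero.mpr hne
  have hφt : φ t = 0 := by
    have : φ t = φ t₁ - φ t₂ := by
      simp only [φ, ← Finset.sum_sub_distrib]
      refine Finset.sum_congr rfl fun j _ => ?_
      simp only [t, Pi.sub_apply, Prod.fst_sub, Prod.snd_sub, Submodule.coe_sub,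
        sub_pow_char_pow]
      ring
    rw [this, heq, sub_self]
  let w : K[X] × K[X] →+ K[X] :=
    { toFun := fun u => u.1 + u.2 * f ^ n'
      map_zero' := by simp
      map_add' := fun u v => by simp only [Prod.fst_add, Prod.snd_add]; ring }
  let r : Fin J → K[X] × K[X] := fun j => ((t j).1, (t j).2)
  set Y : K[X] := (X - C x₀) ^ p ^ b' with hY
  let ρ : K[X] := ∑ j, w (r j) * Y ^ (j : ℕ)
  have hρ : ρ ≠ 0 := by
    intro h0
    apply ht
    have hY0 : Y ≠ 0 := pow_ne_zero _ (X_sub_C_ne_zero x₀)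
    have := eq_zero_of_sum_mul_pow_eq_zero hY0 w
      {u | u.1.natDegree < R ∧ u.2.natDegree < R} (fun u hu hdvd => ?_) J r
      (fun j => ⟨natDegree_lt_of_mem_degreeLT hR (t j).1.2,
        natDegree_lt_of_mem_degreeLT hR (t j).2.2⟩) h0
    · funext j
      have hj := this j
      simp only [r, Prod.mk_eq_zero, ZeroMemClass.coe_eq_zero] at hj
      exact Prod.ext hj.1 hj.2
    · have h1 := sq_mul_eq_of_dvd hn' f x₀ hRB hu.1 hu.2 hdvd
      have h2 := hf _ _ _ (pow_ne_zero _ hx₀) h1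
      exact Prod.ext h2.1 h2.2
  have hdeg : ρ.natDegree ≤ R + m * n' + (J - 1) * p ^ b' := by
    refine natDegree_sum_le_of_forall_le _ _ fun j _ => ?_
    have h1 := natDegree_lt_of_mem_degreeLT hR (t j).1.2
    have h2 := natDegree_lt_of_mem_degreeLT hR (t j).2.2
    have h3 : (w (r j)).natDegree ≤ R + m * n' := by
      refine natDegree_add_le_of_degree_le (by simp only [r]; omega) ?_
      refine natDegree_mul_le.trans (add_le_add h2.le ?_)
      rw [mul_comm]; exact natDegree_pow_le
    have h4 : (Y ^ (j : ℕ)).natDegree ≤ (J - 1) * p ^ b' := by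
      rw [hY, ← pow_mul, natDegree_pow, natDegree_X_sub_C, mul_one, mul_comm]
      exact Nat.mul_le_mul_right _ (by have := j.2; omega)
    exact natDegree_mul_le.trans (add_le_add h3 h4)
  refine le_trans ?_ hdeg
  refine le_trans (Finset.card_le_card ?_) ((Multiset.toFinset_card_le ρ.roots).trans
    (card_roots' ρ))
  intro x hx
  rw [Finset.mem_filter] at hx
  rw [Multiset.mem_toFinset, mem_roots hρ, IsRoot.def]
  have hfx : f.eval x ≠ 0 := by
    intro h0
    have hpos : n + p ^ b * n' ≠ 0 ∨ n + p ^ b * n' = 0 := ne_or_eq _ _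
    rcases hpos with h | h
    · rw [h0, zero_pow h] at hx
      exact ha hx.2.symm
    · have : Fintype.card K = 2 * (n + p ^ b * n') + 1 := by
        rw [hK]; nlinarith
      rw [h] at this
      have := Fintype.one_lt_card (α := K)
      omega
  have hpow : f.eval x ^ n * (ρ.eval x) ^ p ^ b = (φ t).eval x := by
    simp only [ρ, φ, eval_finsetSum, eval_mul]
    rw [sum_pow_char_pow, Finset.mul_sum]
    refine Finset.sum_congr rfl fun j _ => ?_
    have hY1 : (eval x (Y ^ (j : ℕ))) ^ p ^ b = (x - x₀) ^ (j : ℕ) := by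
      rw [hY]
      simp only [eval_pow, eval_sub, eval_X, eval_C]
      have e : p ^ b' * ((j : ℕ) * p ^ b) = Fintype.card K * j := by rw [hK]; ring
      rw [← pow_mul, ← pow_mul, e, pow_mul, FiniteField.pow_card]
    simp only [eval_pow, eval_add, eval_mul, eval_sub, eval_X, eval_C, mul_pow, w, r,
      AddMonoidHom.coe_mk, ZeroHom.coe_mk, add_pow_char_pow]
    simp only [eval_pow] at hY1
    rw [hY1, ← hx.2]
    ring
  rw [hφt, eval_zero] at hpow
  exact pow_eq_zero_iff (pow_ne_zero _ (Fact.out : p.Prime).ne_zero) |>.mp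
    ((mul_eq_zero.mp hpow).resolve_left (pow_ne_zero _ hfx))

end Stepanov

section Stepanov

variable {K : Type*} [Field K]

/-- A polynomial whose squarefree part is not constant is not a constant times the square of a
rational function. -/
lemma eq_zero_of_sq_mul_eq {g h : K[X]} (hg : g ≠ 0) (hh : Squarefree h) (hu : ¬ IsUnit h)
    (r s : K[X]) (κ : K) (hκ : κ ≠ 0) (hrs : r ^ 2 * (g ^ 2 * h) = C κ * s ^ 2) :
    r = 0 ∧ s = 0 := by
  by_cases hr : r = 0
  · refine ⟨hr, ?_⟩
    rw [hr] at hrs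
    simp only [ne_eq, OfNat.ofNat_ne_zero, not_false_eq_true, zero_pow, zero_mul] at hrs
    have := mul_eq_zero.mp hrs.symm
    exact pow_eq_zero_iff (two_ne_zero) |>.mp (this.resolve_left (C_ne_zero.mpr hκ))
  exfalso
  have hdvd : (r * g) ^ 2 ∣ s ^ 2 := by
    refine ⟨C κ⁻¹ * h, ?_⟩
    have : C κ⁻¹ * C κ = 1 := by rw [← C_mul, inv_mul_cancel₀ hκ, C_1]
    calc s ^ 2 = C κ⁻¹ * C κ * s ^ 2 := by rw [this, one_mul]
      _ = C κ⁻¹ * (C κ * s ^ 2) := by ring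
      _ = _ := by rw [← hrs]; ring
  obtain ⟨u, rfl⟩ := (UniqueFactorizationMonoid.pow_dvd_pow_iff_dvd two_ne_zero).mp hdvd
  have h1 : h = C κ * u ^ 2 := by
    have : (r * g) ^ 2 ≠ 0 := pow_ne_zero _ (mul_ne_zero hr hg)
    refine mul_left_cancel₀ this ?_
    linear_combination hrs
  have h2 : IsUnit u := hh u ⟨C κ, by rw [h1]; ring⟩
  exact hu (h1 ▸ (isUnit_C.mpr (isUnit_iff_ne_zero.mpr hκ)).mul (h2.pow 2))

variable [Fintype K]

/-- Stepanov's bound for the number of `x` with `f(x)` of given quadratic character. -/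
lemma card_pow_eq_le {p : ℕ} [Fact p.Prime] [CharP K p] (hp : p ≠ 2) {b b' : ℕ} (hbb : b ≤ b')
    (hK : Fintype.card K = p ^ b * p ^ b') (f : K[X])
    (hf : ∀ (r s : K[X]) (κ : K), κ ≠ 0 → r ^ 2 * f = C κ * s ^ 2 → r = 0 ∧ s = 0)
    {a : K} (ha : a ≠ 0) :
    2 * (Finset.univ.filter fun x : K => f.eval x ^ (Fintype.card K / 2) = a).card ≤
      Fintype.card K + 8 * (f.natDegree + 1) * p ^ b' := by
  have hpp : p.Prime := Fact.out
  obtain ⟨n, hn⟩ : ∃ n, 2 * n + 1 = p ^ b := by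
    obtain ⟨n, hn⟩ := (hpp.odd_of_ne_two hp).pow (n := b); exact ⟨n, hn.symm⟩
  obtain ⟨n', hn'⟩ : ∃ n, 2 * n + 1 = p ^ b' := by
    obtain ⟨n, hn⟩ := (hpp.odd_of_ne_two hp).pow (n := b'); exact ⟨n, hn.symm⟩
  have hBB : p ^ b ≤ p ^ b' := Nat.pow_le_pow_right hpp.pos hbb
  set B := p ^ b with hB
  set B' := p ^ b' with hB'
  set m := f.natDegree with hm
  rcases lt_or_ge B' (4 * (m + 1)) with hlt | hge
  · have h1 : (Finset.univ.filter fun x : K => f.eval x ^ (Fintype.card K / 2) = a).card ≤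
      Fintype.card K := Finset.card_le_univ _
    have h2 : Fintype.card K ≤ 8 * (m + 1) * B' := by
      rw [hK]
      exact Nat.mul_le_mul_right _ (by omega)
    omega
  have hf0 : f ≠ 0 := by
    rintro rfl
    have := hf 1 0 1 one_ne_zero (by simp)
    exact one_ne_zero this.1
  obtain ⟨x₀, hx₀⟩ : ∃ x, f.eval x ≠ 0 := by
    by_contra! hcon
    apply hf0
    refine eq_zero_of_natDegree_lt_card_of_eval_eq_zero' f Finset.univ (fun x _ => hcon x) ?_
    rw [Finset.card_univ, hK]
    have : 1 ≤ B := Nat.one_le_pow _ _ hpp.pos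
    nlinarith
  have hc : Fintype.card K / 2 = n + B * n' := by
    have : Fintype.card K = 2 * (n + B * n') + 1 := by rw [hK, ← hn', mul_add, ← hn]; ring
    omega
  have hR1 : 2 * ((B' - m) / 2) + m ≤ B' := by omega
  have hR2 : n' + 1 ≤ 2 * ((B' - m) / 2) - 1 := by omega
  set R := (B' - m) / 2 with hR
  have hJR : m * n + B * R + (n + 1 + (m + 1)) < 2 * (n + 1 + (m + 1)) * R := by
    have e : n + 1 ≤ 2 * R - 1 := by omega
    obtain ⟨u, hu⟩ : ∃ u, 2 * R = u + 1 := ⟨2 * R - 1, by omega⟩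
    have e1 : n + 1 ≤ u := by omega
    have e2 : (m + 1) * (n + 1) ≤ (m + 1) * u := Nat.mul_le_mul_left _ e1
    have e3 : B = 2 * n + 1 := hn.symm
    rw [e3]
    nlinarith
  have key := card_pow_eq_le_of_params (p := p) hn hn' hK f hf ha hx₀
    (J := n + 1 + (m + 1)) (R := R) (by omega) (by omega) hR1 hJR
  rw [hc]
  refine (Nat.mul_le_mul_left 2 key).trans ?_
  have e1 : n + 1 + (m + 1) - 1 = n + (m + 1) := by omega
  rw [e1, hK]
  have e4 : 2 * R ≤ B' := by omega
  have e5 : 2 * n' ≤ B' := by omega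
  have e6 : f.natDegree * (2 * n') ≤ m * B' := Nat.mul_le_mul_left _ e5
  change 2 * (R + m * n' + (n + (m + 1)) * B') ≤ B * B' + 8 * (m + 1) * B'
  have e3 : B = 2 * n + 1 := hn.symm
  rw [e3]
  nlinarith

/-- Weil's bound, up to a constant, for a quadratic character sum over a finite field. -/
lemma abs_sum_quadraticChar_le {p : ℕ} [Fact p.Prime] [CharP K p] (hp : p ≠ 2) {b b' : ℕ}
    (hbb : b ≤ b') (hK : Fintype.card K = p ^ b * p ^ b') (f : K[X])
    (hf : ∀ (r s : K[X]) (κ : K), κ ≠ 0 → r ^ 2 * f = C κ * s ^ 2 → r = 0 ∧ s = 0) :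
    |∑ x : K, quadraticChar K (f.eval x)| ≤ 9 * ((f.natDegree : ℤ) + 1) * p ^ b' := by
  have hpp : p.Prime := Fact.out
  have hchar : ringChar K ≠ 2 := by rwa [ringChar.eq K p]
  have h1 := card_pow_eq_le hp hbb hK f hf (a := 1) one_ne_zero
  have h2 := card_pow_eq_le hp hbb hK f hf (a := -1) (neg_ne_zero.mpr one_ne_zero)
  set N₁ := (Finset.univ.filter fun x : K => f.eval x ^ (Fintype.card K / 2) = 1).card with hN₁
  set N₂ := (Finset.univ.filter fun x : K => f.eval x ^ (Fintype.card K / 2) = -1).card with hN₂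
  set N₀ := (Finset.univ.filter fun x : K => f.eval x = 0).card with hN₀
  have hf0 : f ≠ 0 := by
    rintro rfl
    have := hf 1 0 1 one_ne_zero (by simp)
    exact one_ne_zero this.1
  have h0 : N₀ ≤ f.natDegree := by
    refine le_trans (Finset.card_le_card ?_) ((Multiset.toFinset_card_le f.roots).trans
      (card_roots' f))
    intro x hx
    rw [Finset.mem_filter] at hx
    rw [Multiset.mem_toFinset, mem_roots hf0]
    exact hx.2
  have hne : (-1 : K) ≠ 1 := Ring.neg_one_ne_one_of_char_ne_two hchar
  have hone : Fintype.card K / 2 ≠ 0 := by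
    have := FiniteField.odd_card_of_char_ne_two hchar
    have := Fintype.one_lt_card (α := K)
    omega
  have hpt : ∀ x : K, quadraticChar K (f.eval x) =
      (if f.eval x ^ (Fintype.card K / 2) = 1 then 1 else 0) -
        (if f.eval x ^ (Fintype.card K / 2) = -1 then 1 else 0) ∧
      (1 : ℤ) = (if f.eval x ^ (Fintype.card K / 2) = 1 then 1 else 0) +
        (if f.eval x ^ (Fintype.card K / 2) = -1 then 1 else 0) +
        (if f.eval x = 0 then 1 else 0) := by
    intro x
    by_cases hx : f.eval x = 0
    · rw [hx, zero_pow hone]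
      simp
    · rw [quadraticChar_eq_pow_of_char_ne_two hchar hx]
      rcases FiniteField.pow_dichotomy hchar hx with h | h
      · simp [h, hx, hne.symm]
      · simp [h, hx, hne]
  have hs1 : ∑ x : K, quadraticChar K (f.eval x) = (N₁ : ℤ) - N₂ := by
    rw [Finset.sum_congr rfl fun x _ => (hpt x).1, Finset.sum_sub_distrib]
    simp [hN₁, hN₂]
  have hs2 : (Fintype.card K : ℤ) = N₁ + N₂ + N₀ := by
    have : (Fintype.card K : ℤ) = ∑ x : K, (1 : ℤ) := by simp
    rw [this, Finset.sum_congr rfl fun x _ => (hpt x).2, Finset.sum_add_distrib,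
      Finset.sum_add_distrib]
    simp [hN₁, hN₂, hN₀]
  have hB : (1 : ℤ) ≤ p ^ b' := by exact_mod_cast Nat.one_le_pow _ _ hpp.pos
  zify at h1 h2 h0
  have h3 : (f.natDegree : ℤ) ≤ (f.natDegree + 1) * p ^ b' := by nlinarith
  rw [hs1, abs_le]
  constructor <;> linarith

end Stepanov

section Monics

variable {q : ℕ}

lemma coeff_polyLT (n : ℕ) (v : Fin n → ZMod q) (i : Fin n) : (polyLT q n v).coeff i = v i := by
  rw [polyLT, finsetSum_coeff]
  simp only [coeff_C_mul_X_pow, Fin.val_inj]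
  simp

lemma polyLT_injective (n : ℕ) : Function.Injective (polyLT q n) := by
  intro v w h
  funext i
  rw [← coeff_polyLT n v i, h, coeff_polyLT]

lemma monicOfDeg_injective (n : ℕ) : Function.Injective (monicOfDeg q n) := by
  intro v w h
  exact polyLT_injective n (add_left_cancel h)

lemma degree_polyLT_lt (n : ℕ) (v : Fin n → ZMod q) : (polyLT q n v).degree < n := by
  refine lt_of_le_of_lt (degree_sum_le _ _) ((Finset.sup_lt_iff (WithBot.bot_lt_coe n)).mpr ?_)
  intro i _
  exact lt_of_le_of_lt (degree_C_mul_X_pow_le _ _) (Nat.cast_lt.mpr i.2)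

lemma polyLT_coeff {n : ℕ} {f : (ZMod q)[X]} (hf : f.degree < n) :
    polyLT q n (fun i => f.coeff i) = f := by
  ext i
  by_cases hi : i < n
  · exact coeff_polyLT n _ ⟨i, hi⟩
  · have hi' : (n : WithBot ℕ) ≤ i := by exact_mod_cast not_lt.mp hi
    rw [coeff_eq_zero_of_degree_lt ((degree_polyLT_lt n _).trans_le hi'),
      coeff_eq_zero_of_degree_lt (hf.trans_le hi')]

variable [Fact q.Prime]

lemma monic_monicOfDeg (n : ℕ) (v : Fin n → ZMod q) :
    (monicOfDeg q n v).Monic ∧ (monicOfDeg q n v).natDegree = n := by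
  have h := degree_polyLT_lt n v
  refine ⟨monic_X_pow_add h, ?_⟩
  rw [monicOfDeg, natDegree_add_eq_left_of_degree_lt, natDegree_X_pow]
  rwa [degree_X_pow]

variable (q)

/-- The finset of monic polynomials of degree `n`. -/
noncomputable def monicsDeg (n : ℕ) : Finset (ZMod q)[X] :=
  Finset.univ.image (monicOfDeg q n)

/-- The finset of polynomials of degree less than `n`. -/
noncomputable def polysLT (n : ℕ) : Finset (ZMod q)[X] :=
  Finset.univ.image (polyLT q n)

variable {q}

lemma mem_polysLT {n : ℕ} {f : (ZMod q)[X]} : f ∈ polysLT q n ↔ f.degree < n := by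
  rw [polysLT, Finset.mem_image]
  constructor
  · rintro ⟨v, -, rfl⟩
    exact degree_polyLT_lt n v
  · intro h
    exact ⟨_, Finset.mem_univ _, polyLT_coeff h⟩

lemma mem_monicsDeg {n : ℕ} {f : (ZMod q)[X]} :
    f ∈ monicsDeg q n ↔ f.Monic ∧ f.natDegree = n := by
  rw [monicsDeg, Finset.mem_image]
  constructor
  · rintro ⟨v, -, rfl⟩
    exact monic_monicOfDeg n v
  · rintro ⟨hm, hd⟩
    have h : (f - X ^ n).degree < (n : WithBot ℕ) := by
      rw [← hd, ← degree_eq_natDegree hm.ne_zero]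
      refine degree_sub_lt_left ?_ hm.ne_zero ?_
      · rw [degree_X_pow, degree_eq_natDegree hm.ne_zero]
      · rw [hm.leadingCoeff, leadingCoeff_X_pow]
    refine ⟨_, Finset.mem_univ fun i => (f - X ^ n).coeff i, ?_⟩
    have := polyLT_coeff h
    rw [polyLT] at this
    rw [monicOfDeg, this]
    ring

lemma card_monicsDeg (n : ℕ) : (monicsDeg q n).card = q ^ n := by
  rw [monicsDeg, Finset.card_image_of_injective _ (monicOfDeg_injective n)]
  simp [ZMod.card]

lemma card_polysLT (n : ℕ) : (polysLT q n).card = q ^ n := by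
  rw [polysLT, Finset.card_image_of_injective _ (polyLT_injective n)]
  simp [ZMod.card]

lemma sum_monicOfDeg {M : Type*} [AddCommMonoid M] (n : ℕ) (F : (ZMod q)[X] → M) :
    ∑ v, F (monicOfDeg q n v) = ∑ f ∈ monicsDeg q n, F f := by
  rw [monicsDeg, Finset.sum_image (monicOfDeg_injective n).injOn]

lemma exists_sq_mul_squarefree (f : (ZMod q)[X]) (hf : f.Monic) :
    ∃ E F : (ZMod q)[X], E.Monic ∧ F.Monic ∧ Squarefree F ∧ f = E ^ 2 * F := by
  induction hn : f.natDegree using Nat.strong_induction_on generalizing f with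
  | _ n ih =>
    by_cases hsq : Squarefree f
    · exact ⟨1, f, monic_one, hf, hsq, by ring⟩
    · rw [Squarefree] at hsq
      push Not at hsq
      obtain ⟨x, ⟨y, hxy⟩, hx⟩ := hsq
      have hx0 : x ≠ 0 := by rintro rfl; simp at hxy; exact hf.ne_zero hxy
      set z := x * C x.leadingCoeff⁻¹ with hz
      have hzm : z.Monic := monic_mul_leadingCoeff_inv hx0
      have hc : C x.leadingCoeff⁻¹ * C x.leadingCoeff = (1 : (ZMod q)[X]) := by
        rw [← C_mul, inv_mul_cancel₀ (leadingCoeff_ne_zero.mpr hx0), C_1]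
      have hfz : f = z ^ 2 * (C x.leadingCoeff ^ 2 * y) := by
        rw [hxy, hz]
        linear_combination (-x ^ 2 * y) * (C x.leadingCoeff⁻¹ * C x.leadingCoeff + 1) * hc
      have hwm : (C x.leadingCoeff ^ 2 * y).Monic := (hzm.pow 2).of_mul_monic_left (hfz ▸ hf)
      have hzd : z.natDegree ≠ 0 := by
        intro h0
        have := eq_one_of_monic_natDegree_zero hzm h0
        exact hx (IsUnit.of_mul_eq_one _ this)
      have hd : f.natDegree = 2 * z.natDegree + (C x.leadingCoeff ^ 2 * y).natDegree := by
        conv_lhs => rw [hfz, (hzm.pow 2).natDegree_mul hwm, hzm.natDegree_pow]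
      obtain ⟨E, F, hE, hF, hFs, hEF⟩ := ih _ (by omega) _ hwm rfl
      exact ⟨z * E, F, hzm.mul hE, hF, hFs, by rw [hfz, hEF]; ring⟩

lemma dvd_of_sq_dvd_sq_mul_squarefree {E G F : (ZMod q)[X]} (hE : E ≠ 0) (hF : Squarefree F)
    (h : E ^ 2 ∣ G ^ 2 * F) : E ∣ G := by
  obtain ⟨a, b, c, hab, rfl, rfl⟩ := UniqueFactorizationMonoid.exists_reduced_factors E hE G
  have hc : c ^ 2 ≠ 0 := pow_ne_zero _ (left_ne_zero_of_mul hE)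
  rw [mul_pow, mul_pow, mul_assoc, mul_dvd_mul_iff_left hc] at h
  have h1 : a ^ 2 ∣ F := (hab.pow (m := 2) (n := 2)).dvd_of_dvd_mul_left h
  have h2 : IsUnit a := hF a (by rwa [← sq])
  exact mul_dvd_mul_left c h2.dvd

lemma sq_mul_squarefree_unique {E F E' F' : (ZMod q)[X]} (hE : E.Monic) (hE' : E'.Monic)
    (hF : Squarefree F) (hF' : Squarefree F') (h : E ^ 2 * F = E' ^ 2 * F') :
    E = E' ∧ F = F' := by
  have h1 : E ∣ E' := dvd_of_sq_dvd_sq_mul_squarefree hE.ne_zero hF' ⟨F, h.symm⟩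
  have h2 : E' ∣ E := dvd_of_sq_dvd_sq_mul_squarefree hE'.ne_zero hF ⟨F', h⟩
  have h3 : E = E' := eq_of_monic_of_associated hE hE' (associated_of_dvd_dvd h1 h2)
  subst h3
  exact ⟨rfl, mul_left_cancel₀ (pow_ne_zero 2 hE.ne_zero) h⟩

lemma sum_monicsDeg_eq_sum_sq_mul {M : Type*} [AddCommMonoid M] (n : ℕ) (G : (ZMod q)[X] → M) :
    ∑ D ∈ monicsDeg q n, G D = ∑ e ∈ Finset.range (n / 2 + 1), ∑ E ∈ monicsDeg q e,
      ∑ F ∈ (monicsDeg q (n - 2 * e)).filter Squarefree, G (E ^ 2 * F) := by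
  simp_rw [← Finset.sum_product']
  rw [Finset.sum_sigma']
  symm
  refine Finset.sum_nbij (fun t => t.2.1 ^ 2 * t.2.2) ?_ ?_ ?_ (fun _ _ => rfl)
  · rintro ⟨e, E, F⟩ h
    simp only [Finset.mem_sigma, Finset.mem_range, Finset.mem_product, Finset.mem_filter,
      mem_monicsDeg] at h ⊢
    obtain ⟨he, ⟨hE, hEd⟩, ⟨hF, hFd⟩, -⟩ := h
    refine ⟨(hE.pow 2).mul hF, ?_⟩
    rw [(hE.pow 2).natDegree_mul hF, hE.natDegree_pow, hEd, hFd]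
    omega
  · rintro ⟨e, E, F⟩ h ⟨e', E', F'⟩ h' heq
    simp only [Finset.coe_sigma, Set.mem_sigma_iff, Finset.mem_coe, Finset.mem_range,
      Finset.mem_product, Finset.mem_filter, mem_monicsDeg] at h h' heq
    obtain ⟨he, ⟨hE, hEd⟩, ⟨hF, hFd⟩, hFs⟩ := h
    obtain ⟨he', ⟨hE', hEd'⟩, ⟨hF', hFd'⟩, hFs'⟩ := h'
    obtain ⟨rfl, rfl⟩ := sq_mul_squarefree_unique hE hE' hFs hFs' heq
    rw [← hEd, ← hEd']
  · intro D hD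
    rw [Finset.mem_coe, mem_monicsDeg] at hD
    obtain ⟨E, F, hE, hF, hFs, rfl⟩ := exists_sq_mul_squarefree D hD.1
    have hd := hD.2
    rw [(hE.pow 2).natDegree_mul hF, hE.natDegree_pow] at hd
    refine ⟨⟨E.natDegree, E, F⟩, ?_, rfl⟩
    simp only [Finset.coe_sigma, Set.mem_sigma_iff, Finset.mem_coe, Finset.mem_range,
      Finset.mem_product, Finset.mem_filter, mem_monicsDeg]
    exact ⟨by omega, ⟨hE, trivial⟩, ⟨hF, by omega⟩, hFs⟩

end Monics

section ResidueSymbol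

variable {q : ℕ} [Fact q.Prime] {P : (ZMod q)[X]}

instance AdjoinRoot.finite_of_irreducible [hP : Fact (Irreducible P)] : Finite (AdjoinRoot P) := by
  have : Module.Finite (ZMod q) (AdjoinRoot P) :=
    (AdjoinRoot.powerBasis hP.out.ne_zero).finite
  exact Module.finite_of_finite (ZMod q)

noncomputable instance AdjoinRoot.fintype_of_irreducible [Fact (Irreducible P)] :
    Fintype (AdjoinRoot P) := Fintype.ofFinite _

lemma card_adjoinRoot [hP : Fact (Irreducible P)] :
    Fintype.card (AdjoinRoot P) = q ^ P.natDegree := by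
  have : Module.Finite (ZMod q) (AdjoinRoot P) :=
    (AdjoinRoot.powerBasis hP.out.ne_zero).finite
  rw [Module.card_eq_pow_finrank (K := ZMod q), ZMod.card,
    (AdjoinRoot.powerBasis hP.out.ne_zero).finrank, AdjoinRoot.powerBasis_dim]

lemma charP_adjoinRoot [Fact (Irreducible P)] : CharP (AdjoinRoot P) q :=
  charP_of_injective_algebraMap (algebraMap (ZMod q) (AdjoinRoot P)).injective q

lemma sum_adjoinRoot {M : Type*} [AddCommMonoid M] [Fact (Irreducible P)] (hPm : P.Monic)
    (G : AdjoinRoot P → M) :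
    ∑ x, G x = ∑ v ∈ polysLT q P.natDegree, G (AdjoinRoot.mk P v) := by
  symm
  refine Finset.sum_bij (fun v _ => AdjoinRoot.mk P v) (fun _ _ => Finset.mem_univ _) ?_ ?_
    (fun _ _ => rfl)
  · intro v hv w hw h
    rw [mem_polysLT, ← degree_eq_natDegree hPm.ne_zero] at hv hw
    rw [AdjoinRoot.mk_eq_mk] at h
    by_contra hne
    have h1 := degree_le_of_dvd h (sub_ne_zero.mpr hne)
    exact absurd (lt_of_le_of_lt (degree_sub_le v w) (max_lt hv hw)) (not_lt.mpr h1)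
  · intro x _
    obtain ⟨f, rfl⟩ := AdjoinRoot.mk_surjective x
    refine ⟨f %ₘ P, ?_, ?_⟩
    · rw [mem_polysLT, ← degree_eq_natDegree hPm.ne_zero]
      exact degree_modByMonic_lt f hPm
    · rw [AdjoinRoot.mk_eq_mk, ← dvd_neg, neg_sub]
      refine ⟨f /ₘ P, ?_⟩
      linear_combination -(modByMonic_add_div f P)

lemma resSym_eq_quadraticChar [Fact (Irreducible P)] (a : (ZMod q)[X]) :
    resSym q a P = quadraticChar (AdjoinRoot P) (AdjoinRoot.mk P a) := by
  have hsq : IsSquare (AdjoinRoot.mk P a) ↔ ∃ b : (ZMod q)[X], P ∣ a - b ^ 2 := by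
    constructor
    · rintro ⟨y, hy⟩
      obtain ⟨b, rfl⟩ := AdjoinRoot.mk_surjective y
      exact ⟨b, by rw [← AdjoinRoot.mk_eq_mk, hy, map_pow, sq]⟩
    · rintro ⟨b, hb⟩
      rw [← AdjoinRoot.mk_eq_mk] at hb
      exact ⟨AdjoinRoot.mk P b, by rw [hb, map_pow, sq]⟩
  rw [resSym, quadraticChar_apply, quadraticCharFun]
  simp only [AdjoinRoot.mk_eq_zero, hsq]

lemma resSym_mul (hP : Irreducible P) (a b : (ZMod q)[X]) :
    resSym q (a * b) P = resSym q a P * resSym q b P := by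
  have : Fact (Irreducible P) := ⟨hP⟩
  simp only [resSym_eq_quadraticChar, map_mul]

lemma resSym_sq (hP : Irreducible P) (a : (ZMod q)[X]) :
    resSym q (a ^ 2) P = if P ∣ a then 0 else 1 := by
  rw [sq, resSym_mul hP, resSym]
  split_ifs <;> rfl

lemma abs_resSym_le (a : (ZMod q)[X]) : |resSym q a P| ≤ 1 := by
  rw [resSym]
  split_ifs <;> simp

lemma ringChar_adjoinRoot_ne_two (hq : q ≠ 2) [Fact (Irreducible P)] :
    ringChar (AdjoinRoot P) ≠ 2 := by
  have := charP_adjoinRoot (P := P)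
  rwa [ringChar.eq (AdjoinRoot P) q]

lemma sum_resSym_add (hq : q ≠ 2) (hP : Irreducible P) (hPm : P.Monic) (a : (ZMod q)[X]) :
    ∑ v ∈ polysLT q P.natDegree, resSym q (a + v) P = 0 := by
  have : Fact (Irreducible P) := ⟨hP⟩
  simp only [resSym_eq_quadraticChar, map_add]
  have h := Equiv.sum_comp (Equiv.addLeft (AdjoinRoot.mk P a))
    (fun x => quadraticChar (AdjoinRoot P) x)
  simp only [Equiv.coe_addLeft] at h
  rw [← sum_adjoinRoot hPm fun x => quadraticChar (AdjoinRoot P) (AdjoinRoot.mk P a + x), h]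
  exact quadraticChar_sum_zero (ringChar_adjoinRoot_ne_two hq)

lemma resSym_C (hq : q ≠ 2) (hP : Irreducible P) {c : ZMod q} (hc : c ≠ 0) :
    resSym q (C c) P = quadraticChar (ZMod q) c ^ P.natDegree := by
  have : Fact (Irreducible P) := ⟨hP⟩
  have hchar := ringChar_adjoinRoot_ne_two (P := P) hq
  have hcharF : ringChar (ZMod q) ≠ 2 := by rwa [ZMod.ringChar_zmod_n]
  rw [resSym_eq_quadraticChar]
  have hc' : AdjoinRoot.mk P (C c) ≠ 0 := by
    rw [AdjoinRoot.mk_C]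
    simpa using hc
  have h1 := quadraticChar_eq_pow_of_char_ne_two' hchar (AdjoinRoot.mk P (C c))
  have h2 := quadraticChar_eq_pow_of_char_ne_two' hcharF c
  obtain ⟨k, hk⟩ : ∃ k, q = 2 * k + 1 := (Fact.out : q.Prime).odd_of_ne_two hq
  rw [ZMod.card] at h2
  have hk1 : q / 2 = k := by omega
  rw [hk1] at h2
  rw [card_adjoinRoot] at h1
  have hgeom : q ^ P.natDegree / 2 = k * ∑ i ∈ Finset.range P.natDegree, q ^ i := by
    have := Nat.geomSum_eq (m := q) (by have := (Fact.out : q.Prime).two_le; omega) P.natDegree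
    have h3 := (mul_geom_sum (q : ℤ) P.natDegree)
    have h4 : (q : ℤ) = 2 * k + 1 := by exact_mod_cast hk
    have h5 : ((q ^ P.natDegree : ℕ) : ℤ) =
        2 * ((k * ∑ i ∈ Finset.range P.natDegree, q ^ i : ℕ) : ℤ) + 1 := by
      push_cast
      rw [h4] at h3 ⊢
      linarith
    have h6 : q ^ P.natDegree = 2 * (k * ∑ i ∈ Finset.range P.natDegree, q ^ i) + 1 := by
      exact_mod_cast h5
    omega
  have hodd : ∀ n : ℕ, ∃ l, ∑ i ∈ Finset.range n, q ^ i = 2 * l + n := by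
    intro n
    induction n with
    | zero => exact ⟨0, rfl⟩
    | succ n ih =>
      obtain ⟨l, hl⟩ := ih
      obtain ⟨r, hr⟩ : ∃ r, q ^ n = 2 * r + 1 :=
        ((Fact.out : q.Prime).odd_of_ne_two hq).pow
      exact ⟨l + r, by rw [Finset.sum_range_succ, hl, hr]; ring⟩
  obtain ⟨l, hl⟩ := hodd P.natDegree
  have hε : quadraticChar (ZMod q) c ^ 2 = 1 := quadraticChar_sq_one hc
  have hinj : ((quadraticChar (AdjoinRoot P) (AdjoinRoot.mk P (C c)) : ℤ) : AdjoinRoot P) =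
      ((quadraticChar (ZMod q) c ^ P.natDegree : ℤ) : AdjoinRoot P) := by
    rw [h1, hgeom, AdjoinRoot.mk_C, pow_mul, ← map_pow, ← h2, hl, pow_add, pow_mul]
    rw [map_intCast, ← Int.cast_pow, hε, Int.cast_one, one_pow, one_mul, Int.cast_pow]
  have h01 : (1 : AdjoinRoot P) ≠ -1 := (Ring.neg_one_ne_one_of_char_ne_two hchar).symm
  rcases quadraticChar_dichotomy hc' with h | h <;>
    rcases quadraticChar_dichotomy hc with h' | h' <;>
    rcases neg_one_pow_eq_or ℤ P.natDegree with h'' | h'' <;>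
    rw [h, h'] at hinj ⊢ <;> simp_all

end ResidueSymbol

section Translation

variable {q : ℕ} [Fact q.Prime]

lemma sum_monicsDeg_eq_sum_polysLT {M : Type*} [AddCommMonoid M] (m : ℕ) (F : (ZMod q)[X] → M) :
    ∑ f ∈ monicsDeg q m, F f = ∑ v ∈ polysLT q m, F (X ^ m + v) := by
  rw [← sum_monicOfDeg, polysLT, Finset.sum_image (polyLT_injective m).injOn]
  rfl

lemma sum_polysLT_add {M : Type*} [AddCommMonoid M] {k : ℕ} {w : (ZMod q)[X]}
    (hw : w ∈ polysLT q k) (F : (ZMod q)[X] → M) :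
    ∑ v ∈ polysLT q k, F (v + w) = ∑ v ∈ polysLT q k, F v := by
  rw [mem_polysLT] at hw
  refine Finset.sum_nbij' (fun v => v + w) (fun v => v - w) ?_ ?_ (fun v _ => by ring)
    (fun v _ => by ring) (fun _ _ => rfl)
  · intro v hv
    rw [mem_polysLT] at hv ⊢
    exact (degree_add_le _ _).trans_lt (max_lt hv hw)
  · intro v hv
    rw [mem_polysLT] at hv ⊢
    exact (degree_sub_le _ _).trans_lt (max_lt hv hw)

lemma sum_monicsDeg_add {M : Type*} [AddCommMonoid M] {m k : ℕ} (hkm : k ≤ m)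
    {w : (ZMod q)[X]} (hw : w ∈ polysLT q k) (F : (ZMod q)[X] → M) :
    ∑ v ∈ monicsDeg q m, F (v + w) = ∑ v ∈ monicsDeg q m, F v := by
  have hw' : w ∈ polysLT q m := by
    rw [mem_polysLT] at hw ⊢
    exact hw.trans_le (by exact_mod_cast hkm)
  rw [sum_monicsDeg_eq_sum_polysLT, sum_monicsDeg_eq_sum_polysLT,
    ← sum_polysLT_add hw' fun v => F (X ^ m + v)]
  simp only [add_assoc]

end Translation

section CharSums

variable {q : ℕ} [Fact q.Prime] {P : (ZMod q)[X]}

/-- The sum of `χ_P` over monic polynomials of degree `m`. -/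
noncomputable def monicCharSum (q : ℕ) [Fact q.Prime] (m : ℕ) (P : (ZMod q)[X]) : ℤ :=
  ∑ D ∈ monicsDeg q m, resSym q D P

/-- The sum of `χ_P` over monic squarefree polynomials of degree `m`. -/
noncomputable def sqfreeCharSum (q : ℕ) [Fact q.Prime] (m : ℕ) (P : (ZMod q)[X]) : ℤ :=
  ∑ D ∈ (monicsDeg q m).filter Squarefree, resSym q D P

lemma monicCharSum_eq_zero (hq : q ≠ 2) (hP : Irreducible P) (hPm : P.Monic) {m : ℕ}
    (hm : P.natDegree ≤ m) : monicCharSum q m P = 0 := by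
  have h : ∑ w ∈ polysLT q P.natDegree, ∑ D ∈ monicsDeg q m, resSym q (D + w) P = 0 := by
    rw [Finset.sum_comm]
    exact Finset.sum_eq_zero fun D _ => sum_resSym_add hq hP hPm D
  rw [Finset.sum_congr rfl fun w hw => sum_monicsDeg_add hm hw fun D => resSym q D P,
    Finset.sum_const, card_polysLT, nsmul_eq_mul] at h
  refine (mul_eq_zero.mp h).resolve_left ?_
  have := (Fact.out : q.Prime).pos
  positivity

lemma card_filter_dvd_monicsDeg (hPm : P.Monic) (e : ℕ) :
    ((monicsDeg q e).filter (P ∣ ·)).card =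
      if P.natDegree ≤ e then q ^ (e - P.natDegree) else 0 := by
  split_ifs with h
  · rw [← card_monicsDeg (q := q) (e - P.natDegree)]
    symm
    refine Finset.card_nbij (fun f => P * f) ?_ ?_ ?_
    · intro f hf
      simp only [Finset.coe_filter, Finset.mem_coe, Set.mem_ofPred_eq, mem_monicsDeg] at hf ⊢
      refine ⟨⟨hPm.mul hf.1, ?_⟩, dvd_mul_right _ _⟩
      rw [hPm.natDegree_mul hf.1, hf.2]
      omega
    · intro f _ f' _ hff
      exact mul_left_cancel₀ hPm.ne_zero hff
    · intro f hf
      simp only [Finset.coe_filter, mem_monicsDeg, Set.mem_ofPred_eq] at hf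
      obtain ⟨⟨hfm, hfd⟩, c, rfl⟩ := hf
      have hc := hPm.of_mul_monic_left hfm
      refine ⟨c, ?_, rfl⟩
      rw [Finset.mem_coe, mem_monicsDeg]
      rw [hPm.natDegree_mul hc] at hfd
      exact ⟨hc, by omega⟩
  · rw [Finset.card_eq_zero, Finset.filter_eq_empty_iff]
    intro f hf hd
    rw [mem_monicsDeg] at hf
    have := natDegree_le_of_dvd hd hf.1.ne_zero
    omega

lemma sum_resSym_sq (hP : Irreducible P) (hPm : P.Monic) (e : ℕ) :
    ∑ E ∈ monicsDeg q e, resSym q (E ^ 2) P =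
      (q : ℤ) ^ e - if P.natDegree ≤ e then (q : ℤ) ^ (e - P.natDegree) else 0 := by
  have h1 : ∀ E : (ZMod q)[X], resSym q (E ^ 2) P = 1 - if P ∣ E then 1 else 0 := by
    intro E
    rw [resSym_sq hP]
    split_ifs <;> rfl
  simp only [h1]
  rw [Finset.sum_sub_distrib, Finset.sum_boole, card_filter_dvd_monicsDeg hPm, Finset.sum_const,
    card_monicsDeg]
  split_ifs <;> simp

lemma monicCharSum_eq_sum_sqfree (hP : Irreducible P) (hPm : P.Monic) (n : ℕ) :
    monicCharSum q n P = ∑ e ∈ Finset.range (n / 2 + 1),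
      ((q : ℤ) ^ e - if P.natDegree ≤ e then (q : ℤ) ^ (e - P.natDegree) else 0) *
        sqfreeCharSum q (n - 2 * e) P := by
  rw [monicCharSum, sum_monicsDeg_eq_sum_sq_mul]
  refine Finset.sum_congr rfl fun e _ => ?_
  simp only [resSym_mul hP]
  rw [← sum_resSym_sq hP hPm, sqfreeCharSum, Finset.sum_mul_sum]

lemma sqfreeCharSum_add_two (hP : Irreducible P) (hPm : P.Monic) (n : ℕ) :
    sqfreeCharSum q (n + 2) P = monicCharSum q (n + 2) P - q * monicCharSum q n P +
      if 2 * P.natDegree ≤ n + 2 then sqfreeCharSum q (n + 2 - 2 * P.natDegree) P else 0 := by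
  have hd : 0 < P.natDegree := hP.natDegree_pos
  rw [monicCharSum_eq_sum_sqfree hP hPm (n + 2), monicCharSum_eq_sum_sqfree hP hPm n,
    show (n + 2) / 2 + 1 = n / 2 + 1 + 1 by omega, Finset.sum_range_succ', Finset.mul_sum]
  have h0 : ¬ P.natDegree ≤ 0 := by omega
  rw [if_neg h0]
  have h1 : ∀ e ∈ Finset.range (n / 2 + 1),
      ((q : ℤ) ^ (e + 1) - if P.natDegree ≤ e + 1 then (q : ℤ) ^ (e + 1 - P.natDegree) else 0) *
        sqfreeCharSum q (n + 2 - 2 * (e + 1)) P =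
      q * (((q : ℤ) ^ e - if P.natDegree ≤ e then (q : ℤ) ^ (e - P.natDegree) else 0) *
        sqfreeCharSum q (n - 2 * e) P) -
        if e = P.natDegree - 1 then sqfreeCharSum q (n + 2 - 2 * P.natDegree) P else 0 := by
    intro e _
    rw [show n + 2 - 2 * (e + 1) = n - 2 * e by omega]
    rcases lt_trichotomy (e + 1) P.natDegree with h | h | h
    · rw [if_neg (by omega), if_neg (by omega), if_neg (by omega)]
      ring
    · rw [if_pos (by omega), if_neg (by omega), if_pos (by omega),
        show n + 2 - 2 * P.natDegree = n - 2 * e by omega,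
        show e + 1 - P.natDegree = 0 by omega]
      ring
    · rw [if_pos (by omega), if_pos (by omega), if_neg (by omega),
        show e + 1 - P.natDegree = e - P.natDegree + 1 by omega]
      ring
  rw [Finset.sum_congr rfl h1, Finset.sum_sub_distrib, Finset.sum_ite_eq']
  simp only [Finset.mem_range]
  by_cases h2 : 2 * P.natDegree ≤ n + 2
  · rw [if_pos h2, if_pos (by omega)]
    simp only [pow_zero, sub_zero, one_mul, mul_zero, Nat.sub_zero]
    ring
  · rw [if_neg h2, if_neg (by omega)]
    simp only [pow_zero, sub_zero, one_mul, mul_zero, Nat.sub_zero]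
    ring

lemma abs_sqfreeCharSum_le (m : ℕ) : |sqfreeCharSum q m P| ≤ (q : ℤ) ^ m := by
  calc |sqfreeCharSum q m P| ≤ ∑ D ∈ (monicsDeg q m).filter Squarefree, |resSym q D P| :=
        Finset.abs_sum_le_sum_abs _ _
    _ ≤ ∑ D ∈ (monicsDeg q m).filter Squarefree, (1 : ℤ) :=
        Finset.sum_le_sum fun D _ => abs_resSym_le D
    _ = (((monicsDeg q m).filter Squarefree).card : ℤ) := by simp
    _ ≤ ((monicsDeg q m).card : ℤ) := by exact_mod_cast Finset.card_filter_le _ _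
    _ = (q : ℤ) ^ m := by rw [card_monicsDeg]; push_cast; rfl

lemma abs_sqfreeCharSum_le_of_natDegree (hq : q ≠ 2) (hP : Irreducible P) (hPm : P.Monic) (m : ℕ) :
    |sqfreeCharSum q m P| ≤ (q : ℤ) ^ (P.natDegree + 1) := by
  have hd : 0 < P.natDegree := hP.natDegree_pos
  have hq1 : (1 : ℤ) ≤ q := by exact_mod_cast (Fact.out : q.Prime).one_le
  induction m using Nat.strong_induction_on with
  | _ m ih =>
    by_cases hm : m ≤ P.natDegree + 1
    · exact (abs_sqfreeCharSum_le m).trans (pow_le_pow_right₀ hq1 hm)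
    · obtain ⟨n, rfl⟩ : ∃ n, m = n + 2 := ⟨m - 2, by omega⟩
      rw [sqfreeCharSum_add_two hP hPm, monicCharSum_eq_zero hq hP hPm (by omega),
        monicCharSum_eq_zero hq hP hPm (by omega)]
      split_ifs
      · simpa using ih (n + 2 - 2 * P.natDegree) (by omega)
      · simp only [mul_zero, sub_zero, add_zero, abs_zero]
        positivity

end CharSums

section FunctionalEquation

variable {q : ℕ} [Fact q.Prime] {P : (ZMod q)[X]}

lemma sum_stdAddChar_polysLT (k : ℕ) (h : (ZMod q)[X] →+ ZMod q) :
    ∑ y ∈ polysLT q k, ZMod.stdAddChar (N := q) (h y) =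
      if ∀ y ∈ polysLT q k, h y = 0 then (q : ℂ) ^ k else 0 := by
  split_ifs with H
  · rw [Finset.sum_congr rfl fun y hy => by rw [H y hy, AddChar.map_zero_eq_one]]
    simp [card_polysLT]
  · push Not at H
    obtain ⟨w, hw, hne⟩ := H
    have h1 := sum_polysLT_add hw fun y => ZMod.stdAddChar (N := q) (h y)
    simp only [map_add, AddChar.map_add_eq_mul] at h1
    rw [← Finset.sum_mul] at h1
    have h2 : ZMod.stdAddChar (N := q) (h w) ≠ 1 := by
      intro h3
      rw [← AddChar.map_zero_eq_one (ZMod.stdAddChar (N := q))] at h3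
      exact hne (ZMod.injective_stdAddChar h3)
    by_contra h0
    exact h2 (mul_left_cancel₀ h0 (h1.trans (mul_one _).symm))

/-- The coefficient of `t ^ (deg P - 1)` in the residue of a polynomial modulo `P`. -/
noncomputable def resCoeff (P : (ZMod q)[X]) : (ZMod q)[X] →ₗ[ZMod q] ZMod q :=
  (lcoeff (ZMod q) (P.natDegree - 1)).comp (modByMonicHom P)

lemma resCoeff_of_mem (hPm : P.Monic) {a : (ZMod q)[X]} (ha : a ∈ polysLT q P.natDegree) :
    resCoeff P a = a.coeff (P.natDegree - 1) := by
  rw [mem_polysLT, ← degree_eq_natDegree hPm.ne_zero] at ha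
  rw [resCoeff, LinearMap.comp_apply, modByMonicHom_apply, (modByMonic_eq_self_iff hPm).mpr ha,
    lcoeff_apply]

/-- The residue pairing is perfect between polynomials of degree less than `k` and polynomials
modulo those of degree less than `deg P - k`. -/
lemma resCoeff_mul_eq_zero_iff (hPm : P.Monic) {k : ℕ} (hk : k ≤ P.natDegree) {c : ZMod q}
    (hc : c ≠ 0) {u : (ZMod q)[X]} (hu : u ∈ polysLT q P.natDegree) :
    (∀ y ∈ polysLT q k, resCoeff P (C c * u * y) = 0) ↔ u ∈ polysLT q (P.natDegree - k) := by
  constructor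
  · intro H
    by_contra hu'
    rw [mem_polysLT] at hu hu'
    have hu0 : u ≠ 0 := by
      rintro rfl
      simp at hu'
    rw [degree_eq_natDegree hu0, not_lt, Nat.cast_le] at hu'
    rw [degree_eq_natDegree hu0, Nat.cast_lt] at hu
    have h1 := H (X ^ (P.natDegree - 1 - u.natDegree)) (by
      rw [mem_polysLT, degree_X_pow, Nat.cast_lt]
      omega)
    rw [resCoeff_of_mem hPm, show P.natDegree - 1 = u.natDegree + (P.natDegree - 1 - u.natDegree) by
      omega, Nat.add_sub_cancel_left, coeff_mul_X_pow, coeff_C_mul] at h1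
    · exact mul_ne_zero hc (leadingCoeff_ne_zero.mpr hu0) h1
    · rw [mem_polysLT, mul_assoc, degree_C_mul hc, degree_mul, degree_X_pow,
        degree_eq_natDegree hu0, ← Nat.cast_add, Nat.cast_lt]
      omega
  · intro hu' y hy
    by_cases h0 : u * y = 0
    · rw [mul_assoc, h0, mul_zero, map_zero]
    have hu0 := left_ne_zero_of_mul h0
    have hy0 := right_ne_zero_of_mul h0
    rw [mem_polysLT, degree_eq_natDegree hu0, Nat.cast_lt] at hu'
    rw [mem_polysLT, degree_eq_natDegree hy0, Nat.cast_lt] at hy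
    have hd : (C c * u * y).degree = ((u.natDegree + y.natDegree : ℕ) : WithBot ℕ) := by
      rw [mul_assoc, degree_C_mul hc, degree_mul, degree_eq_natDegree hu0, degree_eq_natDegree hy0,
        Nat.cast_add]
    rw [resCoeff_of_mem hPm]
    · exact coeff_eq_zero_of_degree_lt (by rw [hd, Nat.cast_lt]; omega)
    · rw [mem_polysLT, hd, Nat.cast_lt]
      omega

lemma sum_stdAddChar_resCoeff_mul (hPm : P.Monic) {k : ℕ} (hk : k ≤ P.natDegree) {c : ZMod q}
    (hc : c ≠ 0) {u : (ZMod q)[X]} (hu : u ∈ polysLT q P.natDegree) :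
    ∑ y ∈ polysLT q k, ZMod.stdAddChar (N := q) (resCoeff P (C c * u * y)) =
      if u ∈ polysLT q (P.natDegree - k) then (q : ℂ) ^ k else 0 := by
  rw [← if_congr (resCoeff_mul_eq_zero_iff hPm hk hc hu) rfl rfl]
  exact sum_stdAddChar_polysLT k
    ((resCoeff P).toAddMonoidHom.comp (AddMonoidHom.mulLeft (C c * u)))

/-- The additive character of the residue field of `P` given by the top coefficient. -/
noncomputable def resAddChar (hPm : P.Monic) : AddChar (AdjoinRoot P) ℂ :=
  (ZMod.stdAddChar (N := q)).compAddMonoidHom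
    ((lcoeff (ZMod q) (P.natDegree - 1)).comp (AdjoinRoot.modByMonicHom hPm)).toAddMonoidHom

lemma resAddChar_mk (hPm : P.Monic) (a : (ZMod q)[X]) :
    resAddChar hPm (AdjoinRoot.mk P a) = ZMod.stdAddChar (N := q) (resCoeff P a) := by
  simp [resAddChar, resCoeff]

/-- The quadratic Gauss sum modulo `P`. -/
noncomputable def resGaussSum (P : (ZMod q)[X]) : ℂ :=
  ∑ u ∈ polysLT q P.natDegree, (resSym q u P : ℂ) * ZMod.stdAddChar (N := q) (resCoeff P u)

lemma sum_resSym_mul_stdAddChar (hq : q ≠ 2) (hP : Irreducible P) (hPm : P.Monic)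
    (y : (ZMod q)[X]) :
    ∑ u ∈ polysLT q P.natDegree, (resSym q u P : ℂ) *
      ZMod.stdAddChar (N := q) (resCoeff P (u * y)) = resSym q y P * resGaussSum P := by
  have : Fact (Irreducible P) := ⟨hP⟩
  have h1 : ∀ z, ∑ u ∈ polysLT q P.natDegree, (resSym q u P : ℂ) *
      ZMod.stdAddChar (N := q) (resCoeff P (u * z)) =
      ∑ x : AdjoinRoot P, (quadraticChar (AdjoinRoot P) x : ℂ) *
        resAddChar hPm (x * AdjoinRoot.mk P z) := by
    intro z
    rw [sum_adjoinRoot hPm]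
    simp only [resSym_eq_quadraticChar, ← map_mul, resAddChar_mk]
  have h2 : resGaussSum P = ∑ x : AdjoinRoot P, (quadraticChar (AdjoinRoot P) x : ℂ) *
        resAddChar hPm x := by
    have := h1 1
    simp only [mul_one, map_one] at this
    exact this
  rw [h1, h2, resSym_eq_quadraticChar]
  set w := AdjoinRoot.mk P y
  by_cases hw : w = 0
  · rw [hw]
    simp only [mul_zero, AddChar.map_zero_eq_one, mul_one, MulChar.map_zero, Int.cast_zero,
      zero_mul]
    rw [← Int.cast_sum, quadraticChar_sum_zero (ringChar_adjoinRoot_ne_two hq), Int.cast_zero]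
  · have h3 := Equiv.sum_comp (Equiv.mulRight₀ w hw) fun x =>
      (quadraticChar (AdjoinRoot P) w : ℂ) * ((quadraticChar (AdjoinRoot P) x : ℂ) *
        resAddChar hPm x)
    rw [Finset.mul_sum, ← h3]
    refine Finset.sum_congr rfl fun x _ => ?_
    change _ = (quadraticChar (AdjoinRoot P) w : ℂ) *
      ((quadraticChar (AdjoinRoot P) (x * w) : ℂ) * resAddChar hPm (x * w))
    rw [map_mul (quadraticChar (AdjoinRoot P)), Int.cast_mul]
    have h4 : ((quadraticChar (AdjoinRoot P) w : ℤ) : ℂ) ^ 2 = 1 := by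
      exact_mod_cast quadraticChar_sq_one hw
    linear_combination (-(quadraticChar (AdjoinRoot P) x : ℂ) * resAddChar hPm (x * w)) * h4

lemma pow_mul_monicCharSum (hq : q ≠ 2) (hP : Irreducible P) (hPm : P.Monic) {m : ℕ}
    (hm : m < P.natDegree) :
    (q : ℂ) ^ (P.natDegree - m) * monicCharSum q m P =
      resGaussSum P * ∑ y ∈ polysLT q (P.natDegree - m),
        ZMod.stdAddChar (N := q) (-y.coeff (P.natDegree - 1 - m)) * (resSym q y P : ℂ) := by
  have hX : X ^ m ∈ polysLT q P.natDegree := by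
    rw [mem_polysLT, degree_X_pow, Nat.cast_lt]
    exact hm
  have key : ∑ y ∈ polysLT q (P.natDegree - m), ∑ u ∈ polysLT q P.natDegree,
      (resSym q u P : ℂ) *
        ZMod.stdAddChar (N := q) (resCoeff P (C 1 * (u - X ^ m) * y)) =
      resGaussSum P * ∑ y ∈ polysLT q (P.natDegree - m),
        ZMod.stdAddChar (N := q) (-y.coeff (P.natDegree - 1 - m)) * (resSym q y P : ℂ) := by
    rw [Finset.mul_sum]
    refine Finset.sum_congr rfl fun y hy => ?_
    have h1 : resCoeff P (X ^ m * y) = y.coeff (P.natDegree - 1 - m) := by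
      rw [resCoeff_of_mem hPm, show P.natDegree - 1 = (P.natDegree - 1 - m) + m by omega,
        coeff_X_pow_mul, Nat.add_sub_cancel]
      rw [mem_polysLT] at hy ⊢
      by_cases hy0 : y = 0
      · simp [hy0]
      rw [degree_mul, degree_X_pow, degree_eq_natDegree hy0, ← Nat.cast_add, Nat.cast_lt]
      rw [degree_eq_natDegree hy0, Nat.cast_lt] at hy
      omega
    have h2 := sum_resSym_mul_stdAddChar hq hP hPm y
    rw [mul_left_comm, mul_comm (resGaussSum P), ← h2, Finset.mul_sum]
    refine Finset.sum_congr rfl fun u _ => ?_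
    rw [C_1, one_mul, sub_mul, map_sub, h1, sub_eq_add_neg, AddChar.map_add_eq_mul]
    ring
  rw [← key, Finset.sum_comm, monicCharSum]
  simp only [← Finset.mul_sum]
  have h3 : ∀ u ∈ polysLT q P.natDegree, (resSym q u P : ℂ) *
      ∑ y ∈ polysLT q (P.natDegree - m),
        ZMod.stdAddChar (N := q) (resCoeff P (C 1 * (u - X ^ m) * y)) =
      if u - X ^ m ∈ polysLT q m then (q : ℂ) ^ (P.natDegree - m) * resSym q u P else 0 := by
    intro u hu
    have hu' : u - X ^ m ∈ polysLT q P.natDegree := by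
      rw [mem_polysLT] at hu hX ⊢
      exact (degree_sub_le _ _).trans_lt (max_lt hu hX)
    rw [sum_stdAddChar_resCoeff_mul hPm (Nat.sub_le _ _) one_ne_zero hu',
      show P.natDegree - (P.natDegree - m) = m by omega]
    split_ifs <;> ring
  rw [Finset.sum_congr rfl h3, ← Finset.sum_filter, ← Finset.mul_sum, Int.cast_sum]
  congr 1
  refine Finset.sum_congr ?_ fun _ _ => rfl
  ext u
  rw [Finset.mem_filter, mem_monicsDeg, mem_polysLT, mem_polysLT]
  constructor
  · rintro ⟨hum, hud⟩
    have h4 : u.degree = m := by rw [degree_eq_natDegree hum.ne_zero, hud]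
    refine ⟨by rw [h4, Nat.cast_lt]; exact hm, ?_⟩
    rw [← h4]
    exact degree_sub_lt_left (by rw [h4, degree_X_pow]) hum.ne_zero
      (by rw [hum.leadingCoeff, leadingCoeff_X_pow])
  · rintro ⟨-, hu⟩
    have h5 : u = X ^ m + (u - X ^ m) := by ring
    rw [h5]
    refine ⟨monic_X_pow_add hu, ?_⟩
    rw [natDegree_add_eq_left_of_degree_lt, natDegree_X_pow]
    rwa [degree_X_pow]

end FunctionalEquation

section GaussSum

variable {q : ℕ} [Fact q.Prime] {P : (ZMod q)[X]}

/-- The common value of the quadratic Gauss sums modulo monic irreducible polynomials of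
degree `d`. -/
noncomputable def gaussConst (q d : ℕ) [Fact q.Prime] : ℂ :=
  ∑ x ∈ polysLT q (d - d / 2), ZMod.stdAddChar (N := q) ((x ^ 2).coeff (d - 1))

lemma two_ne_zero_zmod (hq : q ≠ 2) : (2 : ZMod q) ≠ 0 :=
  Ring.two_ne_zero (by rwa [ZMod.ringChar_zmod_n])

lemma resGaussSum_eq_sum_sq (hq : q ≠ 2) (hP : Irreducible P) (hPm : P.Monic) :
    resGaussSum P =
      ∑ x ∈ polysLT q P.natDegree, ZMod.stdAddChar (N := q) (resCoeff P (x ^ 2)) := by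
  have : Fact (Irreducible P) := ⟨hP⟩
  have hd : 0 < P.natDegree := hP.natDegree_pos
  have h0 : ∑ x : AdjoinRoot P, resAddChar hPm x = 0 := by
    rw [sum_adjoinRoot hPm]
    simp only [resAddChar_mk]
    have h1 : (1 : (ZMod q)[X]) ∈ polysLT q P.natDegree := by
      rw [mem_polysLT, degree_one]
      exact_mod_cast hd
    have h2 := sum_stdAddChar_resCoeff_mul hPm le_rfl one_ne_zero h1
    simp only [C_1, one_mul] at h2
    rw [h2, if_neg]
    simp [mem_polysLT]
  have h1 : resGaussSum P = ∑ x : AdjoinRoot P, (quadraticChar (AdjoinRoot P) x : ℂ) *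
      resAddChar hPm x := by
    rw [sum_adjoinRoot hPm, resGaussSum]
    simp only [resSym_eq_quadraticChar, resAddChar_mk]
  have h2 : ∑ x ∈ polysLT q P.natDegree, ZMod.stdAddChar (N := q) (resCoeff P (x ^ 2)) =
      ∑ x : AdjoinRoot P, resAddChar hPm (x ^ 2) := by
    rw [sum_adjoinRoot hPm]
    simp only [← map_pow, resAddChar_mk]
  have h3 : ∀ y : AdjoinRoot P,
      (((Finset.univ.filter fun x : AdjoinRoot P => x ^ 2 = y).card : ℕ) : ℂ) =
        (quadraticChar (AdjoinRoot P) y : ℂ) + 1 := by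
    intro y
    have := quadraticChar_card_sqrts (ringChar_adjoinRoot_ne_two (P := P) hq) y
    rw [Set.toFinset_ofPred] at this
    exact_mod_cast this
  have h4 : ∑ x : AdjoinRoot P, resAddChar hPm (x ^ 2) =
      ∑ y : AdjoinRoot P, ((quadraticChar (AdjoinRoot P) y : ℂ) + 1) * resAddChar hPm y := by
    rw [← Finset.sum_fiberwise_of_maps_to (s := Finset.univ) (t := Finset.univ)
      (g := fun x : AdjoinRoot P => x ^ 2) (fun _ _ => Finset.mem_univ _)]
    refine Finset.sum_congr rfl fun y _ => ?_
    rw [← h3, Finset.sum_congr rfl fun x hx => by rw [(Finset.mem_filter.mp hx).2],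
      Finset.sum_const, nsmul_eq_mul]
  rw [h2, h4, h1]
  simp only [add_mul, one_mul]
  rw [Finset.sum_add_distrib, h0, add_zero]

lemma resGaussSum_eq_gaussConst (hq : q ≠ 2) (hP : Irreducible P) (hPm : P.Monic) :
    resGaussSum P = gaussConst q P.natDegree := by
  have hd : 0 < P.natDegree := hP.natDegree_pos
  set d := P.natDegree with hd_def
  have hsq : ∀ k, 2 * k < d + 2 → ∀ x ∈ polysLT q k, x ^ 2 ∈ polysLT q d := by
    intro k hk x hx
    rw [mem_polysLT] at hx ⊢
    by_cases hx0 : x = 0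
    · simp [hx0]
    rw [degree_eq_natDegree hx0, Nat.cast_lt] at hx
    rw [degree_eq_natDegree (pow_ne_zero 2 hx0), natDegree_pow, Nat.cast_lt]
    omega
  have h1 : ∀ w ∈ polysLT q (d / 2), resCoeff P (w ^ 2) = 0 := by
    intro w hw
    rw [resCoeff_of_mem hPm (hsq _ (by omega) w hw)]
    by_cases hw0 : w = 0
    · simp [hw0]
    rw [mem_polysLT, degree_eq_natDegree hw0, Nat.cast_lt] at hw
    refine coeff_eq_zero_of_natDegree_lt ?_
    rw [natDegree_pow]
    omega
  have h2 : (q : ℂ) ^ (d / 2) * resGaussSum P = ∑ w ∈ polysLT q (d / 2), ∑ x ∈ polysLT q d,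
      ZMod.stdAddChar (N := q) (resCoeff P ((x + w) ^ 2)) := by
    rw [Finset.sum_congr rfl fun w hw => ?_, Finset.sum_const, card_polysLT, nsmul_eq_mul,
      Nat.cast_pow]
    have hw' : w ∈ polysLT q d := by
      rw [mem_polysLT] at hw ⊢
      exact hw.trans_le (by exact_mod_cast Nat.div_le_self d 2)
    rw [sum_polysLT_add hw' fun x => ZMod.stdAddChar (N := q) (resCoeff P (x ^ 2)),
      resGaussSum_eq_sum_sq hq hP hPm]
  have h3 : ∑ w ∈ polysLT q (d / 2), ∑ x ∈ polysLT q d,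
      ZMod.stdAddChar (N := q) (resCoeff P ((x + w) ^ 2)) =
      ∑ x ∈ polysLT q d, ZMod.stdAddChar (N := q) (resCoeff P (x ^ 2)) *
        ∑ w ∈ polysLT q (d / 2), ZMod.stdAddChar (N := q) (resCoeff P (C 2 * x * w)) := by
    rw [Finset.sum_comm]
    refine Finset.sum_congr rfl fun x _ => ?_
    rw [Finset.mul_sum]
    refine Finset.sum_congr rfl fun w hw => ?_
    have hC : (C 2 : (ZMod q)[X]) = 2 := map_ofNat C 2
    have hexp : (x + w) ^ 2 = x ^ 2 + (C 2 * x * w + w ^ 2) := by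
      rw [hC]
      ring
    rw [hexp, map_add (resCoeff P), map_add (resCoeff P), h1 w hw, add_zero, AddChar.map_add_eq_mul]
  have h4 : ∑ x ∈ polysLT q d, ZMod.stdAddChar (N := q) (resCoeff P (x ^ 2)) *
        ∑ w ∈ polysLT q (d / 2), ZMod.stdAddChar (N := q) (resCoeff P (C 2 * x * w)) =
      (q : ℂ) ^ (d / 2) * gaussConst q d := by
    rw [Finset.sum_congr rfl fun x hx => by
      rw [sum_stdAddChar_resCoeff_mul hPm (Nat.div_le_self d 2) (two_ne_zero_zmod hq) hx, mul_ite,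
        mul_zero], ← Finset.sum_filter, gaussConst, Finset.mul_sum]
    refine Finset.sum_congr ?_ fun x hx => ?_
    · ext x
      rw [Finset.mem_filter, and_iff_right_iff_imp, mem_polysLT, mem_polysLT]
      intro hx
      exact hx.trans_le (by exact_mod_cast Nat.sub_le d _)
    · rw [resCoeff_of_mem hPm (hsq _ (by omega) x hx), mul_comm]
  have hq0 : (q : ℂ) ^ (d / 2) ≠ 0 :=
    pow_ne_zero _ (by exact_mod_cast (Fact.out : q.Prime).ne_zero)
  exact mul_left_cancel₀ hq0 (by rw [h2, h3, h4])

lemma gaussConst_even {d : ℕ} (hd : 0 < d) (he : Even d) : gaussConst q d = (q : ℂ) ^ (d / 2) := by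
  obtain ⟨k, rfl⟩ := he
  rw [gaussConst, Finset.sum_congr rfl fun x hx => ?_, Finset.sum_const, card_polysLT,
    nsmul_eq_mul, mul_one, Nat.cast_pow, show k + k - (k + k) / 2 = (k + k) / 2 by omega]
  rw [coeff_eq_zero_of_degree_lt, AddChar.map_zero_eq_one]
  by_cases hx0 : x = 0
  · simp [hx0]
  rw [mem_polysLT, degree_eq_natDegree hx0, Nat.cast_lt] at hx
  rw [degree_eq_natDegree (pow_ne_zero 2 hx0), natDegree_pow, Nat.cast_lt]
  omega

lemma norm_gaussConst_le (d : ℕ) : ‖gaussConst q d‖ ≤ (q : ℝ) ^ (d - d / 2) := by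
  refine (norm_sum_le _ _).trans ?_
  simp [AddChar.norm_apply, card_polysLT]

/-- Nonzero polynomials of degree less than `k` are nonzero multiples of monic ones. -/
lemma sum_polysLT_eq_sum_monics {M : Type*} [AddCommMonoid M] (k : ℕ) (F : (ZMod q)[X] → M) :
    ∑ y ∈ polysLT q k, F y = F 0 + ∑ j ∈ Finset.range k, ∑ D ∈ monicsDeg q j,
      ∑ c ∈ Finset.univ.erase (0 : ZMod q), F (C c * D) := by
  have h0 : (0 : (ZMod q)[X]) ∈ polysLT q k := by
    simp [mem_polysLT]
  rw [← Finset.add_sum_erase _ _ h0]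
  congr 1
  simp_rw [← Finset.sum_product']
  rw [Finset.sum_sigma']
  symm
  refine Finset.sum_bij' (fun t _ => C t.2.2 * t.2.1)
    (fun y _ => ⟨y.natDegree, (C y.leadingCoeff⁻¹ * y, y.leadingCoeff)⟩) ?_ ?_ ?_ ?_
    (fun _ _ => rfl)
  · rintro ⟨j, D, c⟩ h
    simp only [Finset.mem_sigma, Finset.mem_range, Finset.mem_product, Finset.mem_erase,
      mem_monicsDeg, Finset.mem_univ, and_true, mem_polysLT] at h ⊢
    obtain ⟨hj, ⟨hD, rfl⟩, hc⟩ := h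
    refine ⟨mul_ne_zero (C_ne_zero.mpr hc) hD.ne_zero, ?_⟩
    rw [degree_C_mul hc, degree_eq_natDegree hD.ne_zero, Nat.cast_lt]
    exact hj
  · intro y hy
    rw [Finset.mem_erase, mem_polysLT] at hy
    obtain ⟨hy0, hy⟩ := hy
    rw [degree_eq_natDegree hy0, Nat.cast_lt] at hy
    simp only [Finset.mem_sigma, Finset.mem_range, Finset.mem_product, Finset.mem_erase,
      mem_monicsDeg, Finset.mem_univ, and_true]
    refine ⟨hy, ⟨?_, ?_⟩, leadingCoeff_ne_zero.mpr hy0⟩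
    · rw [mul_comm]
      exact monic_mul_leadingCoeff_inv hy0
    · rw [natDegree_C_mul (inv_ne_zero (leadingCoeff_ne_zero.mpr hy0))]
  · rintro ⟨j, D, c⟩ h
    simp only [Finset.mem_sigma, Finset.mem_range, Finset.mem_product, Finset.mem_erase,
      mem_monicsDeg, Finset.mem_univ, and_true] at h
    obtain ⟨hj, ⟨hD, rfl⟩, hc⟩ := h
    have h1 : (C c * D).leadingCoeff = c := by
      rw [leadingCoeff_mul, leadingCoeff_C, hD.leadingCoeff, mul_one]
    have h2 : C c⁻¹ * (C c * D) = D := by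
      rw [← mul_assoc, ← C_mul, inv_mul_cancel₀ hc, C_1, one_mul]
    simp only [h1, h2, natDegree_C_mul hc]
  · intro y hy
    rw [Finset.mem_erase] at hy
    change C y.leadingCoeff * (C y.leadingCoeff⁻¹ * y) = y
    rw [← mul_assoc, ← C_mul, mul_inv_cancel₀ (leadingCoeff_ne_zero.mpr hy.1), C_1, one_mul]

/-- The coefficients in the functional equation for `monicCharSum`. -/
noncomputable def funEqCoeff (q : ℕ) [Fact q.Prime] (d : ℕ) (top : Prop) : ℂ :=
  ∑ c ∈ Finset.univ.erase (0 : ZMod q), (quadraticChar (ZMod q) c : ℂ) ^ d *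
    if top then ZMod.stdAddChar (N := q) (-c) else 1

lemma monicCharSum_functional_equation (hq : q ≠ 2) (hP : Irreducible P) (hPm : P.Monic) {m : ℕ}
    (hm : m < P.natDegree) :
    (q : ℂ) ^ (P.natDegree - m) * monicCharSum q m P =
      gaussConst q P.natDegree * ∑ j ∈ Finset.range (P.natDegree - m),
        funEqCoeff q P.natDegree (j = P.natDegree - 1 - m) * monicCharSum q j P := by
  rw [pow_mul_monicCharSum hq hP hPm hm, resGaussSum_eq_gaussConst hq hP hPm,
    sum_polysLT_eq_sum_monics]
  have h0 : resSym q 0 P = 0 := by simp [resSym]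
  rw [h0, Int.cast_zero, mul_zero, zero_add]
  congr 1
  refine Finset.sum_congr rfl fun j hj => ?_
  rw [Finset.mem_range] at hj
  rw [monicCharSum, Int.cast_sum, Finset.mul_sum]
  refine Finset.sum_congr rfl fun D hD => ?_
  rw [mem_monicsDeg] at hD
  rw [funEqCoeff, Finset.sum_mul]
  refine Finset.sum_congr rfl fun c hc => ?_
  rw [resSym_mul hP, resSym_C hq hP (Finset.ne_of_mem_erase hc), coeff_C_mul]
  have h1 : ZMod.stdAddChar (N := q) (-(c * D.coeff (P.natDegree - 1 - m))) =
      if j = P.natDegree - 1 - m then ZMod.stdAddChar (N := q) (-c) else 1 := by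
    split_ifs with h
    · rw [← h, ← hD.2, hD.1.coeff_natDegree, mul_one]
    · rw [coeff_eq_zero_of_natDegree_lt (by omega), mul_zero, neg_zero, AddChar.map_zero_eq_one]
  rw [h1]
  push_cast
  split_ifs <;> ring

lemma sum_stdAddChar_erase_zero :
    ∑ c ∈ Finset.univ.erase (0 : ZMod q), ZMod.stdAddChar (N := q) (-c) = -1 := by
  have h1 : ∑ c : ZMod q, ZMod.stdAddChar (N := q) (-c) = 0 := by
    refine (Equiv.sum_comp (Equiv.neg (ZMod q)) fun c => ZMod.stdAddChar (N := q) c).trans ?_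
    rw [AddChar.sum_eq_zero_iff_ne_zero]
    intro h
    have := ZMod.injective_stdAddChar (N := q) (a₁ := 0) (a₂ := 1) (by simp [h])
    exact zero_ne_one this
  rw [← Finset.add_sum_erase _ _ (Finset.mem_univ 0), neg_zero, AddChar.map_zero_eq_one] at h1
  linear_combination h1

lemma quadraticChar_pow_even {d : ℕ} (hd : Even d) {c : ZMod q} (hc : c ≠ 0) :
    (quadraticChar (ZMod q) c : ℂ) ^ d = 1 := by
  obtain ⟨k, rfl⟩ := hd
  rw [← two_mul, pow_mul]
  have : ((quadraticChar (ZMod q) c : ℤ) : ℂ) ^ 2 = 1 := by exact_mod_cast quadraticChar_sq_one hc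
  rw [this, one_pow]

lemma funEqCoeff_even_top {d : ℕ} (hd : Even d) {top : Prop} (h : top) :
    funEqCoeff q d top = -1 := by
  rw [funEqCoeff, ← sum_stdAddChar_erase_zero (q := q)]
  refine Finset.sum_congr rfl fun c hc => ?_
  rw [quadraticChar_pow_even hd (Finset.ne_of_mem_erase hc), if_pos h, one_mul]

lemma funEqCoeff_even_not_top {d : ℕ} (hd : Even d) {top : Prop} (h : ¬top) :
    funEqCoeff q d top = (q : ℂ) - 1 := by
  rw [funEqCoeff, Finset.sum_congr rfl fun c hc => by
    rw [quadraticChar_pow_even hd (Finset.ne_of_mem_erase hc), if_neg h, one_mul],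
    Finset.sum_const, Finset.card_erase_of_mem (Finset.mem_univ _), Finset.card_univ, ZMod.card,
    nsmul_eq_mul, mul_one, Nat.cast_sub (Fact.out : q.Prime).one_le, Nat.cast_one]

lemma funEqCoeff_odd_not_top (hq : q ≠ 2) {d : ℕ} (hd : Odd d) {top : Prop} (h : ¬top) :
    funEqCoeff q d top = 0 := by
  obtain ⟨k, rfl⟩ := hd
  have h1 : ∀ c ∈ Finset.univ.erase (0 : ZMod q),
      ((quadraticChar (ZMod q) c : ℂ) ^ (2 * k + 1) *
        if top then ZMod.stdAddChar (N := q) (-c) else 1) = quadraticChar (ZMod q) c := by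
    intro c hc
    rw [if_neg h, pow_succ, quadraticChar_pow_even (even_two_mul k) (Finset.ne_of_mem_erase hc),
      one_mul, mul_one]
  have h2 := quadraticChar_sum_zero (F := ZMod q) (by rwa [ZMod.ringChar_zmod_n])
  rw [← Finset.add_sum_erase _ _ (Finset.mem_univ 0), MulChar.map_zero, zero_add] at h2
  rw [funEqCoeff, Finset.sum_congr rfl h1, ← Int.cast_sum, h2, Int.cast_zero]

lemma norm_funEqCoeff_le (d : ℕ) (top : Prop) : ‖funEqCoeff q d top‖ ≤ q := by
  refine (norm_sum_le _ _).trans ?_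
  have h1 : ∀ c ∈ Finset.univ.erase (0 : ZMod q),
      ‖(quadraticChar (ZMod q) c : ℂ) ^ d *
        if top then ZMod.stdAddChar (N := q) (-c) else 1‖ ≤ 1 := by
    intro c hc
    have h2 : ‖(if top then ZMod.stdAddChar (N := q) (-c) else 1 : ℂ)‖ = 1 := by
      split_ifs <;> simp [AddChar.norm_apply]
    rw [norm_mul, norm_pow, h2, mul_one]
    rcases quadraticChar_dichotomy (Finset.ne_of_mem_erase hc) with h | h <;> simp [h]
  refine (Finset.sum_le_card_nsmul _ _ _ h1).trans ?_
  rw [nsmul_eq_mul, mul_one]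
  exact_mod_cast (Finset.card_erase_le).trans (by rw [Finset.card_univ, ZMod.card])

end GaussSum

section PrimeSums

variable {q : ℕ} [Fact q.Prime]

/-- The monic irreducible polynomials of degree `d`. -/
noncomputable def irrDeg (q d : ℕ) [Fact q.Prime] : Finset (ZMod q)[X] :=
  (monicsDeg q d).filter Irreducible

lemma mem_irrDeg {d : ℕ} {P : (ZMod q)[X]} :
    P ∈ irrDeg q d ↔ P.Monic ∧ Irreducible P ∧ P.natDegree = d := by
  rw [irrDeg, Finset.mem_filter, mem_monicsDeg]
  tauto

section Points

variable {K : Type*} [Field K] [Fintype K] [Algebra (ZMod q) K] {d : ℕ}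

lemma finrank_eq_of_card (hK : Fintype.card K = q ^ d) : Module.finrank (ZMod q) K = d := by
  rw [Module.card_eq_pow_finrank (K := ZMod q), ZMod.card] at hK
  exact Nat.pow_right_injective (Fact.out : q.Prime).two_le hK

lemma exists_aeval_eq (hK : Fintype.card K = q ^ d) {x : K}
    (hx : (minpoly (ZMod q) x).natDegree = d) (y : K) : ∃ b : (ZMod q)[X], aeval x b = y := by
  have hxi : IsIntegral (ZMod q) x := Algebra.IsIntegral.isIntegral x
  have hinj : Set.InjOn (fun v : (ZMod q)[X] => aeval x v) (polysLT q d) := by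
    intro v hv w hw h
    rw [Finset.mem_coe, mem_polysLT] at hv hw
    have h1 : aeval x (v - w) = 0 := by
      rw [map_sub, sub_eq_zero]
      exact h
    rw [← minpoly.dvd_iff] at h1
    by_contra hne
    have h2 := degree_le_of_dvd h1 (sub_ne_zero.mpr hne)
    rw [degree_eq_natDegree (minpoly.ne_zero hxi), hx] at h2
    exact absurd ((degree_sub_le v w).trans_lt (max_lt hv hw)) (not_lt.mpr h2)
  have himg : (polysLT q d).image (fun v : (ZMod q)[X] => aeval x v) = Finset.univ := by
    rw [← Finset.card_eq_iff_eq_univ, Finset.card_image_of_injOn hinj, card_polysLT, hK]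
  have hy := Finset.mem_univ y
  rw [← himg, Finset.mem_image] at hy
  obtain ⟨b, -, hb⟩ := hy
  exact ⟨b, hb⟩

lemma quadraticChar_aeval (hK : Fintype.card K = q ^ d) {x : K}
    (hx : (minpoly (ZMod q) x).natDegree = d) (D : (ZMod q)[X]) :
    quadraticChar K (aeval x D) = resSym q D (minpoly (ZMod q) x) := by
  have hsq : IsSquare (aeval x D) ↔ ∃ b : (ZMod q)[X], minpoly (ZMod q) x ∣ D - b ^ 2 := by
    simp only [minpoly.dvd_iff, map_sub, map_pow, sub_eq_zero]
    constructor
    · rintro ⟨y, hy⟩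
      obtain ⟨b, rfl⟩ := exists_aeval_eq hK hx y
      exact ⟨b, by rw [hy, sq]⟩
    · rintro ⟨b, hb⟩
      exact ⟨aeval x b, by rw [hb, sq]⟩
  rw [resSym, quadraticChar_apply, quadraticCharFun]
  simp only [hsq, minpoly.dvd_iff]

lemma card_filter_minpoly_eq (hK : Fintype.card K = q ^ d) {P : (ZMod q)[X]}
    (hP : P ∈ irrDeg q d) :
    (Finset.univ.filter fun x : K => minpoly (ZMod q) x = P).card = d := by
  obtain ⟨hPm, hPi, hPd⟩ := mem_irrDeg.mp hP
  have : Fact (Irreducible P) := ⟨hPi⟩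
  have hcard : Fintype.card (AdjoinRoot P) = Fintype.card K := by
    rw [card_adjoinRoot, hPd, hK]
  have hcharA : CharP (AdjoinRoot P) q := charP_adjoinRoot
  have hcharK : CharP K q := charP_of_injective_algebraMap (algebraMap (ZMod q) K).injective q
  let e : AdjoinRoot P →ₐ[ZMod q] K := (FiniteField.algEquivOfCardEq q hcard).toAlgHom
  have hroot : aeval (e (AdjoinRoot.root P)) P = 0 := by
    rw [aeval_algHom_apply, AdjoinRoot.aeval_eq, AdjoinRoot.mk_self, map_zero]
  have hmin : ∀ x : K, aeval x P = 0 ↔ minpoly (ZMod q) x = P := by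
    intro x
    constructor
    · intro h
      exact (minpoly.eq_of_irreducible_of_monic hPi h hPm).symm
    · rintro rfl
      exact minpoly.aeval _ _
  have hsplit : (P.map (algebraMap (ZMod q) K)).Splits := by
    rw [← (hmin _).mp hroot]
    exact Normal.splits inferInstance _
  have hsep : P.Separable := PerfectField.separable_of_irreducible hPi
  have h1 := card_rootSet_eq_natDegree hsep hsplit
  rw [hPd] at h1
  rw [← h1, ← Set.toFinset_card]
  congr 1
  ext x
  rw [Finset.mem_filter, Set.mem_toFinset, mem_rootSet]
  simp [hmin, hPm.ne_zero]

lemma sum_filter_minpoly (hK : Fintype.card K = q ^ d) (H : (ZMod q)[X] → ℤ) :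
    ∑ x ∈ Finset.univ.filter (fun x : K => (minpoly (ZMod q) x).natDegree = d),
      H (minpoly (ZMod q) x) = ∑ P ∈ irrDeg q d, (d : ℤ) * H P := by
  have hmaps : ∀ x ∈ Finset.univ.filter (fun x : K => (minpoly (ZMod q) x).natDegree = d),
      minpoly (ZMod q) x ∈ irrDeg q d := by
    intro x hx
    have hxi : IsIntegral (ZMod q) x := Algebra.IsIntegral.isIntegral x
    exact mem_irrDeg.mpr ⟨minpoly.monic hxi, minpoly.irreducible hxi, (Finset.mem_filter.mp hx).2⟩
  rw [← Finset.sum_fiberwise_of_maps_to hmaps]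
  refine Finset.sum_congr rfl fun P hP => ?_
  rw [Finset.sum_congr rfl fun x hx => by rw [(Finset.mem_filter.mp hx).2], Finset.sum_const,
    nsmul_eq_mul, Finset.filter_filter]
  congr 2
  refine Eq.trans (congrArg Finset.card ?_) (card_filter_minpoly_eq hK hP)
  ext x
  simp only [Finset.mem_filter, Finset.mem_univ, true_and, and_iff_right_iff_imp]
  rintro rfl
  exact (mem_irrDeg.mp hP).2.2

lemma card_filter_minpoly_ne_le (hK : Fintype.card K = q ^ d) (hd : 0 < d) :
    (Finset.univ.filter fun x : K => ¬(minpoly (ZMod q) x).natDegree = d).card ≤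
      2 * d * q ^ (d / 2) := by
  have hsub : (Finset.univ.filter fun x : K => ¬(minpoly (ZMod q) x).natDegree = d) ⊆
      (Finset.range (d / 2 + 1)).biUnion fun e => (monicsDeg q e).biUnion fun P =>
        (P.map (algebraMap (ZMod q) K)).roots.toFinset := by
    intro x hx
    have hxi : IsIntegral (ZMod q) x := Algebra.IsIntegral.isIntegral x
    have hne := (Finset.mem_filter.mp hx).2
    have hdvd := minpoly.degree_dvd hxi
    rw [finrank_eq_of_card hK] at hdvd
    simp only [Finset.mem_biUnion, Finset.mem_range, mem_monicsDeg]
    refine ⟨(minpoly (ZMod q) x).natDegree, ?_, minpoly (ZMod q) x, ⟨minpoly.monic hxi, rfl⟩, ?_⟩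
    · obtain ⟨k, hk⟩ := hdvd
      have hk2 : 2 ≤ k := by
        by_contra h
        interval_cases k <;> omega
      have : (minpoly (ZMod q) x).natDegree * 2 ≤ (minpoly (ZMod q) x).natDegree * k :=
        Nat.mul_le_mul_left _ hk2
      omega
    · rw [Multiset.mem_toFinset, mem_roots ((minpoly.monic hxi).map _).ne_zero, IsRoot.def,
        eval_map_algebraMap, minpoly.aeval]
  have hq2 := (Fact.out : q.Prime).two_le
  calc (Finset.univ.filter fun x : K => ¬(minpoly (ZMod q) x).natDegree = d).card
      ≤ ∑ e ∈ Finset.range (d / 2 + 1), ∑ P ∈ monicsDeg q e,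
          ((P.map (algebraMap (ZMod q) K)).roots.toFinset).card :=
        (Finset.card_le_card hsub).trans (Finset.card_biUnion_le.trans
          (Finset.sum_le_sum fun _ _ => Finset.card_biUnion_le))
    _ ≤ ∑ e ∈ Finset.range (d / 2 + 1), ∑ P ∈ monicsDeg q e, d := by
        refine Finset.sum_le_sum fun e he => Finset.sum_le_sum fun P hP => ?_
        rw [Finset.mem_range] at he
        rw [mem_monicsDeg] at hP
        refine (Multiset.toFinset_card_le _).trans ((card_roots' _).trans ?_)
        rw [hP.1.natDegree_map, hP.2]
        omega
    _ = (∑ e ∈ Finset.range (d / 2 + 1), q ^ e) * d := by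
        simp only [Finset.sum_const, card_monicsDeg, smul_eq_mul, Finset.sum_mul]
    _ ≤ (2 * q ^ (d / 2)) * d := by
        gcongr
        have := Nat.geomSum_lt (m := q) (n := d / 2) (s := Finset.range (d / 2)) hq2 (by simp)
        rw [Finset.sum_range_succ]
        omega
    _ = 2 * d * q ^ (d / 2) := by ring

end Points

/-- The sum of `d(P) χ_P(D)` over monic irreducible `P` of degree `d`. -/
noncomputable def primeCharSum (q d : ℕ) [Fact q.Prime] (D : (ZMod q)[X]) : ℤ :=
  ∑ P ∈ irrDeg q d, (d : ℤ) * resSym q D P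

lemma exists_field_card {d : ℕ} (hd : d ≠ 0) :
    ∃ (K : Type) (_ : Field K) (_ : Fintype K) (_ : Algebra (ZMod q) K),
      Fintype.card K = q ^ d := by
  have : Fintype (GaloisField q d) := Fintype.ofFinite _
  refine ⟨GaloisField q d, inferInstance, this, inferInstance, ?_⟩
  rw [← Nat.card_eq_fintype_card, GaloisField.card q d hd]

lemma card_irrDeg_le (d : ℕ) : d * (irrDeg q d).card ≤ q ^ d := by
  rcases Nat.eq_zero_or_pos d with rfl | hd
  · simp
  obtain ⟨K, _, _, _, hK⟩ := exists_field_card (q := q) hd.ne'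
  have h := sum_filter_minpoly hK fun _ => 1
  simp only [Finset.sum_const, nsmul_eq_mul, mul_one] at h
  have h1 : (irrDeg q d).card * d =
      (Finset.univ.filter fun x : K => (minpoly (ZMod q) x).natDegree = d).card := by
    exact_mod_cast h.symm
  rw [mul_comm, h1, ← hK]
  exact Finset.card_le_univ _

lemma le_card_irrDeg {d : ℕ} (hd : 0 < d) :
    q ^ d ≤ d * (irrDeg q d).card + 2 * d * q ^ (d / 2) := by
  obtain ⟨K, _, _, _, hK⟩ := exists_field_card (q := q) hd.ne'
  have h := sum_filter_minpoly hK fun _ => 1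
  simp only [Finset.sum_const, nsmul_eq_mul, mul_one] at h
  have h1 : (irrDeg q d).card * d =
      (Finset.univ.filter fun x : K => (minpoly (ZMod q) x).natDegree = d).card := by
    exact_mod_cast h.symm
  have h2 := card_filter_minpoly_ne_le hK hd
  have h3 := Finset.card_filter_add_card_filter_not (s := Finset.univ)
    fun x : K => (minpoly (ZMod q) x).natDegree = d
  rw [Finset.card_univ, hK] at h3
  rw [← h3, mul_comm d, h1]
  omega

lemma abs_primeCharSum_le (hq : q ≠ 2) {d : ℕ} {D : (ZMod q)[X]} (hD : D.Monic)
    (hdeg : D.natDegree < d) (hns : ¬IsSquare D) :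
    |primeCharSum q d D| ≤ 11 * d * (q : ℤ) ^ (d - d / 2) := by
  have hd : 0 < d := by omega
  obtain ⟨K, _, _, _, hK⟩ := exists_field_card (q := q) hd.ne'
  have hcharK : CharP K q := charP_of_injective_algebraMap (algebraMap (ZMod q) K).injective q
  obtain ⟨E, F, hE, hF, hFs, rfl⟩ := exists_sq_mul_squarefree D hD
  have hF1 : ¬IsUnit F := by
    intro h
    rw [hF.isUnit_iff] at h
    exact hns ⟨E, by rw [h, mul_one, sq]⟩
  set φ := algebraMap (ZMod q) K
  have hweil := abs_sum_quadraticChar_le (K := K) (p := q) hq (b := d / 2) (b' := d - d / 2)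
    (by omega) (by rw [hK, ← pow_add]; congr 1; omega) ((E ^ 2 * F).map φ) (by
      intro r s κ hκ hrs
      rw [Polynomial.map_mul, Polynomial.map_pow] at hrs
      refine eq_zero_of_sq_mul_eq (hE.map φ).ne_zero ?_ ?_ r s κ hκ hrs
      · exact ((PerfectField.separable_iff_squarefree.mpr hFs).map).squarefree
      · rwa [isUnit_map])
  rw [hE.pow 2 |>.mul hF |>.natDegree_map] at hweil
  set D := E ^ 2 * F
  have hsplit := Finset.sum_filter_add_sum_filter_not Finset.univ
    (fun x : K => (minpoly (ZMod q) x).natDegree = d) fun x => quadraticChar K ((D.map φ).eval x)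
  have h1 : ∑ x ∈ Finset.univ.filter (fun x : K => (minpoly (ZMod q) x).natDegree = d),
      quadraticChar K ((D.map φ).eval x) = primeCharSum q d D := by
    rw [primeCharSum, ← sum_filter_minpoly hK]
    refine Finset.sum_congr rfl fun x hx => ?_
    rw [eval_map_algebraMap, quadraticChar_aeval hK (Finset.mem_filter.mp hx).2]
  have h2 : |∑ x ∈ Finset.univ.filter (fun x : K => ¬(minpoly (ZMod q) x).natDegree = d),
      quadraticChar K ((D.map φ).eval x)| ≤ 2 * d * (q : ℤ) ^ (d / 2) := by
    refine (Finset.abs_sum_le_sum_abs _ _).trans ?_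
    refine (Finset.sum_le_card_nsmul _ _ 1 fun x _ => ?_).trans ?_
    · by_cases h0 : (D.map φ).eval x = 0
      · rw [h0, MulChar.map_zero]
        simp
      · rcases quadraticChar_dichotomy h0 with h | h <;> rw [h] <;> simp
    · rw [nsmul_eq_mul, mul_one]
      exact_mod_cast card_filter_minpoly_ne_le hK hd
  have h3 : (q : ℤ) ^ (d / 2) ≤ (q : ℤ) ^ (d - d / 2) :=
    pow_le_pow_right₀ (by exact_mod_cast (Fact.out : q.Prime).one_le) (by omega)
  have h4 : 2 * d * (q : ℤ) ^ (d / 2) ≤ 2 * d * (q : ℤ) ^ (d - d / 2) := by gcongr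
  have h5 : 9 * ((D.natDegree : ℤ) + 1) * (q : ℤ) ^ (d - d / 2) ≤
      9 * (d : ℤ) * (q : ℤ) ^ (d - d / 2) := by
    gcongr
    exact_mod_cast hdeg
  rw [h1] at hsplit
  have h6 : primeCharSum q d D = ∑ x : K, quadraticChar K ((D.map φ).eval x) -
      ∑ x ∈ Finset.univ.filter (fun x : K => ¬(minpoly (ZMod q) x).natDegree = d),
        quadraticChar K ((D.map φ).eval x) := by
    rw [← hsplit]
    ring
  rw [h6]
  refine (abs_sub _ _).trans ?_
  linarith

lemma primeCharSum_sq {d : ℕ} {E : (ZMod q)[X]} (hE : E ≠ 0) (hdeg : E.natDegree < d) :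
    primeCharSum q d (E ^ 2) = d * (irrDeg q d).card := by
  rw [primeCharSum, Finset.sum_congr rfl fun P hP => ?_, Finset.sum_const, nsmul_eq_mul, mul_comm]
  obtain ⟨hPm, hPi, hPd⟩ := mem_irrDeg.mp hP
  rw [resSym_sq hPi, if_neg, mul_one]
  intro h
  have := natDegree_le_of_dvd h hE
  omega

end PrimeSums

section DegreeSums

variable {q : ℕ} [Fact q.Prime]

/-- The sum of `d(P) χ_P(D)` over monic `D` of degree `m` and monic irreducible `P` of
degree `d`. -/
noncomputable def degCharSum (q m d : ℕ) [Fact q.Prime] : ℤ :=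
  ∑ P ∈ irrDeg q d, (d : ℤ) * monicCharSum q m P

lemma degCharSum_eq_sum_primeCharSum (m d : ℕ) :
    degCharSum q m d = ∑ D ∈ monicsDeg q m, primeCharSum q d D := by
  simp only [degCharSum, monicCharSum, primeCharSum, Finset.mul_sum]
  exact Finset.sum_comm

/-- The contribution of perfect squares to `degCharSum`. -/
noncomputable def squareTerm (q j d : ℕ) : ℤ := if Even j then (q : ℤ) ^ (j / 2 + d) else 0

lemma sum_filter_isSquare_monicsDeg (j : ℕ) (H : (ZMod q)[X] → ℤ) :
    ∑ D ∈ (monicsDeg q (2 * j)).filter IsSquare, H D = ∑ E ∈ monicsDeg q j, H (E ^ 2) := by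
  symm
  refine Finset.sum_nbij (fun E => E ^ 2) ?_ ?_ ?_ (fun _ _ => rfl)
  · intro E hE
    rw [mem_monicsDeg] at hE
    rw [Finset.mem_filter, mem_monicsDeg, hE.1.natDegree_pow, hE.2]
    exact ⟨⟨hE.1.pow 2, rfl⟩, E, sq E⟩
  · intro E hE E' hE' h
    rw [Finset.mem_coe, mem_monicsDeg] at hE hE'
    exact (sq_mul_squarefree_unique hE.1 hE'.1 squarefree_one squarefree_one
      (by simpa only [mul_one] using h)).1
  · intro D hD
    rw [Finset.mem_coe, Finset.mem_filter, mem_monicsDeg] at hD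
    obtain ⟨⟨hDm, hDd⟩, y, rfl⟩ := hD
    have hy0 : y ≠ 0 := by
      rintro rfl
      simp at hDm
    have hlc : y.leadingCoeff * y.leadingCoeff = 1 := by
      rw [← leadingCoeff_mul]
      exact hDm
    refine ⟨y * C y.leadingCoeff⁻¹, ?_, ?_⟩
    · rw [Finset.mem_coe, mem_monicsDeg]
      refine ⟨monic_mul_leadingCoeff_inv hy0, ?_⟩
      rw [natDegree_mul_C (inv_ne_zero (leadingCoeff_ne_zero.mpr hy0))]
      rw [natDegree_mul hy0 hy0] at hDd
      omega
    · have h2 : C y.leadingCoeff⁻¹ ^ 2 = (1 : (ZMod q)[X]) := by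
        rw [← C_pow, sq, ← mul_inv, hlc, inv_one, C_1]
      change (y * C y.leadingCoeff⁻¹) ^ 2 = y * y
      rw [mul_pow, h2, mul_one, sq]

lemma abs_sum_isSquare_sub_le {j d : ℕ} (hjd : j < d) :
    |∑ D ∈ (monicsDeg q j).filter IsSquare, primeCharSum q d D - squareTerm q j d| ≤
      2 * d * (q : ℤ) ^ (j + (d - d / 2)) := by
  have hq1 : (1 : ℤ) ≤ q := by exact_mod_cast (Fact.out : q.Prime).one_le
  rw [squareTerm]
  split_ifs with hj
  · obtain ⟨r, hr⟩ := hj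
    obtain rfl : j = 2 * r := by omega
    rw [sum_filter_isSquare_monicsDeg, Finset.sum_congr rfl fun E hE => primeCharSum_sq
      (mem_monicsDeg.mp hE).1.ne_zero (by rw [(mem_monicsDeg.mp hE).2]; omega),
      Finset.sum_const, card_monicsDeg, nsmul_eq_mul, Nat.mul_div_cancel_left r two_pos, pow_add,
      Nat.cast_pow, ← mul_sub, abs_mul, abs_of_nonneg (by positivity)]
    have h1 : |(d : ℤ) * (irrDeg q d).card - (q : ℤ) ^ d| ≤ 2 * d * (q : ℤ) ^ (d / 2) := by
      have h2 : (d : ℤ) * (irrDeg q d).card ≤ (q : ℤ) ^ d := by exact_mod_cast card_irrDeg_le d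
      have h3 : (q : ℤ) ^ d ≤ (d : ℤ) * (irrDeg q d).card + 2 * d * (q : ℤ) ^ (d / 2) := by
        exact_mod_cast le_card_irrDeg (q := q) (d := d) (by omega)
      rw [abs_le]
      constructor
      · linarith
      · have : 0 ≤ 2 * (d : ℤ) * (q : ℤ) ^ (d / 2) := by positivity
        linarith
    calc (q : ℤ) ^ r * |(d : ℤ) * (irrDeg q d).card - (q : ℤ) ^ d|
        ≤ (q : ℤ) ^ r * (2 * d * (q : ℤ) ^ (d / 2)) := by gcongr
      _ = 2 * d * (q : ℤ) ^ (r + d / 2) := by ring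
      _ ≤ 2 * d * (q : ℤ) ^ (2 * r + (d - d / 2)) := by
        have : (q : ℤ) ^ (r + d / 2) ≤ (q : ℤ) ^ (2 * r + (d - d / 2)) :=
          pow_le_pow_right₀ hq1 (by omega)
        gcongr
  · rw [Finset.filter_false_of_mem, Finset.sum_empty, sub_zero, abs_zero]
    · positivity
    · rintro D hD ⟨y, rfl⟩
      rw [mem_monicsDeg] at hD
      have hy0 : y ≠ 0 := by
        rintro rfl
        simp at hD
      rw [natDegree_mul hy0 hy0] at hD
      exact hj ⟨y.natDegree, hD.2.symm⟩

lemma abs_degCharSum_sub_squareTerm_le (hq : q ≠ 2) {j d : ℕ} (hjd : j < d) :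
    |degCharSum q j d - squareTerm q j d| ≤ 13 * d * (q : ℤ) ^ (j + (d - d / 2)) := by
  rw [degCharSum_eq_sum_primeCharSum, ← Finset.sum_filter_add_sum_filter_not (monicsDeg q j)
    IsSquare]
  have h1 := abs_sum_isSquare_sub_le (q := q) hjd
  have h2 : |∑ D ∈ (monicsDeg q j).filter fun D => ¬IsSquare D, primeCharSum q d D| ≤
      11 * d * (q : ℤ) ^ (j + (d - d / 2)) := by
    refine (Finset.abs_sum_le_sum_abs _ _).trans ((Finset.sum_le_card_nsmul _ _
      (11 * d * (q : ℤ) ^ (d - d / 2)) fun D hD => ?_).trans ?_)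
    · rw [Finset.mem_filter, mem_monicsDeg] at hD
      exact abs_primeCharSum_le hq hD.1.1 (by omega) hD.2
    · have h3 : (((monicsDeg q j).filter fun D => ¬IsSquare D).card : ℤ) ≤ (q : ℤ) ^ j := by
        exact_mod_cast (Finset.card_filter_le _ _).trans (card_monicsDeg j).le
      rw [nsmul_eq_mul, pow_add]
      calc _ ≤ (q : ℤ) ^ j * (11 * d * (q : ℤ) ^ (d - d / 2)) := by gcongr
        _ = _ := by ring
  rw [add_sub_right_comm]
  refine (abs_add_le _ _).trans ?_
  linarith

lemma degCharSum_eq_zero (hq : q ≠ 2) {m d : ℕ} (h : d ≤ m) : degCharSum q m d = 0 := by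
  refine Finset.sum_eq_zero fun P hP => ?_
  obtain ⟨hPm, hPi, hPd⟩ := mem_irrDeg.mp hP
  rw [monicCharSum_eq_zero hq hPi hPm (by omega), mul_zero]

lemma degCharSum_functional_equation (hq : q ≠ 2) {m d : ℕ} (hm : m < d) :
    (q : ℂ) ^ (d - m) * degCharSum q m d = gaussConst q d * ∑ j ∈ Finset.range (d - m),
      funEqCoeff q d (j = d - 1 - m) * degCharSum q j d := by
  have h1 : ∀ j, (degCharSum q j d : ℂ) = ∑ P ∈ irrDeg q d, (d : ℂ) * (monicCharSum q j P : ℂ) := by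
    intro j
    rw [degCharSum]
    push_cast
    rfl
  have h2 : ∀ P ∈ irrDeg q d, (q : ℂ) ^ (d - m) * ((d : ℂ) * monicCharSum q m P) =
      gaussConst q d * ∑ j ∈ Finset.range (d - m),
        funEqCoeff q d (j = d - 1 - m) * ((d : ℂ) * monicCharSum q j P) := by
    intro P hP
    obtain ⟨hPm, hPi, rfl⟩ := mem_irrDeg.mp hP
    rw [mul_left_comm, monicCharSum_functional_equation hq hPi hPm hm, mul_left_comm,
      Finset.mul_sum (Finset.range _) _ (P.natDegree : ℂ)]
    congr 1
    exact Finset.sum_congr rfl fun j _ => by ring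
  rw [h1, Finset.mul_sum, Finset.sum_congr rfl h2, ← Finset.mul_sum, Finset.sum_comm]
  simp only [← Finset.mul_sum, ← h1]

lemma abs_degCharSum_le_of_odd (hq : q ≠ 2) {m d : ℕ} (hm : Odd m) (hd : Odd d) (hmd : m < d) :
    |degCharSum q m d| ≤ 13 * d * (q : ℤ) ^ (d + 1) := by
  have hq0 : (0 : ℝ) < q := by exact_mod_cast (Fact.out : q.Prime).pos
  obtain ⟨k, hk⟩ : ∃ k, d = m + 1 + k := ⟨d - 1 - m, by omega⟩
  have hkodd : ¬Even k := by
    rintro ⟨r, hr⟩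
    obtain ⟨a, ha⟩ := hm
    obtain ⟨b, hb⟩ := hd
    omega
  have h1 := degCharSum_functional_equation hq hmd
  rw [show d - m = k + 1 by omega, show d - 1 - m = k by omega, Finset.sum_range_succ,
    Finset.sum_eq_zero (fun j hj => by
      rw [funEqCoeff_odd_not_top hq hd (Finset.mem_range.mp hj).ne, zero_mul]), zero_add] at h1
  have h2 := congrArg norm h1
  rw [norm_mul, norm_mul, norm_mul, norm_pow, Complex.norm_natCast, Complex.norm_intCast,
    Complex.norm_intCast] at h2
  have h3 := abs_degCharSum_sub_squareTerm_le hq (j := k) (d := d) (by omega)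
  rw [squareTerm, if_neg hkodd, sub_zero] at h3
  have h3' : |(degCharSum q k d : ℝ)| ≤ 13 * d * (q : ℝ) ^ (k + (d - d / 2)) := by exact_mod_cast h3
  have h4 : (q : ℝ) ^ (k + 1) * |(degCharSum q m d : ℝ)| ≤
      (q : ℝ) ^ (k + 1) * (13 * d * (q : ℝ) ^ (d + 1)) := by
    rw [h2]
    calc ‖gaussConst q d‖ * (‖funEqCoeff q d (k = k)‖ * |(degCharSum q k d : ℝ)|)
        ≤ (q : ℝ) ^ (d - d / 2) * (q * (13 * d * (q : ℝ) ^ (k + (d - d / 2)))) := by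
          gcongr
          · exact norm_gaussConst_le d
          · exact norm_funEqCoeff_le d _
      _ = 13 * d * (q : ℝ) ^ ((d - d / 2) + 1 + (k + (d - d / 2))) := by ring
      _ = 13 * d * (q : ℝ) ^ ((k + 1) + (d + 1)) := by
          congr 2
          obtain ⟨b, hb⟩ := hd
          omega
      _ = _ := by ring
  exact_mod_cast le_of_mul_le_mul_left h4 (by positivity)

lemma geom_sum_squareTerm {q : ℕ} (r d : ℕ) :
    ((q : ℤ) - 1) * ∑ j ∈ Finset.range (2 * r), squareTerm q j d - squareTerm q (2 * r) d =
      -(q : ℤ) ^ d := by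
  induction r with
  | zero => simp [squareTerm]
  | succ r ih =>
    have h1 : squareTerm q (2 * r) d = (q : ℤ) ^ (r + d) := by
      rw [squareTerm, if_pos (even_two_mul r), Nat.mul_div_cancel_left r two_pos]
    have h2 : squareTerm q (2 * r + 1) d = 0 := if_neg (by simp)
    have h3 : squareTerm q (2 * (r + 1)) d = (q : ℤ) ^ (r + 1 + d) := by
      rw [squareTerm, if_pos (even_two_mul _), Nat.mul_div_cancel_left _ two_pos]
    rw [h1] at ih
    rw [h3, show 2 * (r + 1) = 2 * r + 1 + 1 by ring, Finset.sum_range_succ, Finset.sum_range_succ,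
      h1, h2, show r + 1 + d = r + d + 1 by ring, pow_succ]
    linear_combination ih

lemma abs_degCharSum_add_le_of_even (hq : q ≠ 2) {m d : ℕ} (hm : Odd m) (hd : Even d)
    (hmd : m < d) :
    |degCharSum q m d + (q : ℤ) ^ (m + d / 2)| ≤ 26 * d * (q : ℤ) ^ (d + 1) := by
  have hq1 : (1 : ℤ) ≤ q := by exact_mod_cast (Fact.out : q.Prime).one_le
  obtain ⟨s, hs⟩ := hd
  obtain ⟨a, ha⟩ := hm
  obtain ⟨r, hr⟩ : ∃ r, d = m + 1 + 2 * r := ⟨s - a - 1, by omega⟩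
  have hd : Even d := ⟨s, hs⟩
  have h1 : (q : ℤ) ^ (2 * r + 1) * degCharSum q m d = (q : ℤ) ^ s *
      (((q : ℤ) - 1) * ∑ j ∈ Finset.range (2 * r), degCharSum q j d -
        degCharSum q (2 * r) d) := by
    have h := degCharSum_functional_equation hq hmd
    rw [show d - m = 2 * r + 1 by omega, show d - 1 - m = 2 * r by omega, Finset.sum_range_succ,
      Finset.sum_congr rfl (fun j hj => by
        rw [funEqCoeff_even_not_top hd (Finset.mem_range.mp hj).ne]), funEqCoeff_even_top hd rfl,
      ← Finset.mul_sum, gaussConst_even (by omega) hd, show d / 2 = s by omega] at h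
    have h' : (q : ℂ) ^ (2 * r + 1) * degCharSum q m d = (q : ℂ) ^ s *
      (((q : ℂ) - 1) * ∑ j ∈ Finset.range (2 * r), (degCharSum q j d : ℂ) -
        degCharSum q (2 * r) d) := by rw [h]; ring
    exact_mod_cast h'
  have hE : ∀ j < d, |degCharSum q j d - squareTerm q j d| ≤
      13 * d * (q : ℤ) ^ s * (q : ℤ) ^ j := by
    intro j hj
    refine (abs_degCharSum_sub_squareTerm_le hq hj).trans_eq ?_
    rw [show d - d / 2 = s by omega]
    ring
  have h2 := geom_sum_squareTerm (q := q) r d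
  have h3 : (q : ℤ) ^ (2 * r + 1) * (degCharSum q m d + (q : ℤ) ^ (m + d / 2)) = (q : ℤ) ^ s *
      (((q : ℤ) - 1) * ∑ j ∈ Finset.range (2 * r), (degCharSum q j d - squareTerm q j d) -
        (degCharSum q (2 * r) d - squareTerm q (2 * r) d)) := by
    rw [Finset.sum_sub_distrib]
    have h4 : (q : ℤ) ^ (2 * r + 1) * (q : ℤ) ^ (m + d / 2) = (q : ℤ) ^ s * (q : ℤ) ^ d := by
      rw [← pow_add, ← pow_add]
      congr 1
      omega
    linear_combination h1 + (q : ℤ) ^ s * h2 + h4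
  have h5 : |∑ j ∈ Finset.range (2 * r), (degCharSum q j d - squareTerm q j d)| ≤
      13 * d * (q : ℤ) ^ s * ∑ j ∈ Finset.range (2 * r), (q : ℤ) ^ j := by
    rw [Finset.mul_sum]
    refine (Finset.abs_sum_le_sum_abs _ _).trans (Finset.sum_le_sum fun j hj => hE j ?_)
    rw [Finset.mem_range] at hj
    omega
  have h6 := hE (2 * r) (by omega)
  have h7 : ((q : ℤ) - 1) * ∑ j ∈ Finset.range (2 * r), (q : ℤ) ^ j = (q : ℤ) ^ (2 * r) - 1 :=
    mul_geom_sum _ _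
  have h8 : (q : ℤ) ^ (2 * r + 1) * |degCharSum q m d + (q : ℤ) ^ (m + d / 2)| ≤
      (q : ℤ) ^ (2 * r + 1) * (26 * d * (q : ℤ) ^ (d + 1)) := by
    rw [← abs_of_nonneg (show 0 ≤ (q : ℤ) ^ (2 * r + 1) by positivity), ← abs_mul,
      abs_of_nonneg (show 0 ≤ (q : ℤ) ^ (2 * r + 1) by positivity), h3, abs_mul,
      abs_of_nonneg (show 0 ≤ (q : ℤ) ^ s by positivity)]
    calc _ ≤ (q : ℤ) ^ s * (((q : ℤ) - 1) * (13 * d * (q : ℤ) ^ s *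
          ∑ j ∈ Finset.range (2 * r), (q : ℤ) ^ j) + 13 * d * (q : ℤ) ^ s * (q : ℤ) ^ (2 * r)) := by
          gcongr
          refine (abs_sub _ _).trans (add_le_add ?_ h6)
          rw [abs_mul, abs_of_nonneg (sub_nonneg.mpr hq1)]
          exact mul_le_mul_of_nonneg_left h5 (sub_nonneg.mpr hq1)
      _ = (q : ℤ) ^ s * (13 * d * (q : ℤ) ^ s * (2 * (q : ℤ) ^ (2 * r) - 1)) := by
          linear_combination (q : ℤ) ^ s * 13 * d * (q : ℤ) ^ s * h7
      _ ≤ (q : ℤ) ^ s * (13 * d * (q : ℤ) ^ s * (2 * (q : ℤ) ^ (2 * r))) := by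
          gcongr
          linarith
      _ = 26 * d * (q : ℤ) ^ (s + s + 2 * r) := by ring
      _ ≤ 26 * d * (q : ℤ) ^ ((2 * r + 1) + (d + 1)) := by
          have := pow_le_pow_right₀ hq1 (show s + s + 2 * r ≤ (2 * r + 1) + (d + 1) by omega)
          gcongr
      _ = _ := by ring
  exact le_of_mul_le_mul_left h8 (by positivity)

end DegreeSums

section OddPowers

variable {q : ℕ} [Fact q.Prime]

lemma vM_pow {P : (ZMod q)[X]} (hPm : P.Monic) (hP : Irreducible P) {k : ℕ} (hk : 1 ≤ k) :
    vM q (P ^ k) = P.natDegree := by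
  have h : ∃ P' : (ZMod q)[X], (∃ k' : ℕ, 1 ≤ k' ∧ P ^ k = P' ^ k') ∧ P'.Monic ∧ Irreducible P' :=
    ⟨P, ⟨k, hk, rfl⟩, hPm, hP⟩
  rw [vM, dif_pos h]
  obtain ⟨⟨k', hk', he⟩, hm, hi⟩ := h.choose_spec
  have h1 : P ∣ h.choose := by
    refine hP.prime.dvd_of_dvd_pow (n := k') ?_
    rw [← he]
    exact dvd_pow_self P (by omega)
  exact congrArg natDegree (eq_of_monic_of_associated hPm hm (hP.associated_of_dvd hi h1)).symm

lemma jacSym_pow {P : (ZMod q)[X]} (hPm : P.Monic) (hP : Irreducible P) (D : (ZMod q)[X]) (k : ℕ) :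
    jacSym q D (P ^ (2 * k + 1)) = resSym q D P := by
  rw [jacSym, if_neg (pow_ne_zero _ hP.ne_zero), normalizedFactors_pow,
    normalizedFactors_irreducible hP, hPm.normalize_eq_self, Multiset.map_nsmul,
    Multiset.prod_nsmul, Multiset.map_singleton, Multiset.prod_singleton, resSym]
  split_ifs
  · simp
  · simp
  · rw [pow_succ, pow_mul]
    simp

/-- The property of being an odd power of a monic irreducible polynomial. -/
def IsOddPrimePow (f : (ZMod q)[X]) : Prop :=
  ∃ P : (ZMod q)[X], ∃ k : ℕ, P.Monic ∧ Irreducible P ∧ f = P ^ (2 * k + 1)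

/-- The sum of `Λ(f) χ_D(f)` over monic squarefree `D` of degree `2 * g + 1` and odd prime powers
`f` of degree `m`. -/
noncomputable def oddPowSum (q g m : ℕ) [Fact q.Prime] : ℤ :=
  ∑ f ∈ (monicsDeg q m).filter IsOddPrimePow,
    (vM q f : ℤ) * ∑ D ∈ (monicsDeg q (2 * g + 1)).filter Squarefree, jacSym q D f

/-- The part of `oddPowSum` coming from primes of degree at most `g`. -/
noncomputable def tailSum (q g d : ℕ) [Fact q.Prime] : ℤ :=
  ∑ P ∈ irrDeg q d, (d : ℤ) *
    if 2 * d ≤ 2 * g + 1 then sqfreeCharSum q (2 * g + 1 - 2 * d) P else 0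

/-- The main term of `oddPowSum`. -/
noncomputable def mainCoeff (q g d : ℕ) : ℤ :=
  if d = 2 * g then (q : ℤ) ^ (3 * g)
  else if Even d ∧ 2 * g + 2 ≤ d then -((q : ℤ) ^ (2 * g) * ((q : ℤ) - 1) * (q : ℤ) ^ (d / 2))
  else 0

lemma sum_filter_irreducible_oddPow (g m : ℕ) (hg : 1 ≤ g) :
    ∑ f ∈ ((monicsDeg q m).filter IsOddPrimePow).filter Irreducible,
      (vM q f : ℤ) * ∑ D ∈ (monicsDeg q (2 * g + 1)).filter Squarefree, jacSym q D f =
    degCharSum q (2 * g + 1) m - q * degCharSum q (2 * g - 1) m + tailSum q g m := by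
  have h1 : ((monicsDeg q m).filter IsOddPrimePow).filter Irreducible = irrDeg q m := by
    ext f
    rw [Finset.mem_filter, Finset.mem_filter, mem_monicsDeg, mem_irrDeg]
    constructor
    · rintro ⟨⟨⟨hm, hd⟩, -⟩, hi⟩
      exact ⟨hm, hi, hd⟩
    · rintro ⟨hm, hi, hd⟩
      exact ⟨⟨⟨hm, hd⟩, f, 0, hm, hi, by simp⟩, hi⟩
  rw [h1, degCharSum, degCharSum, tailSum, Finset.mul_sum, ← Finset.sum_sub_distrib,
    ← Finset.sum_add_distrib]
  refine Finset.sum_congr rfl fun P hP => ?_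
  obtain ⟨hPm, hPi, hPd⟩ := mem_irrDeg.mp hP
  have h2 : vM q P = m := by
    have := vM_pow hPm hPi le_rfl
    rwa [pow_one, hPd] at this
  have h3 : ∀ D, jacSym q D P = resSym q D P := by
    intro D
    have := jacSym_pow hPm hPi D 0
    rwa [mul_zero, zero_add, pow_one] at this
  have h4 := sqfreeCharSum_add_two hPi hPm (2 * g - 1)
  rw [show 2 * g - 1 + 2 = 2 * g + 1 by omega, hPd] at h4
  simp only [h3]
  change _ * sqfreeCharSum q (2 * g + 1) P = _
  rw [h2, h4]
  ring

lemma abs_sum_filter_not_irreducible_oddPow_le (hq : q ≠ 2) (g m : ℕ) :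
    |∑ f ∈ ((monicsDeg q m).filter IsOddPrimePow).filter (fun f => ¬Irreducible f),
      (vM q f : ℤ) * ∑ D ∈ (monicsDeg q (2 * g + 1)).filter Squarefree, jacSym q D f| ≤
    2 * m * (q : ℤ) ^ (m + 1) := by
  have hq2 := (Fact.out : q.Prime).two_le
  have hq1 : (1 : ℤ) ≤ q := by exact_mod_cast (Fact.out : q.Prime).one_le
  have hrep : ∀ f ∈ ((monicsDeg q m).filter IsOddPrimePow).filter (fun f => ¬Irreducible f),
      ∃ P : (ZMod q)[X], ∃ k : ℕ, P.Monic ∧ Irreducible P ∧ f = P ^ (2 * k + 1) ∧ 1 ≤ k ∧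
        m = (2 * k + 1) * P.natDegree ∧ P.natDegree ≤ m / 3 := by
    intro f hf
    rw [Finset.mem_filter, Finset.mem_filter, mem_monicsDeg] at hf
    obtain ⟨⟨⟨hfm, hfd⟩, P, k, hPm, hPi, rfl⟩, hni⟩ := hf
    have hk : 1 ≤ k := by
      by_contra h
      obtain rfl : k = 0 := by omega
      exact hni (by simpa using hPi)
    rw [hPm.natDegree_pow] at hfd
    refine ⟨P, k, hPm, hPi, rfl, hk, hfd.symm, ?_⟩
    rw [Nat.le_div_iff_mul_le (by norm_num), ← hfd, mul_comm]
    exact Nat.mul_le_mul_right _ (by omega)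
  have hcard : (((monicsDeg q m).filter IsOddPrimePow).filter (fun f => ¬Irreducible f)).card ≤
      2 * q ^ (m / 3) := by
    have hsub : ((monicsDeg q m).filter IsOddPrimePow).filter (fun f => ¬Irreducible f) ⊆
        (Finset.range (m / 3 + 1)).biUnion fun e =>
          (monicsDeg q e).image fun P => P ^ (m / e) := by
      intro f hf
      obtain ⟨P, k, hPm, hPi, hfP, -, hmk, hle⟩ := hrep f hf
      rw [Finset.mem_biUnion]
      refine ⟨P.natDegree, Finset.mem_range.mpr (by omega), Finset.mem_image.mpr
        ⟨P, mem_monicsDeg.mpr ⟨hPm, rfl⟩, ?_⟩⟩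
      rw [hfP, hmk, Nat.mul_div_cancel _ hPi.natDegree_pos]
    refine (Finset.card_le_card hsub).trans (Finset.card_biUnion_le.trans
      ((Finset.sum_le_sum fun e _ => Finset.card_image_le).trans ?_))
    simp only [card_monicsDeg]
    have := Nat.geomSum_lt (m := q) (n := m / 3) (s := Finset.range (m / 3)) hq2 (by simp)
    rw [Finset.sum_range_succ]
    omega
  refine (Finset.abs_sum_le_sum_abs _ _).trans ((Finset.sum_le_card_nsmul _ _
    (m * (q : ℤ) ^ (m / 3 + 1)) fun f hf => ?_).trans ?_)
  · obtain ⟨P, k, hPm, hPi, rfl, -, hmk, hle⟩ := hrep f hf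
    simp only [jacSym_pow hPm hPi]
    rw [vM_pow hPm hPi (by omega), abs_mul, Nat.abs_cast]
    change (P.natDegree : ℤ) * |sqfreeCharSum q (2 * g + 1) P| ≤ _
    have h1 : (P.natDegree : ℤ) ≤ m := by
      have : P.natDegree ≤ m := hle.trans (Nat.div_le_self _ _)
      exact_mod_cast this
    have h2 := (abs_sqfreeCharSum_le_of_natDegree hq hPi hPm (2 * g + 1)).trans
      (pow_le_pow_right₀ hq1 (show P.natDegree + 1 ≤ m / 3 + 1 by omega))
    gcongr
  · rw [nsmul_eq_mul]
    calc _ ≤ (2 * (q : ℤ) ^ (m / 3)) * (m * (q : ℤ) ^ (m / 3 + 1)) := by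
          gcongr
          exact_mod_cast hcard
      _ = 2 * m * (q : ℤ) ^ (m / 3 + (m / 3 + 1)) := by ring
      _ ≤ _ := by
          have := pow_le_pow_right₀ hq1 (show m / 3 + (m / 3 + 1) ≤ m + 1 by omega)
          gcongr

lemma abs_degCharSum_sub_mainCoeff_le (hq : q ≠ 2) (g d : ℕ) (hg : 1 ≤ g) :
    |degCharSum q (2 * g + 1) d - q * degCharSum q (2 * g - 1) d - mainCoeff q g d| ≤
      52 * d * (q : ℤ) ^ (d + 2) := by
  have hq0 : (1 : ℤ) ≤ q := by exact_mod_cast (Fact.out : q.Prime).one_le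
  have hodd : Odd (2 * g + 1) := ⟨g, rfl⟩
  have hodd' : Odd (2 * g - 1) := ⟨g - 1, by omega⟩
  have hpow : (q : ℤ) * (26 * d * (q : ℤ) ^ (d + 1)) + 26 * d * (q : ℤ) ^ (d + 1) ≤
      52 * d * (q : ℤ) ^ (d + 2) := by
    have h : 0 ≤ 26 * (d : ℤ) * (q : ℤ) ^ (d + 1) := by positivity
    have h' : 52 * d * (q : ℤ) ^ (d + 2) = 2 * (q * (26 * d * (q : ℤ) ^ (d + 1))) := by ring
    rw [h']
    nlinarith
  have hB : ∀ m, Odd m → m < d → |degCharSum q m d +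
      if Even d then (q : ℤ) ^ (m + d / 2) else 0| ≤ 26 * d * (q : ℤ) ^ (d + 1) := by
    intro m hm hmd
    split_ifs with hd
    · exact abs_degCharSum_add_le_of_even hq hm hd hmd
    · rw [add_zero]
      refine (abs_degCharSum_le_of_odd hq hm (Nat.not_even_iff_odd.mp hd) hmd).trans ?_
      gcongr
      norm_num
  have hcomb : ∀ x y : ℤ, |x| ≤ 26 * d * (q : ℤ) ^ (d + 1) → |y| ≤ 26 * d * (q : ℤ) ^ (d + 1) →
      |x - q * y| ≤ 52 * d * (q : ℤ) ^ (d + 2) := by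
    intro x y hx hy
    refine (abs_sub _ _).trans ?_
    rw [abs_mul, Nat.abs_cast]
    have : (q : ℤ) * |y| ≤ q * (26 * d * (q : ℤ) ^ (d + 1)) := by gcongr
    linarith
  have h0 : |(0 : ℤ)| ≤ 26 * d * (q : ℤ) ^ (d + 1) := by
    rw [abs_zero]
    positivity
  rw [mainCoeff]
  rcases lt_or_ge d (2 * g) with h | h
  · rw [degCharSum_eq_zero hq (by omega), degCharSum_eq_zero hq (by omega), if_neg (by omega),
      if_neg (by omega)]
    simp only [mul_zero, sub_zero, abs_zero]
    positivity
  · have hB1 := hB _ hodd' (by omega)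
    rcases eq_or_lt_of_le h with rfl | h
    · rw [if_pos (even_two_mul g)] at hB1
      rw [degCharSum_eq_zero hq (by omega), if_pos rfl]
      have h1 := hcomb _ _ h0 hB1
      rwa [mul_add, ← pow_succ', show 2 * g - 1 + 2 * g / 2 + 1 = 3 * g by omega,
        ← sub_sub] at h1
    · rw [if_neg (by omega)]
      rcases eq_or_lt_of_le (Nat.succ_le_of_lt h) with rfl | h
      · rw [if_neg (by simp)] at hB1
        rw [degCharSum_eq_zero hq (by omega), if_neg (by omega), sub_zero]
        rw [add_zero] at hB1
        exact hcomb _ _ h0 hB1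
      · have hB2 := hB _ hodd (by omega)
        have h1 := hcomb _ _ hB2 hB1
        refine le_trans (le_of_eq (congrArg abs ?_)) h1
        by_cases hd : Even d
        · rw [if_pos hd, if_pos hd, if_pos ⟨hd, by omega⟩, mul_add, ← pow_succ',
            show 2 * g - 1 + d / 2 + 1 = 2 * g + d / 2 by omega]
          ring
        · rw [if_neg hd, if_neg hd, if_neg (fun h => hd h.1)]
          ring

lemma abs_oddPowSum_sub_le (hq : q ≠ 2) (g m : ℕ) (hg : 1 ≤ g) :
    |oddPowSum q g m - mainCoeff q g m - tailSum q g m| ≤ 54 * m * (q : ℤ) ^ (m + 2) := by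
  rw [oddPowSum, ← Finset.sum_filter_add_sum_filter_not _ Irreducible,
    sum_filter_irreducible_oddPow g m hg]
  have h1 := abs_sum_filter_not_irreducible_oddPow_le hq g m
  have h2 := abs_degCharSum_sub_mainCoeff_le hq g m hg
  have h3 : 2 * m * (q : ℤ) ^ (m + 1) ≤ 2 * m * (q : ℤ) ^ (m + 2) := by
    have := pow_le_pow_right₀ (show (1 : ℤ) ≤ q by exact_mod_cast (Fact.out : q.Prime).one_le)
      (show m + 1 ≤ m + 2 by omega)
    gcongr
  rw [abs_le] at h1 h2 ⊢
  constructor <;> linarith [h1.1, h1.2, h2.1, h2.2]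

lemma tailSum_eq_zero {g d : ℕ} (h : g < d) : tailSum q g d = 0 := by
  refine Finset.sum_eq_zero fun P _ => ?_
  rw [if_neg (by omega), mul_zero]

lemma abs_tailSum_le {g d : ℕ} {B : ℤ} (hB : 0 ≤ B)
    (h : ∀ P ∈ irrDeg q d, |sqfreeCharSum q (2 * g + 1 - 2 * d) P| ≤ B) :
    |tailSum q g d| ≤ (q : ℤ) ^ d * B := by
  calc |tailSum q g d| ≤ ∑ P ∈ irrDeg q d, (d : ℤ) * B := by
        refine (Finset.abs_sum_le_sum_abs _ _).trans (Finset.sum_le_sum fun P hP => ?_)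
        rw [abs_mul, Nat.abs_cast]
        gcongr
        split_ifs
        · exact h P hP
        · rwa [abs_zero]
    _ = ((d * (irrDeg q d).card : ℕ) : ℤ) * B := by
        rw [Finset.sum_const, nsmul_eq_mul]
        push_cast
        ring
    _ ≤ (q : ℤ) ^ d * B := by
        gcongr
        exact_mod_cast card_irrDeg_le d

lemma abs_tailSum_le_of_natDegree (hq : q ≠ 2) (g d : ℕ) :
    |tailSum q g d| ≤ (q : ℤ) ^ d * (q : ℤ) ^ (d + 1) := by
  refine abs_tailSum_le (by positivity) fun P hP => ?_
  obtain ⟨hPm, hPi, hPd⟩ := mem_irrDeg.mp hP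
  have := abs_sqfreeCharSum_le_of_natDegree hq hPi hPm (2 * g + 1 - 2 * d)
  rwa [hPd] at this

lemma abs_tailSum_le_trivial (g d : ℕ) :
    |tailSum q g d| ≤ (q : ℤ) ^ d * (q : ℤ) ^ (2 * g + 1 - 2 * d) :=
  abs_tailSum_le (by positivity) fun _ _ => abs_sqfreeCharSum_le _

end OddPowers

section LevelSum

variable {q : ℕ} [Fact q.Prime]

/-- The weight `q^{-m(1/2+α)}`. -/
noncomputable def levelWeight (q : ℕ) (α : ℂ) (m : ℕ) : ℂ :=
  1 / (q : ℂ) ^ ((m : ℂ) * (1 / 2 + α))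

lemma sumH_eq {M : Type*} [AddCommMonoid M] (g : ℕ) (F : (ZMod q)[X] → M) :
    sumH q g F = ∑ D ∈ (monicsDeg q (2 * g + 1)).filter Squarefree, F D := by
  rw [sumH, Finset.sum_filter, ← sum_monicOfDeg]

lemma sumMonicLE_natCast {M : Type*} [AddCommMonoid M] (N : ℕ) (F : (ZMod q)[X] → M) :
    sumMonicLE q (N : ℤ) F = ∑ m ∈ Finset.range (N + 1), ∑ f ∈ monicsDeg q m, F f := by
  rw [sumMonicLE, if_pos (Int.natCast_nonneg _)]
  refine Finset.sum_congr (by simp) fun m _ => ?_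
  rw [sumMonic, if_pos (Int.natCast_nonneg _)]
  simp only [Int.toNat_natCast]
  exact sum_monicOfDeg m F

lemma sumH_sumMonicLE_eq (g N : ℕ) (α : ℂ) :
    sumH q g (fun D => sumMonicLE q (N : ℤ) (fun f =>
      if ∃ P : (ZMod q)[X], ∃ k : ℕ, P.Monic ∧ Irreducible P ∧ f = P ^ (2 * k + 1) then
        (vM q f : ℂ) * (jacSym q D f : ℂ) / (q : ℂ) ^ ((f.natDegree : ℂ) * (1 / 2 + α))
      else 0)) =
    ∑ m ∈ Finset.range (N + 1), levelWeight q α m * (oddPowSum q g m : ℂ) := by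
  simp only [sumH_eq, sumMonicLE_natCast]
  rw [Finset.sum_comm]
  refine Finset.sum_congr rfl fun m _ => ?_
  rw [Finset.sum_comm, oddPowSum, Finset.sum_filter, Int.cast_sum, Finset.mul_sum]
  refine Finset.sum_congr rfl fun f hf => ?_
  have hdeg : f.natDegree = m := (mem_monicsDeg.1 hf).2
  by_cases h : IsOddPrimePow f
  · have h' : ∃ P : (ZMod q)[X], ∃ k : ℕ, P.Monic ∧ Irreducible P ∧ f = P ^ (2 * k + 1) := h
    simp only [if_pos h, if_pos h', hdeg]
    push_cast
    rw [Finset.mul_sum, Finset.mul_sum]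
    refine Finset.sum_congr rfl fun D _ => ?_
    rw [levelWeight]
    ring
  · have h' : ¬ ∃ P : (ZMod q)[X], ∃ k : ℕ, P.Monic ∧ Irreducible P ∧ f = P ^ (2 * k + 1) := h
    simp only [if_neg h, if_neg h', Finset.sum_const_zero, Int.cast_zero, mul_zero]

lemma norm_levelWeight_le {g m : ℕ} (hg : 1 ≤ g) (hm : m ≤ 4 * g) {α : ℂ}
    (hα : ‖α‖ ≤ 1 / (g : ℝ)) : ‖levelWeight q α m‖ ≤ (q : ℝ) ^ 4 / √(q : ℝ) ^ m := by
  have hq : 0 < q := (Fact.out : q.Prime).pos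
  have hq1 : (1 : ℝ) ≤ q := by exact_mod_cast hq
  have hqr : (0 : ℝ) < q := by linarith
  have hs : √(q : ℝ) ^ m = (q : ℝ) ^ ((m : ℝ) / 2) := by
    rw [Real.sqrt_eq_rpow, ← Real.rpow_natCast, ← Real.rpow_mul hqr.le]
    ring_nf
  rw [levelWeight, norm_div, norm_one, Complex.norm_natCast_cpow_of_pos hq, hs,
    div_le_div_iff₀ (by positivity) (by positivity), one_mul]
  have hre : ((m : ℂ) * (1 / 2 + α)).re = m * (1 / 2 + α.re) := by
    rw [← Complex.ofReal_natCast, Complex.re_ofReal_mul]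
    norm_num
  rw [hre, ← Real.rpow_natCast (q : ℝ) 4, ← Real.rpow_add hqr]
  refine Real.rpow_le_rpow_of_exponent_le hq1 ?_
  have hg' : (0 : ℝ) < g := by exact_mod_cast hg
  have h1 : -α.re ≤ 1 / g := (neg_le_abs _).trans ((Complex.abs_re_le_norm α).trans hα)
  have h2 : (m : ℝ) * -α.re ≤ m * (1 / g) := by gcongr
  have h3 : (m : ℝ) * (1 / g) ≤ 4 := by
    rw [mul_one_div, div_le_iff₀ hg']
    exact_mod_cast hm
  push_cast
  nlinarith

lemma levelWeight_two_mul (α : ℂ) (n : ℕ) :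
    levelWeight q α (2 * n) * (q : ℂ) ^ n = (q : ℂ) ^ (-2 * (n : ℂ) * α) := by
  have hq : (q : ℂ) ≠ 0 := Nat.cast_ne_zero.2 (Fact.out : q.Prime).ne_zero
  have h : ((2 * n : ℕ) : ℂ) * (1 / 2 + α) = n + 2 * n * α := by push_cast; ring
  have h' : -2 * (n : ℂ) * α = -(2 * n * α) := by ring
  rw [levelWeight, h, Complex.cpow_add _ _ hq, Complex.cpow_natCast, h', Complex.cpow_neg]
  field_simp

lemma sum_levelWeight_mul_mainCoeff (g N : ℕ) (α : ℂ) :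
    ∑ m ∈ Finset.range (N + 1), levelWeight q α m * (mainCoeff q g m : ℂ) =
    ((q : ℂ) ^ (2 * g + 1) - (q : ℂ) ^ (2 * g)) *
      (if 2 * g ≤ N then
        -(∑ n ∈ Finset.Icc (g + 1) (N / 2), (q : ℂ) ^ (-2 * (n : ℂ) * α))
          + (q : ℂ) ^ (-2 * (g : ℂ) * α) / ((q : ℂ) - 1)
      else 0) := by
  have hq1 : (q : ℂ) - 1 ≠ 0 :=
    sub_ne_zero.2 (Nat.cast_ne_one.2 (Fact.out : q.Prime).ne_one)
  have hterm : ∀ m, levelWeight q α m * (mainCoeff q g m : ℂ) =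
      (if m = 2 * g then (q : ℂ) ^ (2 * g) * (q : ℂ) ^ (-2 * (g : ℂ) * α) else 0) +
      (if Even m ∧ 2 * g + 2 ≤ m then
        -((q : ℂ) ^ (2 * g) * ((q : ℂ) - 1) * (levelWeight q α m * (q : ℂ) ^ (m / 2)))
        else 0) := by
    intro m
    rw [mainCoeff]
    split_ifs with h1 h2 h2
    · omega
    · rw [h1, ← levelWeight_two_mul]
      push_cast
      ring
    · push_cast
      ring
    · simp
  have hsum : ∑ m ∈ Finset.range (N + 1), (if Even m ∧ 2 * g + 2 ≤ m then
        -((q : ℂ) ^ (2 * g) * ((q : ℂ) - 1) * (levelWeight q α m * (q : ℂ) ^ (m / 2)))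
        else 0) = -((q : ℂ) ^ (2 * g) * ((q : ℂ) - 1)) *
        ∑ n ∈ Finset.Icc (g + 1) (N / 2), (q : ℂ) ^ (-2 * (n : ℂ) * α) := by
    rw [← Finset.sum_filter, Finset.mul_sum]
    symm
    refine Finset.sum_nbij' (fun n => 2 * n) (fun m => m / 2) ?_ ?_ ?_ ?_ ?_
    · intro n hn
      simp only [Finset.mem_Icc, Finset.mem_filter, Finset.mem_range] at hn ⊢
      exact ⟨by omega, even_two_mul n, by omega⟩
    · intro m hm
      simp only [Finset.mem_Icc, Finset.mem_filter, Finset.mem_range] at hm ⊢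
      omega
    · intro n _
      simp
    · intro m hm
      exact Nat.two_mul_div_two_of_even (Finset.mem_filter.1 hm).2.1
    · intro n _
      rw [Nat.mul_div_cancel_left _ two_pos, levelWeight_two_mul]
      ring
  simp only [hterm, Finset.sum_add_distrib, hsum, Finset.sum_ite_eq', Finset.mem_range]
  split_ifs with h1 h2 h2
  · field_simp
    ring
  · omega
  · omega
  · rw [Finset.Icc_eq_empty (by omega)]
    simp

lemma sum_range_pow_le {s : ℝ} (hs : 2 ≤ s) (N : ℕ) :
    ∑ m ∈ Finset.range (N + 1), s ^ m ≤ 2 * s ^ N := by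
  induction N with
  | zero => simp
  | succ n ih =>
    rw [Finset.sum_range_succ, pow_succ s n]
    have : 0 ≤ s ^ n := by positivity
    nlinarith

lemma sum_norm_error_le (hq : 4 ≤ q) {g N : ℕ} (hg : 1 ≤ g) (hN : N ≤ 4 * g) {α : ℂ}
    (hα : ‖α‖ ≤ 1 / (g : ℝ)) :
    ∑ m ∈ Finset.range (N + 1), ‖levelWeight q α m‖ *
      ‖((oddPowSum q g m - mainCoeff q g m - tailSum q g m : ℤ) : ℂ)‖ ≤
    108 * (q : ℝ) ^ 6 * N * √(q : ℝ) ^ N := by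
  have hs : (2 : ℝ) ≤ √(q : ℝ) := Real.le_sqrt_of_sq_le (by norm_num; exact_mod_cast hq)
  have hss : √(q : ℝ) ^ 2 = q := Real.sq_sqrt (Nat.cast_nonneg _)
  have hterm : ∀ m ∈ Finset.range (N + 1), ‖levelWeight q α m‖ *
      ‖((oddPowSum q g m - mainCoeff q g m - tailSum q g m : ℤ) : ℂ)‖ ≤
      54 * (q : ℝ) ^ 6 * N * √(q : ℝ) ^ m := by
    intro m hm
    have hmN : m ≤ N := Nat.lt_succ_iff.1 (Finset.mem_range.1 hm)
    have h1 := norm_levelWeight_le (q := q) hg (hmN.trans hN) hα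
    have h2 : ‖((oddPowSum q g m - mainCoeff q g m - tailSum q g m : ℤ) : ℂ)‖ ≤
        54 * N * (q : ℝ) ^ (m + 2) := by
      rw [Complex.norm_intCast]
      have h := abs_oddPowSum_sub_le (q := q) (by omega) g m hg
      have h' : (|((oddPowSum q g m - mainCoeff q g m - tailSum q g m : ℤ) : ℝ)|) ≤
          54 * m * (q : ℝ) ^ (m + 2) := by exact_mod_cast h
      refine h'.trans ?_
      gcongr
    calc _ ≤ (q : ℝ) ^ 4 / √(q : ℝ) ^ m * (54 * N * (q : ℝ) ^ (m + 2)) := by gcongr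
      _ = 54 * (q : ℝ) ^ 6 * N * √(q : ℝ) ^ m := by
        have : (q : ℝ) ^ m = √(q : ℝ) ^ m * √(q : ℝ) ^ m := by rw [← mul_pow, ← sq, hss]
        rw [pow_add, this]
        field_simp
  refine (Finset.sum_le_sum hterm).trans ?_
  rw [← Finset.mul_sum]
  have := sum_range_pow_le hs N
  calc _ ≤ 54 * (q : ℝ) ^ 6 * N * (2 * √(q : ℝ) ^ N) := by gcongr
    _ = _ := by ring

lemma norm_levelWeight_mul_tailSum_le (hq : 4 ≤ q) {g d : ℕ} (hg : 1 ≤ g) (hd : d ≤ g) {α : ℂ}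
    (hα : ‖α‖ ≤ 1 / (g : ℝ)) :
    ‖levelWeight q α d‖ * ‖(tailSum q g d : ℂ)‖ ≤
      (q : ℝ) ^ 4 * √(q : ℝ) ^ (2 * g + 2) * (1 / 2) ^ (d.dist (2 * g / 3) - 1) := by
  have hs : (2 : ℝ) ≤ √(q : ℝ) := Real.le_sqrt_of_sq_le (by norm_num; exact_mod_cast hq)
  have hs0 : (0 : ℝ) < √(q : ℝ) := by linarith
  have hss : √(q : ℝ) ^ 2 = q := Real.sq_sqrt (Nat.cast_nonneg _)
  have h1 := norm_levelWeight_le (q := q) hg (show d ≤ 4 * g by omega) hα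
  have key : ∀ a b : ℕ, (|tailSum q g d| ≤ (q : ℤ) ^ a) → 2 * a + b ≤ 2 * g + 2 + d →
      ‖levelWeight q α d‖ * ‖(tailSum q g d : ℂ)‖ ≤
      (q : ℝ) ^ 4 * √(q : ℝ) ^ (2 * g + 2) * (1 / 2) ^ b := by
    intro a b ha hab
    have h2 : ‖(tailSum q g d : ℂ)‖ ≤ √(q : ℝ) ^ (2 * a) := by
      rw [Complex.norm_intCast, pow_mul, hss]
      exact_mod_cast ha
    have h3 : √(q : ℝ) ^ (2 * a) * 2 ^ b ≤ √(q : ℝ) ^ (2 * g + 2) * √(q : ℝ) ^ d := by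
      calc _ ≤ √(q : ℝ) ^ (2 * a) * √(q : ℝ) ^ b := by gcongr
        _ = √(q : ℝ) ^ (2 * a + b) := (pow_add _ _ _).symm
        _ ≤ √(q : ℝ) ^ (2 * g + 2 + d) := pow_le_pow_right₀ (by linarith) hab
        _ = _ := pow_add _ _ _
    calc _ ≤ (q : ℝ) ^ 4 / √(q : ℝ) ^ d * √(q : ℝ) ^ (2 * a) := by gcongr
      _ = (q : ℝ) ^ 4 * (1 / 2) ^ b / √(q : ℝ) ^ d * (√(q : ℝ) ^ (2 * a) * 2 ^ b) := by
        rw [one_div, inv_pow]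
        field_simp
      _ ≤ (q : ℝ) ^ 4 * (1 / 2) ^ b / √(q : ℝ) ^ d *
          (√(q : ℝ) ^ (2 * g + 2) * √(q : ℝ) ^ d) := by gcongr
      _ = _ := by field_simp
  rcases le_or_gt d (2 * g / 3) with h | h
  · refine key (d + (d + 1)) _ ?_ ?_
    · rw [pow_add]
      exact abs_tailSum_le_of_natDegree (by omega) g d
    · rw [Nat.dist_eq_sub_of_le h]
      omega
  · refine key (d + (2 * g + 1 - 2 * d)) _ ?_ ?_
    · rw [pow_add]
      exact abs_tailSum_le_trivial g d
    · rw [Nat.dist_eq_sub_of_le_right h.le]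
      omega

lemma sum_half_pow_le (n : ℕ) : ∑ i ∈ Finset.range n, (1 / 2 : ℝ) ^ i ≤ 2 := by
  rw [geom_sum_eq (by norm_num)]
  have : (0 : ℝ) < (1 / 2) ^ n := by positivity
  rw [div_le_iff_of_neg (by norm_num)]
  linarith

lemma sum_half_pow_dist_le (a n : ℕ) :
    ∑ d ∈ Finset.range n, (1 / 2 : ℝ) ^ (d.dist a - 1) ≤ 5 := by
  rw [← Finset.sum_filter_add_sum_filter_not _ (fun d => d < a)]
  have h1 : ∑ d ∈ (Finset.range n).filter (fun d => d < a), (1 / 2 : ℝ) ^ (d.dist a - 1) ≤ 2 := by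
    refine le_trans ?_ (sum_half_pow_le a)
    calc _ ≤ ∑ d ∈ Finset.range a, (1 / 2 : ℝ) ^ (d.dist a - 1) := by
          refine Finset.sum_le_sum_of_subset_of_nonneg (fun d hd => ?_) fun _ _ _ => by positivity
          exact Finset.mem_range.2 (Finset.mem_filter.1 hd).2
      _ = ∑ d ∈ Finset.range a, (1 / 2 : ℝ) ^ (a - 1 - d) := by
          refine Finset.sum_congr rfl fun d hd => ?_
          rw [Nat.dist_eq_sub_of_le (Finset.mem_range.1 hd).le]
          congr 1
          omega
      _ = _ := Finset.sum_range_reflect (fun i => (1 / 2 : ℝ) ^ i) a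
      _ ≤ _ := le_rfl
  have h2 : ∑ d ∈ (Finset.range n).filter (fun d => ¬ d < a), (1 / 2 : ℝ) ^ (d.dist a - 1) ≤
      3 := by
    calc _ ≤ ∑ d ∈ Finset.Ico a (a + 1 + n), (1 / 2 : ℝ) ^ (d.dist a - 1) := by
          refine Finset.sum_le_sum_of_subset_of_nonneg (fun d hd => ?_) fun _ _ _ => by positivity
          rw [Finset.mem_filter, Finset.mem_range] at hd
          rw [Finset.mem_Ico]
          omega
      _ = ∑ i ∈ Finset.range (n + 1), (1 / 2 : ℝ) ^ (i - 1) := by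
          rw [Finset.sum_Ico_eq_sum_range, show a + 1 + n - a = n + 1 by omega]
          refine Finset.sum_congr rfl fun i _ => ?_
          rw [Nat.dist_eq_sub_of_le_right (Nat.le_add_right a i), Nat.add_sub_cancel_left]
      _ ≤ 3 := by
          rw [Finset.sum_range_succ']
          have := sum_half_pow_le n
          simp only [Nat.add_sub_cancel, zero_tsub, pow_zero]
          linarith
  linarith

lemma sum_norm_tail_le (hq : 4 ≤ q) {g : ℕ} (N : ℕ) (hg : 1 ≤ g) {α : ℂ}
    (hα : ‖α‖ ≤ 1 / (g : ℝ)) :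
    ∑ m ∈ Finset.range (N + 1), ‖levelWeight q α m‖ * ‖(tailSum q g m : ℂ)‖ ≤
      5 * (q : ℝ) ^ 5 * (q : ℝ) ^ g := by
  have hss : √(q : ℝ) ^ 2 = q := Real.sq_sqrt (Nat.cast_nonneg _)
  have hterm : ∀ m, ‖levelWeight q α m‖ * ‖(tailSum q g m : ℂ)‖ ≤
      (q : ℝ) ^ 4 * √(q : ℝ) ^ (2 * g + 2) * (1 / 2) ^ (m.dist (2 * g / 3) - 1) := by
    intro m
    rcases le_or_gt m g with h | h
    · exact norm_levelWeight_mul_tailSum_le hq hg h hα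
    · rw [tailSum_eq_zero h]
      simp only [Int.cast_zero, norm_zero, mul_zero]
      positivity
  refine (Finset.sum_le_sum fun m _ => hterm m).trans ?_
  rw [← Finset.mul_sum]
  calc _ ≤ (q : ℝ) ^ 4 * √(q : ℝ) ^ (2 * g + 2) * 5 := by
        gcongr
        exact sum_half_pow_dist_le _ _
    _ = _ := by
        rw [show 2 * g + 2 = 2 * (g + 1) by ring, pow_mul, hss]
        ring

lemma norm_sum_levelWeight_sub_le (hq : 4 ≤ q) {g N : ℕ} (hg : 1 ≤ g) (hN : N ≤ 4 * g) {α : ℂ}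
    (hα : ‖α‖ ≤ 1 / (g : ℝ)) :
    ‖∑ m ∈ Finset.range (N + 1), levelWeight q α m * (oddPowSum q g m : ℂ) -
      ∑ m ∈ Finset.range (N + 1), levelWeight q α m * (mainCoeff q g m : ℂ)‖ ≤
      108 * (q : ℝ) ^ 6 * N * √(q : ℝ) ^ N + 5 * (q : ℝ) ^ 5 * (q : ℝ) ^ g := by
  have hsplit : ∑ m ∈ Finset.range (N + 1), levelWeight q α m * (oddPowSum q g m : ℂ) -
      ∑ m ∈ Finset.range (N + 1), levelWeight q α m * (mainCoeff q g m : ℂ) =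
      ∑ m ∈ Finset.range (N + 1), levelWeight q α m *
        ((oddPowSum q g m - mainCoeff q g m - tailSum q g m : ℤ) : ℂ) +
      ∑ m ∈ Finset.range (N + 1), levelWeight q α m * (tailSum q g m : ℂ) := by
    rw [← Finset.sum_sub_distrib, ← Finset.sum_add_distrib]
    refine Finset.sum_congr rfl fun m _ => ?_
    push_cast
    ring
  rw [hsplit]
  refine (norm_add_le _ _).trans (add_le_add ?_ ?_)
  · refine (norm_sum_le _ _).trans ?_
    simp only [norm_mul]
    exact sum_norm_error_le hq hg hN hα
  · refine (norm_sum_le _ _).trans ?_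
    simp only [norm_mul]
    exact sum_norm_tail_le hq N hg hα

end LevelSum

/-- Type-I terms of the one level density: there is `C(q)` such that
for `1 ≤ g`, `1 ≤ N < 4g` and `|α| ≤ 1/g`,
`I_1^1(N;α) = 1_{N ≥ 2g} (-∑_{n=g+1}^{⌊N/2⌋} q^{-2nα} + q^{-2gα}/(q-1))
  + O(N q^{N/2-2g} + q^{-g})`. -/
theorem statement12 (q : ℕ) [Fact q.Prime] (hq4 : q % 4 = 1) :
    ∃ C : ℝ, 0 < C ∧ ∀ g N : ℕ, 1 ≤ g → 1 ≤ N → N < 4 * g →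
      ∀ α : ℂ, ‖α‖ ≤ 1 / (g : ℝ) →
      ‖(1 / ((q : ℂ) ^ (2 * g + 1) - (q : ℂ) ^ (2 * g))) *
            sumH q g (fun D =>
              sumMonicLE q (N : ℤ) (fun f =>
                if ∃ P : Polynomial (ZMod q), ∃ k : ℕ,
                    P.Monic ∧ Irreducible P ∧ f = P ^ (2 * k + 1) then
                  (vM q f : ℂ) * (jacSym q D f : ℂ) /
                    (q : ℂ) ^ ((f.natDegree : ℂ) * (1 / 2 + α))
                else 0))
          - (if 2 * g ≤ N then
              -(∑ n ∈ Finset.Icc (g + 1) (N / 2), (q : ℂ) ^ (-2 * (n : ℂ) * α))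
                + (q : ℂ) ^ (-2 * (g : ℂ) * α) / ((q : ℂ) - 1)
            else 0)‖
        ≤ C * ((N : ℝ) * (q : ℝ) ^ ((N : ℝ) / 2 - 2 * g) + (q : ℝ) ^ (-(g : ℝ))) := by
  have hprime : q.Prime := Fact.out
  have hq : 4 ≤ q := by
    have := hprime.two_le
    omega
  have hqr : (1 : ℝ) ≤ q := by exact_mod_cast hprime.one_le
  have hq0 : (0 : ℝ) < q := by linarith
  refine ⟨108 * (q : ℝ) ^ 6, by positivity, fun g N hg _ hN α hα => ?_⟩
  have hB := norm_sum_levelWeight_sub_le hq hg hN.le hα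
  rw [sum_levelWeight_mul_mainCoeff] at hB
  rw [sumH_sumMonicLE_eq]
  set E : ℂ := if 2 * g ≤ N then
    -(∑ n ∈ Finset.Icc (g + 1) (N / 2), (q : ℂ) ^ (-2 * (n : ℂ) * α))
      + (q : ℂ) ^ (-2 * (g : ℂ) * α) / ((q : ℂ) - 1) else 0
  set S : ℂ := ∑ m ∈ Finset.range (N + 1), levelWeight q α m * (oddPowSum q g m : ℂ)
  set c : ℂ := (q : ℂ) ^ (2 * g + 1) - (q : ℂ) ^ (2 * g) with hc
  have hc' : c = (((q : ℝ) ^ (2 * g) * ((q : ℝ) - 1) : ℝ) : ℂ) := by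
    rw [hc]
    push_cast
    ring
  have hq4r : (4 : ℝ) ≤ q := by exact_mod_cast hq
  have hnorm : (q : ℝ) ^ (2 * g) ≤ ‖c‖ := by
    rw [hc', Complex.norm_real, Real.norm_of_nonneg (mul_nonneg (by positivity) (by linarith))]
    exact le_mul_of_one_le_right (by positivity) (by linarith)
  have hpos : (0 : ℝ) < (q : ℝ) ^ (2 * g) := by positivity
  have hc0 : c ≠ 0 := norm_pos_iff.1 (hpos.trans_le hnorm)
  have h1 : 1 / c * S - E = (S - c * E) / c := by field_simp
  have hs : √(q : ℝ) ^ N = (q : ℝ) ^ ((N : ℝ) / 2) := by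
    rw [Real.sqrt_eq_rpow, ← Real.rpow_natCast, ← Real.rpow_mul hq0.le]
    ring_nf
  have h2 : (q : ℝ) ^ ((N : ℝ) / 2 - 2 * g) = √(q : ℝ) ^ N / (q : ℝ) ^ (2 * g) := by
    rw [Real.rpow_sub hq0, hs, ← Real.rpow_natCast (q : ℝ) (2 * g)]
    push_cast
    rfl
  have h3 : (q : ℝ) ^ (-(g : ℝ)) = (q : ℝ) ^ g / (q : ℝ) ^ (2 * g) := by
    rw [Real.rpow_neg hq0.le, Real.rpow_natCast, two_mul, pow_add]
    field_simp
  rw [h1, norm_div, h2, h3]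
  calc _ ≤ (108 * (q : ℝ) ^ 6 * N * √(q : ℝ) ^ N + 5 * (q : ℝ) ^ 5 * (q : ℝ) ^ g) /
        (q : ℝ) ^ (2 * g) := by gcongr
    _ ≤ (108 * (q : ℝ) ^ 6 * N * √(q : ℝ) ^ N + 108 * (q : ℝ) ^ 6 * (q : ℝ) ^ g) /
        (q : ℝ) ^ (2 * g) := by
      gcongr <;> norm_num
    _ = _ := by
      field_simp
end

section
/- For every complex u with |u| > 1/q, the product ∏_P (1 − 1/|P|²)^{−1} (1 − 1/(|P|³ u^{2 d(P)})), taken over all monic irreducible polynomials P in F_q[t], converges absolutely and equals 1 + (1 − 1/(q u²))/(q − 1) = q(1 − 1/(q² u²))/(q − 1). -/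
open Polynomial

noncomputable section

/-- The Euler factor `(1 - 1/|P|²)⁻¹ (1 - 1/(|P|³ u^{2 d(P)}))`. -/
def eulerFac (q : ℕ) (u : ℂ) (P : MonicIrr q) : ℂ :=
  (1 - 1 / (q : ℂ) ^ (2 * P.1.natDegree))⁻¹ *
    (1 - 1 / ((q : ℂ) ^ (3 * P.1.natDegree) * u ^ (2 * P.1.natDegree)))

/-- The Euler product over a free commutative monoid: if the products of the `a i` over all finite
multisets are absolutely summable, then `∏ (1 - a i)⁻¹` converges to their sum. -/
theorem hasProd_one_sub_inv_of_summable_multiset {ι : Type*} {a : ι → ℂ} (ha : ∀ i, a i ≠ 1)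
    (hsum : Summable fun s : Multiset ι ↦ ‖(s.map a).prod‖) :
    HasProd (fun i ↦ (1 - a i)⁻¹) (∑' s : Multiset ι, (s.map a).prod) := by
  classical
  set w : Multiset ι → ℂ := fun s ↦ (s.map a).prod with hw
  have hind (A : Set (Multiset ι)) : Summable (A.indicator w) := hsum.of_norm.indicator A
  let T (S : Finset ι) : Set (Multiset ι) := {s | ∀ i ∈ s, i ∈ S}
  have key (S : Finset ι) : ∏ i ∈ S, (1 - a i)⁻¹ = ∑' s, (T S).indicator w s := by
    induction S using Finset.induction_on with
    | empty =>
      rw [tsum_eq_single 0]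
      · simp [T, hw]
      · intro s hs
        refine Set.indicator_of_notMem (fun h ↦ hs ?_) _
        exact Multiset.eq_zero_of_forall_notMem fun i hi ↦ by simpa using h i hi
    | insert i S hi ih =>
      have hsplit (s : Multiset ι) : (T (insert i S)).indicator w s =
          (T S).indicator w s + (T (insert i S) ∩ {s | i ∈ s}).indicator w s := by
        by_cases his : i ∈ s
        · have h1 : s ∉ T S := fun h ↦ hi (h i his)
          by_cases hs : s ∈ T (insert i S) <;> simp [h1, hs, his]
        · have h1 : s ∈ T (insert i S) ↔ s ∈ T S := by
            refine forall₂_congr fun j hj ↦ ?_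
            have : j ≠ i := fun h ↦ his (h ▸ hj)
            simp [this]
          by_cases hs : s ∈ T S <;> simp [h1, hs, his]
      have hcons : ∑' s, (T (insert i S) ∩ {s | i ∈ s}).indicator w s =
          a i * ∑' s, (T (insert i S)).indicator w s := by
        rw [← tsum_mul_left,
            ← (show Function.Injective (i ::ₘ ·) from fun _ _ ↦ (Multiset.cons_inj_right i).1).tsum_eq]
        · refine tsum_congr fun s ↦ ?_
          have h1 : i ::ₘ s ∈ T (insert i S) ↔ s ∈ T (insert i S) := by simp [T]
          by_cases hs : s ∈ T (insert i S) <;> simp [h1, hs, hw]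
        · intro s hs
          obtain ⟨t, rfl⟩ := Multiset.exists_cons_of_mem (Set.mem_of_indicator_ne_zero hs).2
          exact ⟨t, rfl⟩
      have htot := (hind (T S)).tsum_add (hind (T (insert i S) ∩ {s | i ∈ s}))
      rw [← tsum_congr hsplit, hcons] at htot
      have h1 : 1 - a i ≠ 0 := sub_ne_zero.2 (ha i).symm
      rw [Finset.prod_insert hi, ih, inv_mul_eq_iff_eq_mul₀ h1]
      linear_combination -htot
  have hlim : Filter.Tendsto (fun S ↦ ∑' s, (T S).indicator w s) Filter.atTop
      (nhds (∑' s, w s)) := by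
    refine tendsto_tsum_of_dominated_convergence hsum (fun s ↦ ?_)
      (Filter.Eventually.of_forall fun S s ↦ norm_indicator_le_norm_self w s)
    refine tendsto_const_nhds.congr' ?_
    filter_upwards [Filter.eventually_ge_atTop s.toFinset] with S hS
    have hs : s ∈ T S := fun i hi ↦ hS (Multiset.mem_toFinset.2 hi)
    exact (Set.indicator_of_mem hs w).symm
  simpa only [HasProd, SummationFilter.unconditional_filter, key] using hlim

section FiniteField

variable {F : Type*} [Field F]

/-- Unique factorization: monic polynomials over a field are multisets of monic irreducible ones. -/
def multisetMonicIrreducibleEquiv :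
    Multiset {P : F[X] // P.Monic ∧ Irreducible P} ≃ {p : F[X] // p.Monic} :=
  Equiv.ofBijective
    (fun s ↦ ⟨(s.map Subtype.val).prod, monic_multiset_prod_of_monic _ _ fun P _ ↦ P.2.1⟩) <| by
    classical
    constructor
    · intro s t hst
      have hfac (s : Multiset {P : F[X] // P.Monic ∧ Irreducible P}) :
          UniqueFactorizationMonoid.normalizedFactors (s.map Subtype.val).prod =
            s.map Subtype.val := by
        rw [UniqueFactorizationMonoid.normalizedFactors_prod_eq]
        · rw [Multiset.map_map]
          exact Multiset.map_congr rfl fun P _ ↦ P.2.1.normalize_eq_self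
        · intro p hp
          obtain ⟨P, -, rfl⟩ := Multiset.mem_map.1 hp
          exact P.2.2
      refine Multiset.map_injective Subtype.val_injective ?_
      exact (hfac s).symm.trans ((congrArg _ (Subtype.ext_iff.1 hst)).trans (hfac t))
    · rintro ⟨p, hp⟩
      have hmem : ∀ P ∈ UniqueFactorizationMonoid.normalizedFactors p,
          P.Monic ∧ Irreducible P := fun P hP ↦
        ⟨by
          rw [← UniqueFactorizationMonoid.normalize_normalized_factor P hP]
          exact monic_normalize (UniqueFactorizationMonoid.ne_zero_of_mem_normalizedFactors hP),
        UniqueFactorizationMonoid.irreducible_of_normalized_factor P hP⟩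
      refine ⟨(UniqueFactorizationMonoid.normalizedFactors p).attach.map
        fun P ↦ ⟨P.1, hmem P.1 P.2⟩, Subtype.ext ?_⟩
      simp only [Multiset.map_map, Function.comp_def, Multiset.attach_map_val]
      rw [UniqueFactorizationMonoid.prod_normalizedFactors_eq hp.ne_zero, hp.normalize_eq_self]

theorem natDegree_multisetMonicIrreducibleEquiv
    (s : Multiset {P : F[X] // P.Monic ∧ Irreducible P}) :
    (multisetMonicIrreducibleEquiv s).1.natDegree = (s.map fun P ↦ P.1.natDegree).sum := by
  change (s.map Subtype.val).prod.natDegree = _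
  rw [natDegree_multiset_prod_of_monic, Multiset.map_map]
  · rfl
  · intro p hp
    obtain ⟨P, -, rfl⟩ := Multiset.mem_map.1 hp
    exact P.2.1

/-- Monic polynomials of degree `n` are parametrized by their lower coefficients. -/
def monicFiberEquiv (F : Type*) [Field F] (n : ℕ) :
    {p : {p : F[X] // p.Monic} // p.1.natDegree = n} ≃ (Fin n → F) :=
  ((Equiv.subtypeSubtypeEquivSubtypeInter _ _).trans (monicEquivDegreeLT n)).trans
    (degreeLTEquiv F n).toEquiv

variable [Fintype F]

/-- The zeta function of `F[X]`, as a power series in `x = |F|^{-s}`. -/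
theorem summable_norm_and_tsum_pow_natDegree_monic {x : ℂ} (hx : Fintype.card F * ‖x‖ < 1) :
    Summable (fun p : {p : F[X] // p.Monic} ↦ ‖x ^ p.1.natDegree‖) ∧
      ∑' p : {p : F[X] // p.Monic}, x ^ p.1.natDegree = (1 - Fintype.card F * x)⁻¹ := by
  let e := Equiv.sigmaFiberEquiv fun p : {p : F[X] // p.Monic} ↦ p.1.natDegree
  have hfin (n : ℕ) : Finite {p : {p : F[X] // p.Monic} // p.1.natDegree = n} :=
    .of_equiv _ (monicFiberEquiv F n).symm
  have hcard (n : ℕ) :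
      Nat.card {p : {p : F[X] // p.Monic} // p.1.natDegree = n} = Fintype.card F ^ n := by
    rw [Nat.card_congr (monicFiberEquiv F n), Nat.card_eq_fintype_card]
    simp
  have hfib {K : Type} [NormedField K] (y : K) (n : ℕ) :
      ∑' p : {p : {p : F[X] // p.Monic} // p.1.natDegree = n}, y ^ (e ⟨n, p⟩).1.natDegree =
        (Fintype.card F * y) ^ n := by
    have h (p : {p : {p : F[X] // p.Monic} // p.1.natDegree = n}) :
        y ^ (e ⟨n, p⟩).1.natDegree = y ^ n := by
      rw [show (e ⟨n, p⟩).1.natDegree = n from p.2]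
    rw [tsum_congr h, tsum_const, hcard, nsmul_eq_mul, mul_pow, Nat.cast_pow]
  have hsum : Summable (fun p : {p : F[X] // p.Monic} ↦ ‖x ^ p.1.natDegree‖) := by
    simp only [norm_pow]
    rw [← e.summable_iff, summable_sigma_of_nonneg fun _ ↦ by simp only [Function.comp]; positivity]
    refine ⟨fun n ↦ Summable.of_finite, ?_⟩
    simp only [Function.comp_def, hfib]
    exact summable_geometric_of_lt_one (by positivity) hx
  refine ⟨hsum, ?_⟩
  rw [← e.tsum_eq, (e.summable_iff.2 hsum.of_norm).tsum_sigma' (f := fun c ↦ x ^ (e c).1.natDegree)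
    fun n ↦ Summable.of_finite]
  simp only [hfib]
  exact tsum_geometric_of_norm_lt_one (by simpa using hx)

/-- The Euler product of the zeta function of `F[X]`, with `x = |F|^{-s}`. -/
theorem hasProd_one_sub_pow_natDegree_inv {x : ℂ} (hx : Fintype.card F * ‖x‖ < 1) :
    HasProd (fun P : {P : F[X] // P.Monic ∧ Irreducible P} ↦ (1 - x ^ P.1.natDegree)⁻¹)
      (1 - Fintype.card F * x)⁻¹ := by
  obtain ⟨hsum, htsum⟩ := summable_norm_and_tsum_pow_natDegree_monic hx
  have hx1 : ‖x‖ < 1 := by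
    refine lt_of_le_of_lt (le_mul_of_one_le_left (norm_nonneg x) ?_) hx
    exact_mod_cast Fintype.card_pos (α := F)
  have hw (s : Multiset {P : F[X] // P.Monic ∧ Irreducible P}) :
      (s.map fun P ↦ x ^ P.1.natDegree).prod =
        x ^ (multisetMonicIrreducibleEquiv s).1.natDegree := by
    rw [natDegree_multisetMonicIrreducibleEquiv]
    induction s using Multiset.induction_on with
    | empty => simp
    | cons P s ih => simp [ih, pow_add]
  rw [← htsum, ← multisetMonicIrreducibleEquiv.tsum_eq]
  simp only [← hw]
  refine hasProd_one_sub_inv_of_summable_multiset (fun P h ↦ ?_) ?_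
  · have := pow_lt_one₀ (norm_nonneg x) hx1 P.2.2.natDegree_pos.ne'
    rw [← norm_pow, h, norm_one] at this
    exact lt_irrefl _ this
  · simp only [hw]
    exact (multisetMonicIrreducibleEquiv.summable_iff
      (f := fun p : {p : F[X] // p.Monic} ↦ ‖x ^ p.1.natDegree‖)).2 hsum

end FiniteField

/-- for `|u| > 1/q` the product
`∏_P (1 - 1/|P|²)⁻¹ (1 - 1/(|P|³ u^{2d(P)}))` over the monic irreducible polynomials
converges absolutely and equals `1 + (1 - 1/(qu²))/(q - 1) = q(1 - 1/(q²u²))/(q - 1)`. -/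
theorem statement14 (q : ℕ) (hq : q.Prime) (u : ℂ) (hu : 1 / (q : ℝ) < ‖u‖) :
    Multipliable (eulerFac q u) ∧
    ∏' P : MonicIrr q, eulerFac q u P = 1 + (1 - 1 / ((q : ℂ) * u ^ 2)) / ((q : ℂ) - 1) ∧
    ∏' P : MonicIrr q, eulerFac q u P
      = (q : ℂ) * (1 - 1 / ((q : ℂ) ^ 2 * u ^ 2)) / ((q : ℂ) - 1) := by
  have : Fact q.Prime := ⟨hq⟩
  have hq0 : (0 : ℝ) < q := by exact_mod_cast hq.pos
  have hq1 : (1 : ℝ) < q := by exact_mod_cast hq.one_lt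
  have hqc : (q : ℂ) ≠ 0 := by exact_mod_cast hq.ne_zero
  have hqc1 : (q : ℂ) - 1 ≠ 0 := sub_ne_zero.2 (by exact_mod_cast hq.one_lt.ne')
  have hu0 : u ≠ 0 := norm_pos_iff.1 (lt_trans (by positivity) hu)
  have hqu : 1 < q * ‖u‖ := by rwa [div_lt_iff₀' hq0] at hu
  have h1 : (Fintype.card (ZMod q) : ℝ) * ‖1 / (q : ℂ) ^ 2‖ < 1 := by
    rw [ZMod.card, norm_div, norm_pow, Complex.norm_natCast, norm_one, mul_one_div,
      div_lt_one (by positivity)]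
    exact lt_self_pow₀ hq1 one_lt_two
  have h2 : (Fintype.card (ZMod q) : ℝ) * ‖1 / ((q : ℂ) ^ 3 * u ^ 2)‖ < 1 := by
    rw [ZMod.card, norm_div, norm_mul, norm_pow, norm_pow, Complex.norm_natCast, norm_one,
      mul_one_div, div_lt_one (by positivity)]
    have : 1 < (q * ‖u‖) ^ 2 := one_lt_pow₀ hqu two_ne_zero
    calc (q : ℝ) = q * 1 := (mul_one _).symm
      _ < q * (q * ‖u‖) ^ 2 := by gcongr
      _ = q ^ 3 * ‖u‖ ^ 2 := by ring
  have h2' : 1 - (Fintype.card (ZMod q) : ℂ) * (1 / ((q : ℂ) ^ 3 * u ^ 2)) ≠ 0 := by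
    intro h
    have := congrArg norm (sub_eq_zero.1 h)
    rw [norm_one, norm_mul, Complex.norm_natCast] at this
    exact h2.ne this.symm
  have key := (hasProd_one_sub_pow_natDegree_inv h1).mul
    ((hasProd_one_sub_pow_natDegree_inv h2).inv₀ (inv_ne_zero h2'))
  have hfac : HasProd (eulerFac q u)
      ((q : ℂ) * (1 - 1 / ((q : ℂ) ^ 2 * u ^ 2)) / ((q : ℂ) - 1)) := by
    convert key using 1
    · funext P
      simp only [eulerFac, inv_inv, div_pow, one_pow, mul_pow, pow_mul]
    · rw [inv_inv, ZMod.card,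
        show 1 - (q : ℂ) * (1 / (q : ℂ) ^ 2) = (q - 1) / q by field_simp, inv_div]
      field_simp
  refine ⟨hfac.multipliable, ?_, hfac.tprod_eq⟩
  rw [hfac.tprod_eq]
  field_simp
  ring
end
end

section
/- Let α, β, u be complex numbers with Re α > −1/2, Re β > −1/2 and |u| < q^{min(0, Re α, Re β)}. Then all of the following sums over monic irreducible polynomials P, Q of F_q[t] converge absolutely, and ∑_{k,l ≥ 1} ∑_{P, Q} d(P) d(Q) u^{2k d(P) + 2l d(Q)} |P|^{−k(1+2α)} |Q|^{−l(1+2β)} W(P, Q) = S(α) S(β) + ∑_P d(P)² |P| u^{4 d(P)} / ( (|P|^{1+2α} − u^{2 d(P)}) (|P|^{1+2β} − u^{2 d(P)}) (|P| + 1)² ), where W(P, Q) = (1 − 1/(|P|+1))(1 − 1/(|Q|+1)) if P ≠ Q, W(P, P) = 1 − 1/(|P|+1), and S(γ) = ∑_P d(P) |P| u^{2 d(P)} / ( (|P| + 1)(|P|^{1+2γ} − u^{2 d(P)}) ). -/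
open Polynomial
open scoped Classical

noncomputable section

/-- `W(P,Q) = (1 - 1/(|P|+1))(1 - 1/(|Q|+1))` for `P ≠ Q`, and
`W(P,P) = 1 - 1/(|P|+1)`. -/
def Wfac (q : ℕ) (P Q : MonicIrr q) : ℂ :=
  if P = Q then 1 - 1 / ((q : ℂ) ^ P.1.natDegree + 1)
  else (1 - 1 / ((q : ℂ) ^ P.1.natDegree + 1)) * (1 - 1 / ((q : ℂ) ^ Q.1.natDegree + 1))

/-- The general term `d(P) d(Q) u^{2k d(P) + 2l d(Q)} |P|^{-k(1+2α)} |Q|^{-l(1+2β)} W(P,Q)`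
of the even-even diagonal sum, indexed by `k = x.1 + 1 ≥ 1`, `l = x.2.1 + 1 ≥ 1`,
`P = x.2.2.1`, `Q = x.2.2.2`. -/
def eeTerm (q : ℕ) (u α β : ℂ) (x : ℕ × ℕ × MonicIrr q × MonicIrr q) : ℂ :=
  (x.2.2.1.1.natDegree : ℂ) * (x.2.2.2.1.natDegree : ℂ) *
    u ^ (2 * (x.1 + 1) * x.2.2.1.1.natDegree + 2 * (x.2.1 + 1) * x.2.2.2.1.natDegree) *
    (q : ℂ) ^ (-((x.1 + 1 : ℕ) : ℂ) * (1 + 2 * α) * (x.2.2.1.1.natDegree : ℂ)) *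
    (q : ℂ) ^ (-((x.2.1 + 1 : ℕ) : ℂ) * (1 + 2 * β) * (x.2.2.2.1.natDegree : ℂ)) *
    Wfac q x.2.2.1 x.2.2.2

/-- `S(γ)`-term: `d(P) |P| u^{2d(P)} / ((|P|+1)(|P|^{1+2γ} - u^{2d(P)}))`. -/
def Sterm (q : ℕ) (u γ : ℂ) (P : MonicIrr q) : ℂ :=
  (P.1.natDegree : ℂ) * (q : ℂ) ^ P.1.natDegree * u ^ (2 * P.1.natDegree) /
    (((q : ℂ) ^ P.1.natDegree + 1) *
      ((q : ℂ) ^ ((P.1.natDegree : ℂ) * (1 + 2 * γ)) - u ^ (2 * P.1.natDegree)))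

/-- The right-hand-side term
`d(P)² |P| u^{4d(P)} / ((|P|^{1+2α} - u^{2d(P)})(|P|^{1+2β} - u^{2d(P)})(|P|+1)²)`. -/
def eeRHSterm (q : ℕ) (u α β : ℂ) (P : MonicIrr q) : ℂ :=
  (P.1.natDegree : ℂ) ^ 2 * (q : ℂ) ^ P.1.natDegree * u ^ (4 * P.1.natDegree) /
    (((q : ℂ) ^ ((P.1.natDegree : ℂ) * (1 + 2 * α)) - u ^ (2 * P.1.natDegree)) *
      ((q : ℂ) ^ ((P.1.natDegree : ℂ) * (1 + 2 * β)) - u ^ (2 * P.1.natDegree)) *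
      ((q : ℂ) ^ P.1.natDegree + 1) ^ 2)

/-- The parameter `w = u² q^{-(1+2γ)}`, for which `u^{2d(P)} |P|^{-(1+2γ)} = w^{d(P)}`. -/
def localParam (q : ℕ) (u γ : ℂ) : ℂ := u ^ 2 * (q : ℂ) ^ (-(1 + 2 * γ))

theorem norm_localParam_lt {q : ℕ} (hq : 1 < q) {u γ : ℂ} (hu : ‖u‖ < (q : ℝ) ^ γ.re) :
    ‖localParam q u γ‖ < (q : ℝ)⁻¹ := by
  have hq0 : (0 : ℝ) < q := by positivity
  have hpos : 0 < (q : ℝ) ^ (-(1 + 2 * γ)).re := Real.rpow_pos_of_pos hq0 _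
  have hn : ‖(q : ℂ) ^ (-(1 + 2 * γ))‖ = (q : ℝ) ^ (-(1 + 2 * γ)).re := by
    have := Complex.norm_cpow_eq_rpow_re_of_pos hq0 (-(1 + 2 * γ))
    simpa using this
  have hsq : ‖u‖ ^ 2 < ((q : ℝ) ^ γ.re) ^ 2 := by gcongr
  calc ‖localParam q u γ‖ = ‖u‖ ^ 2 * (q : ℝ) ^ (-(1 + 2 * γ)).re := by
        rw [localParam, norm_mul, norm_pow, hn]
    _ < ((q : ℝ) ^ γ.re) ^ 2 * (q : ℝ) ^ (-(1 + 2 * γ)).re := by gcongr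
    _ = (q : ℝ)⁻¹ := by
        rw [← Real.rpow_natCast, ← Real.rpow_mul hq0.le, ← Real.rpow_add hq0,
          ← Real.rpow_neg_one]
        congr 1
        simp
        ring

theorem pow_mul_cpow_eq_localParam_pow {q : ℕ} (u γ : ℂ) (k d : ℕ) :
    u ^ (2 * k * d) * (q : ℂ) ^ (-(k : ℂ) * (1 + 2 * γ) * (d : ℂ)) =
      localParam q u γ ^ (k * d) := by
  rw [localParam, mul_pow, ← pow_mul, ← Complex.cpow_nat_mul, mul_assoc 2 k d]
  congr 2
  push_cast
  ring

/-- The sum of `d(P) r^{d(P)}` over all polynomials converges for `0 ≤ r < 1/q`. -/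
theorem summable_natDegree_mul_pow {q : ℕ} (hq : 1 < q) {r : ℝ} (hr0 : 0 ≤ r)
    (hr : r < (q : ℝ)⁻¹) :
    Summable fun P : Polynomial (ZMod q) => (P.natDegree : ℝ) * r ^ P.natDegree := by
  have : NeZero q := ⟨by omega⟩
  have hq0 : (0 : ℝ) < q := by positivity
  let coeffs : Polynomial (ZMod q) → Σ n : ℕ, (Fin (n + 1) → ZMod q) :=
    fun P => ⟨P.natDegree, fun i => P.coeff i⟩
  let ofCoeffs : (Σ n : ℕ, (Fin (n + 1) → ZMod q)) → Polynomial (ZMod q) :=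
    fun x => ∑ i, C (x.2 i) * X ^ (i : ℕ)
  have hinj : Function.Injective coeffs := by
    refine Function.LeftInverse.injective (g := ofCoeffs) fun P => ?_
    simp only [coeffs, ofCoeffs]
    rw [Fin.sum_univ_eq_sum_range (fun i => C (P.coeff i) * X ^ i),
      ← Polynomial.as_sum_range_C_mul_X_pow]
  have hcard (n : ℕ) : ∑' _ : Fin (n + 1) → ZMod q, (n : ℝ) * r ^ n =
      q * ((n : ℝ) ^ 1 * (q * r) ^ n) := by
    rw [tsum_const, Nat.card_eq_fintype_card, Fintype.card_fun, ZMod.card, Fintype.card_fin,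
      nsmul_eq_mul]
    push_cast
    ring
  have hqr : ‖(q : ℝ) * r‖ < 1 := by
    rw [Real.norm_of_nonneg (by positivity)]
    calc (q : ℝ) * r < q * (q : ℝ)⁻¹ := by gcongr
      _ = 1 := mul_inv_cancel₀ hq0.ne'
  have hsum : Summable fun x : Σ n : ℕ, (Fin (n + 1) → ZMod q) => (x.1 : ℝ) * r ^ x.1 := by
    refine (summable_sigma_of_nonneg fun x => by positivity).mpr
      ⟨fun n => Summable.of_finite, ?_⟩
    simp only [hcard]
    exact (summable_pow_mul_geometric_of_norm_lt_one 1 hqr).mul_left (q : ℝ)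
  have hcomp := hsum.comp_injective hinj
  exact hcomp

section Abstract

variable {M : Type*} {d : M → ℕ} {w : ℂ}

theorem summable_norm_mul_pow_succ_mul (hd : ∀ P, 1 ≤ d P) (hw : ‖w‖ < 1)
    (hs : Summable fun P => (d P : ℝ) * ‖w‖ ^ d P) :
    Summable fun x : ℕ × M => ‖(d x.2 : ℂ) * w ^ ((x.1 + 1) * d x.2)‖ := by
  have hprod := (summable_geometric_of_lt_one (norm_nonneg w) hw).mul_of_nonneg hs
    (fun k => by positivity) (fun P => by positivity)
  refine hprod.of_nonneg_of_le (fun x => norm_nonneg _) fun x => ?_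
  have hpow : ‖w‖ ^ (x.1 * d x.2) ≤ ‖w‖ ^ x.1 :=
    pow_le_pow_of_le_one (norm_nonneg w) hw.le (Nat.le_mul_of_pos_right _ (hd _))
  calc ‖(d x.2 : ℂ) * w ^ ((x.1 + 1) * d x.2)‖
      = ‖w‖ ^ (x.1 * d x.2) * ((d x.2 : ℝ) * ‖w‖ ^ d x.2) := by
        simp [add_mul, pow_add]; ring
    _ ≤ _ := by gcongr

theorem hasSum_pow_succ_mul {n : ℕ} (hn : 1 ≤ n) (hw : ‖w‖ < 1) :
    HasSum (fun k : ℕ => w ^ ((k + 1) * n)) (w ^ n / (1 - w ^ n)) := by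
  have hlt : ‖w ^ n‖ < 1 := by
    rw [norm_pow]
    exact pow_lt_one₀ (norm_nonneg w) hw (by omega)
  have hgeom := (hasSum_geometric_of_norm_lt_one hlt).mul_left (w ^ n)
  rw [← div_eq_mul_inv] at hgeom
  refine hgeom.congr_fun fun k => ?_
  rw [← pow_mul, ← pow_add]
  ring

theorem hasSum_weighted_pow_succ_mul (hd : ∀ P, 1 ≤ d P) (hw : ‖w‖ < 1)
    (hs : Summable fun P => (d P : ℝ) * ‖w‖ ^ d P) {A : M → ℂ} (hA : ∀ P, ‖A P‖ ≤ 1) :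
    Summable (fun x : ℕ × M => ‖(d x.2 : ℂ) * w ^ ((x.1 + 1) * d x.2) * A x.2‖) ∧
    HasSum (fun P => (d P : ℂ) * (w ^ d P / (1 - w ^ d P)) * A P)
      (∑' x : ℕ × M, (d x.2 : ℂ) * w ^ ((x.1 + 1) * d x.2) * A x.2) := by
  have hnorm : Summable (fun x : ℕ × M => ‖(d x.2 : ℂ) * w ^ ((x.1 + 1) * d x.2) * A x.2‖) := by
    refine (summable_norm_mul_pow_succ_mul hd hw hs).of_nonneg_of_le
      (fun x => norm_nonneg _) fun x => ?_
    rw [norm_mul]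
    exact mul_le_of_le_one_right (norm_nonneg _) (hA _)
  refine ⟨hnorm, ?_⟩
  have hswap := (Equiv.prodComm M ℕ).hasSum_iff.mpr hnorm.of_norm.hasSum
  exact hswap.prod_fiberwise fun P =>
    ((hasSum_pow_succ_mul (hd P) hw).mul_left (d P : ℂ)).mul_right (A P)

/-- Summing the diagonal `P = Q` of a product of two weighted power series. -/
theorem hasSum_diagonal {a b : ℂ} (hd : ∀ P, 1 ≤ d P) (ha : ‖a‖ < 1) (hb : ‖b‖ < 1)
    (hsa : Summable fun P => (d P : ℝ) * ‖a‖ ^ d P)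
    (hsb : Summable fun P => (d P : ℝ) * ‖b‖ ^ d P) {B : M → ℂ} (hB : ∀ P, ‖B P‖ ≤ 1) :
    ∃ s : ℂ,
      HasSum (fun x : ℕ × ℕ × M × M => if x.2.2.1 = x.2.2.2 then
        ((d x.2.2.1 : ℂ) * a ^ ((x.1 + 1) * d x.2.2.1)) *
          ((d x.2.2.2 : ℂ) * b ^ ((x.2.1 + 1) * d x.2.2.2)) * B x.2.2.1 else 0) s ∧
      HasSum (fun P => ((d P : ℂ) * (a ^ d P / (1 - a ^ d P))) *
        ((d P : ℂ) * (b ^ d P / (1 - b ^ d P))) * B P) s := by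
  let diag : M × ℕ × ℕ → (ℕ × M) × ℕ × M := fun y => ((y.2.1, y.1), (y.2.2, y.1))
  have hdiag : Function.Injective diag := by
    rintro ⟨P, k, l⟩ ⟨P', k', l'⟩ h
    simp only [diag, Prod.mk.injEq] at h ⊢
    tauto
  have hsum : Summable fun y : M × ℕ × ℕ =>
      ((d y.1 : ℂ) * a ^ ((y.2.1 + 1) * d y.1)) * ((d y.1 : ℂ) * b ^ ((y.2.2 + 1) * d y.1)) *
        B y.1 := by
    refine Summable.of_norm_bounded (((summable_norm_mul_pow_succ_mul hd ha hsa).mul_of_nonneg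
      (summable_norm_mul_pow_succ_mul hd hb hsb) (fun _ => norm_nonneg _)
      (fun _ => norm_nonneg _)).comp_injective hdiag) fun y => ?_
    rw [norm_mul, norm_mul _ ((d y.1 : ℂ) * b ^ _)]
    exact mul_le_of_le_one_right (by positivity) (hB _)
  let emb : M × ℕ × ℕ → ℕ × ℕ × M × M := fun y => (y.2.1, y.2.2, y.1, y.1)
  have hemb : Function.Injective emb := by
    rintro ⟨P, k, l⟩ ⟨P', k', l'⟩ h
    simp only [emb, Prod.mk.injEq] at h ⊢
    tauto
  refine ⟨_, (hemb.hasSum_iff ?_).mp ?_, hsum.hasSum.prod_fiberwise fun P => ?_⟩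
  · rintro ⟨k, l, P, Q⟩ hx
    refine if_neg fun h : P = Q => hx ⟨(P, k, l), ?_⟩
    simp [emb, h]
  · simpa [emb, Function.comp_def] using hsum.hasSum
  · have hga := (hasSum_pow_succ_mul (hd P) ha).mul_left (d P : ℂ)
    have hgb := (hasSum_pow_succ_mul (hd P) hb).mul_left (d P : ℂ)
    have hprod := summable_mul_of_summable_norm hga.summable.norm hgb.summable.norm
    exact (hga.mul hgb hprod).mul_right (B P)

theorem hasSum_mul_reindex {f g : ℕ × M → ℂ} (hf : Summable fun x => ‖f x‖)
    (hg : Summable fun x => ‖g x‖) :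
    HasSum (fun x : ℕ × ℕ × M × M => f (x.1, x.2.2.1) * g (x.2.1, x.2.2.2))
      ((∑' x, f x) * ∑' x, g x) := by
  let e : ℕ × ℕ × M × M ≃ (ℕ × M) × ℕ × M :=
    ⟨fun x => ((x.1, x.2.2.1), (x.2.1, x.2.2.2)), fun y => (y.1.1, y.2.1, y.1.2, y.2.2),
      fun _ => rfl, fun _ => rfl⟩
  exact e.hasSum_iff.mpr
    (hf.of_norm.hasSum.mul hg.of_norm.hasSum (summable_mul_of_summable_norm hf hg))

end Abstract

theorem pow_div_cpow_sub_pow {q : ℕ} (hq : 0 < q) (u γ : ℂ) (n : ℕ) :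
    u ^ (2 * n) / ((q : ℂ) ^ ((n : ℂ) * (1 + 2 * γ)) - u ^ (2 * n)) =
      localParam q u γ ^ n / (1 - localParam q u γ ^ n) := by
  have hq0 : (q : ℂ) ≠ 0 := by exact_mod_cast hq.ne'
  have hC : (q : ℂ) ^ ((n : ℂ) * (1 + 2 * γ)) ≠ 0 := by
    simp [Complex.cpow_eq_zero_iff, hq0]
  have hw : localParam q u γ ^ n = u ^ (2 * n) / (q : ℂ) ^ ((n : ℂ) * (1 + 2 * γ)) := by
    have h := pow_mul_cpow_eq_localParam_pow (q := q) u γ 1 n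
    rw [one_mul, mul_one] at h
    rw [← h, div_eq_mul_inv, ← Complex.cpow_neg]
    congr 2
    push_cast
    ring
  rw [hw, one_sub_div hC, div_div_div_cancel_right₀ hC]

theorem norm_div_add_one_le (x : ℕ) : ‖(x : ℂ) / (x + 1)‖ ≤ 1 := by
  rw [norm_div, ← Nat.cast_add_one, Complex.norm_natCast, Complex.norm_natCast]
  push_cast
  exact div_le_one_of_le₀ (by linarith) (by positivity)

theorem norm_div_add_one_sq_le (x : ℕ) : ‖(x : ℂ) / (x + 1) ^ 2‖ ≤ 1 := by
  rw [norm_div, norm_pow, ← Nat.cast_add_one, Complex.norm_natCast, Complex.norm_natCast]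
  push_cast
  have : (0 : ℝ) ≤ x := by positivity
  exact div_le_one_of_le₀ (by nlinarith) (by positivity)

theorem Wfac_eq (q : ℕ) (P Q : MonicIrr q) :
    Wfac q P Q =
      ((q ^ P.1.natDegree : ℕ) : ℂ) / ((q ^ P.1.natDegree : ℕ) + 1) *
        (((q ^ Q.1.natDegree : ℕ) : ℂ) / ((q ^ Q.1.natDegree : ℕ) + 1)) +
      if P = Q then ((q ^ P.1.natDegree : ℕ) : ℂ) / ((q ^ P.1.natDegree : ℕ) + 1) ^ 2
      else 0 := by
  have h (n : ℕ) : (q : ℂ) ^ n + 1 ≠ 0 := by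
    exact_mod_cast Nat.succ_ne_zero (q ^ n)
  have hP := h P.1.natDegree
  have hQ := h Q.1.natDegree
  unfold Wfac
  push_cast
  split_ifs with hPQ
  · subst hPQ
    field_simp
    ring
  · field_simp
    ring

theorem Sterm_eq {q : ℕ} (hq : 0 < q) (u γ : ℂ) (P : MonicIrr q) :
    Sterm q u γ P = (P.1.natDegree : ℂ) *
      (localParam q u γ ^ P.1.natDegree / (1 - localParam q u γ ^ P.1.natDegree)) *
      (((q ^ P.1.natDegree : ℕ) : ℂ) / ((q ^ P.1.natDegree : ℕ) + 1)) := by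
  rw [Sterm, ← pow_div_cpow_sub_pow hq]
  push_cast
  simp only [div_eq_mul_inv, mul_inv]
  ring

theorem eeRHSterm_eq {q : ℕ} (hq : 0 < q) (u α β : ℂ) (P : MonicIrr q) :
    eeRHSterm q u α β P = ((P.1.natDegree : ℂ) *
      (localParam q u α ^ P.1.natDegree / (1 - localParam q u α ^ P.1.natDegree))) *
      ((P.1.natDegree : ℂ) *
      (localParam q u β ^ P.1.natDegree / (1 - localParam q u β ^ P.1.natDegree))) *
      (((q ^ P.1.natDegree : ℕ) : ℂ) / ((q ^ P.1.natDegree : ℕ) + 1) ^ 2) := by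
  rw [eeRHSterm, ← pow_div_cpow_sub_pow hq, ← pow_div_cpow_sub_pow hq]
  push_cast
  simp only [div_eq_mul_inv, mul_inv]
  ring

theorem eeTerm_eq (q : ℕ) (u α β : ℂ) (x : ℕ × ℕ × MonicIrr q × MonicIrr q) :
    eeTerm q u α β x =
      ((x.2.2.1.1.natDegree : ℂ) * localParam q u α ^ ((x.1 + 1) * x.2.2.1.1.natDegree)) *
      ((x.2.2.2.1.natDegree : ℂ) * localParam q u β ^ ((x.2.1 + 1) * x.2.2.2.1.natDegree)) *
      Wfac q x.2.2.1 x.2.2.2 := by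
  rw [eeTerm, pow_add, ← pow_mul_cpow_eq_localParam_pow, ← pow_mul_cpow_eq_localParam_pow]
  ring

/-- the even-even diagonal of the two level density:
`∑_{k,l ≥ 1} ∑_{P,Q} d(P) d(Q) u^{2kd(P)+2ld(Q)} |P|^{-k(1+2α)} |Q|^{-l(1+2β)} W(P,Q)
  = S(α) S(β) + ∑_P d(P)² |P| u^{4d(P)} / ((|P|^{1+2α}-u^{2d(P)})(|P|^{1+2β}-u^{2d(P)})(|P|+1)²)`,
all the sums converging absolutely, for `Re α, Re β > -1/2` and
`|u| < q^{min(0, Re α, Re β)}`. -/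
theorem statement15 (q : ℕ) (hq : q.Prime) (α β u : ℂ)
    (hα : -(1 / 2) < α.re) (hβ : -(1 / 2) < β.re)
    (hu : ‖u‖ < (q : ℝ) ^ (min (min 0 α.re) β.re)) :
    Summable (eeTerm q u α β) ∧ Summable (Sterm q u α) ∧ Summable (Sterm q u β) ∧
      Summable (eeRHSterm q u α β) ∧
      ∑' x : ℕ × ℕ × MonicIrr q × MonicIrr q, eeTerm q u α β x
        = (∑' P : MonicIrr q, Sterm q u α P) * (∑' P : MonicIrr q, Sterm q u β P)
          + ∑' P : MonicIrr q, eeRHSterm q u α β P := by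
  have hq1 : 1 < q := hq.one_lt
  have hq1' : (1 : ℝ) ≤ q := by exact_mod_cast hq1.le
  have : Fact q.Prime := ⟨hq⟩
  have ha : ‖localParam q u α‖ < (q : ℝ)⁻¹ :=
    norm_localParam_lt hq1 (hu.trans_le (Real.rpow_le_rpow_of_exponent_le hq1'
      ((min_le_left _ _).trans (min_le_right _ _))))
  have hb : ‖localParam q u β‖ < (q : ℝ)⁻¹ :=
    norm_localParam_lt hq1 (hu.trans_le (Real.rpow_le_rpow_of_exponent_le hq1'
      (min_le_right _ _)))
  have hqinv : (q : ℝ)⁻¹ ≤ 1 := inv_le_one_of_one_le₀ hq1'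
  have hsum {w : ℂ} (hw : ‖w‖ < (q : ℝ)⁻¹) :
      Summable fun P : MonicIrr q => (P.1.natDegree : ℝ) * ‖w‖ ^ P.1.natDegree :=
    (summable_natDegree_mul_pow hq1 (norm_nonneg w) hw).comp_injective
      Subtype.val_injective
  have hd (P : MonicIrr q) : 1 ≤ P.1.natDegree := P.2.2.natDegree_pos
  obtain ⟨hna, hSa⟩ := hasSum_weighted_pow_succ_mul hd (ha.trans_le hqinv) (hsum ha)
    fun P => norm_div_add_one_le (q ^ P.1.natDegree)
  obtain ⟨hnb, hSb⟩ := hasSum_weighted_pow_succ_mul hd (hb.trans_le hqinv) (hsum hb)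
    fun P => norm_div_add_one_le (q ^ P.1.natDegree)
  obtain ⟨s, hs, hR⟩ := hasSum_diagonal hd (ha.trans_le hqinv) (hb.trans_le hqinv)
    (hsum ha) (hsum hb) fun P => norm_div_add_one_sq_le (q ^ P.1.natDegree)
  simp only [← Sterm_eq hq.pos] at hSa hSb
  simp only [← eeRHSterm_eq hq.pos] at hR
  have hee := ((hasSum_mul_reindex hna hnb).add hs).congr_fun (g := eeTerm q u α β)
    fun x => by
      rw [eeTerm_eq, Wfac_eq]
      split_ifs <;> ring
  refine ⟨hee.summable, hSa.summable, hSb.summable, hR.summable, ?_⟩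
  rw [hee.tsum_eq, hSa.tsum_eq, hSb.tsum_eq, hR.tsum_eq]
end
end
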